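/- Let r ≥ 1 be an integer, 0 < a ≤ 1, and let σ satisfy r − 1/2 < σ < r. Then, as T → ∞, ∫_1^T |ζ_r(σ+it, a, 𝟏)|² dt = (Σ_{0 ≤ k,l ≤ r−1} p_{r,k}(a) p_{r,l}(a) ζ_H(2σ−k−l, a)) · T + (1/((r−1)!)²) · ((2π)^{2σ−2r+1}/(2r−2σ)) · ζ(2r−2σ) · T^{2r−2σ} + O(T^{r−σ} log T), where ζ denotes the Riemann zeta function. -/

import Mathlib

open Complex Filter Finset MeasureTheory

/-- The Hurwitz zeta function `ζ_H(s,a)` (meromorphic continuation of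
`∑ m, (m+a)^{-s}`). -/
noncomputable def hzeta (a : ℝ) (s : ℂ) : ℂ := HurwitzZeta.hurwitzZeta (a : UnitAddCircle) s

/-- `p_{r,j}(a)`: the coefficient of `X^j` in `(1/(r-1)!) ∏_{i=1}^{r-1} (X + i - a)`. -/
noncomputable def pCoeff (r : ℕ) (a : ℝ) (j : ℕ) : ℝ :=
  ((Nat.factorial (r - 1) : ℝ)⁻¹ •
    ∏ i ∈ Finset.range (r - 1), (Polynomial.X + Polynomial.C ((i : ℝ) + 1 - a))).coeff j

/-- The Hurwitz multiple zeta function `ζ_r(s,a,𝟏) = ∑_{j=0}^{r-1} p_{r,j}(a) ζ_H(s-j,a)`. -/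
noncomputable def zetaR (r : ℕ) (a : ℝ) (s : ℂ) : ℂ :=
  ∑ j ∈ Finset.range r, (pCoeff r a j : ℂ) * hzeta a (s - j)

lemma norm_cpow_neg_sub_integral_le {x : ℝ} (hx : 0 < x) {s : ℂ} (hs : 0 < s.re) (hs1 : s ≠ 1) :
    ‖(x : ℂ) ^ (-s) - (((x + 1 : ℝ) : ℂ) ^ (1 - s) - (x : ℂ) ^ (1 - s)) / (1 - s)‖ ≤
      ‖s‖ * x ^ (-s.re - 1) := by
  have hs1' : 1 - s ≠ 0 := sub_ne_zero.mpr hs1.symm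
  have hpos : ∀ y ∈ Set.Icc (0 : ℝ) 1, 0 < x + y := fun y hy => by linarith [hy.1]
  have hder : ∀ (c : ℂ) (hc : c ≠ 0) (y : ℝ), y ∈ Set.Icc (0 : ℝ) 1 →
      HasDerivAt (fun y : ℝ => ((x + y : ℝ) : ℂ) ^ c) (c * ((x + y : ℝ) : ℂ) ^ (c - 1)) y := by
    intro c hc y hy
    have h1 := (hasDerivAt_ofReal_cpow_const' (hpos y hy).ne' (r := c - 1)
      (by intro h; apply hc; linear_combination h)).const_mul c
    have h2 := h1.comp_const_add x y
    simpa [mul_div_cancel₀ _ hc] using h2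
  have hb : ∀ y ∈ Set.Icc (0 : ℝ) 1,
      ‖(x : ℂ) ^ (-s) - ((x + y : ℝ) : ℂ) ^ (-s)‖ ≤ ‖s‖ * x ^ (-s.re - 1) := by
    intro y hy
    have hmv := (convex_Icc (0 : ℝ) 1).norm_image_sub_le_of_norm_hasDerivWithin_le
      (f := fun y : ℝ => ((x + y : ℝ) : ℂ) ^ (-s))
      (f' := fun y : ℝ => -s * ((x + y : ℝ) : ℂ) ^ (-s - 1))
      (C := ‖s‖ * x ^ (-s.re - 1))
      (fun z hz => (hder (-s) (by
        intro h; rw [neg_eq_zero] at h; simp [h] at hs) z hz).hasDerivWithinAt)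
      (by
        intro z hz
        rw [norm_mul, norm_neg, norm_cpow_eq_rpow_re_of_pos (hpos z hz)]
        gcongr
        simp only [sub_re, neg_re, one_re]
        exact Real.rpow_le_rpow_of_nonpos hx (by linarith [hz.1]) (by linarith))
      hy (Set.left_mem_Icc.mpr zero_le_one)
    simp only [add_zero, zero_sub, norm_neg, Real.norm_eq_abs, abs_of_nonneg hy.1] at hmv
    refine hmv.trans ?_
    have : 0 ≤ ‖s‖ * x ^ (-s.re - 1) := by positivity
    nlinarith [hy.2]
  have := norm_image_sub_le_of_norm_deriv_le_segment_01'
    (f := fun y : ℝ => (x : ℂ) ^ (-s) * y - (((x + y : ℝ) : ℂ) ^ (1 - s)) / (1 - s))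
    (f' := fun y : ℝ => (x : ℂ) ^ (-s) - ((x + y : ℝ) : ℂ) ^ (-s))
    (C := ‖s‖ * x ^ (-s.re - 1))
    (fun y hy => by
      have h1 := (hder (1 - s) hs1' y hy).div_const (1 - s)
      rw [mul_div_cancel_left₀ _ hs1', show 1 - s - 1 = -s by ring] at h1
      have h2 := (ofRealCLM.hasDerivAt (x := y)).const_mul ((x : ℂ) ^ (-s))
      simp only [ofRealCLM_apply, ofReal_one, mul_one] at h2
      exact (h2.sub h1).hasDerivWithinAt)
    (fun y hy => hb y ⟨hy.1, hy.2.le⟩)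
  refine le_of_eq_of_le (congrArg norm ?_) this
  simp only [ofReal_one, mul_one, ofReal_zero, mul_zero, add_zero]
  ring

lemma summable_add_rpow {x : ℝ} (hx : 0 < x) {p : ℝ} (hp : p < -1) :
    Summable fun m : ℕ => ((m : ℝ) + x) ^ p := by
  have h := (Real.summable_one_div_nat_add_rpow x (-p)).mpr (by linarith)
  refine h.congr fun m => ?_
  have : 0 < (m : ℝ) + x := by positivity
  rw [abs_of_pos this, Real.rpow_neg this.le, one_div, inv_inv]

lemma rpow_neg_sub_one_mul_le {x : ℝ} (hx : 0 < x) {σ : ℝ} (hσ : 0 < σ) :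
    (x + 1) ^ (-σ - 1) * σ ≤ x ^ (-σ) - (x + 1) ^ (-σ) := by
  have hy : 0 < x + 1 := by linarith
  have h1 : x ^ (-σ) = (x + 1) ^ (-σ) * Real.exp (σ * Real.log ((x + 1) / x)) := by
    rw [Real.rpow_def_of_pos hx, Real.rpow_def_of_pos hy, ← Real.exp_add,
      Real.log_div hy.ne' hx.ne']
    ring_nf
  have h2 : σ * (x + 1)⁻¹ ≤ Real.exp (σ * Real.log ((x + 1) / x)) - 1 := by
    have h3 := Real.one_sub_inv_le_log_of_pos (x := (x + 1) / x) (by positivity)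
    have h4 : 1 - ((x + 1) / x)⁻¹ = (x + 1)⁻¹ := by field_simp; ring
    have h5 := Real.add_one_le_exp (σ * Real.log ((x + 1) / x))
    have := mul_le_mul_of_nonneg_left h3 hσ.le
    rw [h4] at this
    linarith
  rw [h1, Real.rpow_sub_one hy.ne']
  have h6 : 0 ≤ (x + 1) ^ (-σ) := by positivity
  calc _ = (x + 1) ^ (-σ) * (σ * (x + 1)⁻¹) := by ring
    _ ≤ (x + 1) ^ (-σ) * (Real.exp (σ * Real.log ((x + 1) / x)) - 1) := by gcongr
    _ = _ := by ring

lemma tsum_add_rpow_le {x : ℝ} (hx : 0 < x) {σ : ℝ} (hσ : 0 < σ) :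
    ∑' m : ℕ, ((m : ℝ) + x) ^ (-σ - 1) ≤ x ^ (-σ - 1) + x ^ (-σ) / σ := by
  refine Real.tsum_le_of_sum_range_le (fun m => by positivity) fun n => ?_
  have key : ∀ n : ℕ, ∑ m ∈ range (n + 1), ((m : ℝ) + x) ^ (-σ - 1) ≤
      x ^ (-σ - 1) + (x ^ (-σ) - (n + x) ^ (-σ)) / σ := by
    intro n
    induction n with
    | zero => simp
    | succ n ih =>
      rw [sum_range_succ]
      have := rpow_neg_sub_one_mul_le (x := n + x) (by positivity) hσ
      rw [← le_div_iff₀ hσ] at this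
      have e : ((n + 1 : ℕ) : ℝ) + x = n + x + 1 := by push_cast; ring
      rw [e]
      calc _ ≤ x ^ (-σ - 1) + (x ^ (-σ) - (n + x) ^ (-σ)) / σ +
            ((n + x) ^ (-σ) - (n + x + 1) ^ (-σ)) / σ := by gcongr
        _ = _ := by ring
  rcases n with _ | n
  · simp; positivity
  · refine (key n).trans ?_
    have : 0 ≤ ((n : ℝ) + x) ^ (-σ) := by positivity
    gcongr
    linarith

/-- The `m`-th term of the Euler–Maclaurin series of `ζ_H`, multiplied by `s - 1`. -/
noncomputable def emTerm (a : ℝ) (m : ℕ) (s : ℂ) : ℂ :=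
  (s - 1) * ((m + a : ℝ) : ℂ) ^ (-s) + (((m + a + 1 : ℝ) : ℂ) ^ (1 - s) - ((m + a : ℝ) : ℂ) ^ (1 - s))

lemma emTerm_eq {a : ℝ} {m : ℕ} {s : ℂ} (hs1 : s ≠ 1) :
    emTerm a m s = (s - 1) * (((m + a : ℝ) : ℂ) ^ (-s) -
      (((m + a + 1 : ℝ) : ℂ) ^ (1 - s) - ((m + a : ℝ) : ℂ) ^ (1 - s)) / (1 - s)) := by
  have : 1 - s ≠ 0 := sub_ne_zero.mpr hs1.symm
  rw [emTerm]
  field_simp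
  ring

lemma norm_emTerm_le {a : ℝ} (ha : 0 < a) (m : ℕ) {s : ℂ} (hs : 0 < s.re) :
    ‖emTerm a m s‖ ≤ ‖s - 1‖ * (‖s‖ * ((m : ℝ) + a) ^ (-s.re - 1)) := by
  by_cases hs1 : s = 1
  · subst hs1; simp [emTerm]
  · rw [emTerm_eq hs1, norm_mul]
    gcongr
    exact norm_cpow_neg_sub_integral_le (by positivity) hs hs1

lemma differentiable_emTerm {a : ℝ} (ha : 0 < a) (m : ℕ) : Differentiable ℂ (emTerm a m) := by
  have h1 : ((m + a : ℝ) : ℂ) ≠ 0 := ofReal_ne_zero.mpr (by positivity)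
  have h2 : ((m + a + 1 : ℝ) : ℂ) ≠ 0 := ofReal_ne_zero.mpr (by positivity)
  unfold emTerm
  intro s
  have := (differentiableAt_id (𝕜 := ℂ) (x := s)).neg.const_cpow (c := ((m + a : ℝ) : ℂ)) (Or.inl h1)
  have h3 := ((differentiableAt_const (1 : ℂ)).sub (differentiableAt_id (𝕜 := ℂ) (x := s))).const_cpow
    (c := ((m + a : ℝ) : ℂ)) (Or.inl h1)
  have h4 := ((differentiableAt_const (1 : ℂ)).sub (differentiableAt_id (𝕜 := ℂ) (x := s))).const_cpow
    (c := ((m + a + 1 : ℝ) : ℂ)) (Or.inl h2)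
  exact ((differentiableAt_id.sub (differentiableAt_const _)).mul this).add (h4.sub h3)

lemma differentiableOn_tsum_emTerm {a : ℝ} (ha : 0 < a) :
    DifferentiableOn ℂ (fun s => ∑' m, emTerm a m s) {s | 0 < s.re} := by
  intro s hs
  have hs' : 0 < s.re := hs
  set U : Set ℂ := {w | s.re / 2 < w.re} ∩ {w | ‖w‖ < ‖s‖ + 1} with hU
  have hUo : IsOpen U := (isOpen_lt continuous_const continuous_re).inter
    (isOpen_lt continuous_norm continuous_const)
  have hsU : s ∈ U := ⟨by show s.re / 2 < s.re; linarith, by simp [Set.mem_ofPred_eq]⟩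
  have hsum : Summable fun m : ℕ => (‖s‖ + 2) * ((‖s‖ + 1) *
      (max 1 (a ^ (-(‖s‖ + 1) - 1)) * (((m : ℝ) + a) ^ (-(s.re / 2) - 1)) +
        ((m : ℝ) + a) ^ (-(s.re / 2) - 1))) := by
    have := summable_add_rpow ha (p := -(s.re / 2) - 1) (by linarith)
    exact (((this.mul_left _).add this).mul_left _).mul_left _
  refine DifferentiableOn.differentiableAt (s := U) ?_ (hUo.mem_nhds hsU) |>.differentiableWithinAt
  refine differentiableOn_tsum_of_summable_norm hsum
    (fun m => (differentiable_emTerm ha m).differentiableOn) hUo fun m w hw => ?_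
  have hw1 : s.re / 2 < w.re := hw.1
  have hw2 : ‖w‖ < ‖s‖ + 1 := hw.2
  refine (norm_emTerm_le ha m (by linarith)).trans ?_
  have h3 : ‖w - 1‖ ≤ ‖s‖ + 2 := (norm_sub_le _ _).trans (by simp; linarith)
  gcongr
  rcases le_total 1 ((m : ℝ) + a) with h | h
  · have h5 : ((m : ℝ) + a) ^ (-w.re - 1) ≤ ((m : ℝ) + a) ^ (-(s.re / 2) - 1) :=
      Real.rpow_le_rpow_of_exponent_le h (by linarith)
    have : 0 ≤ max 1 (a ^ (-(‖s‖ + 1) - 1)) * (((m : ℝ) + a) ^ (-(s.re / 2) - 1)) := by positivity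
    linarith
  · have hm : (0 : ℝ) ≤ m := by positivity
    have h0 : 0 < (m : ℝ) + a := by positivity
    have ha1 : a ≤ 1 := by linarith
    have hwre : w.re ≤ ‖w‖ := re_le_norm w
    have h5 : ((m : ℝ) + a) ^ (-w.re - 1) ≤ a ^ (-(‖s‖ + 1) - 1) :=
      (Real.rpow_le_rpow_of_nonpos ha (by linarith) (by linarith)).trans
        (Real.rpow_le_rpow_of_exponent_ge ha ha1 (by linarith))
    have h6 : 1 ≤ ((m : ℝ) + a) ^ (-(s.re / 2) - 1) :=
      Real.one_le_rpow_of_pos_of_le_one_of_nonpos h0 h (by linarith)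
    have h7 : a ^ (-(‖s‖ + 1) - 1) ≤ max 1 (a ^ (-(‖s‖ + 1) - 1)) := le_max_right _ _
    have h8 : 1 ≤ max 1 (a ^ (-(‖s‖ + 1) - 1)) := le_max_left _ _
    nlinarith

lemma summable_emTerm {a : ℝ} (ha : 0 < a) {s : ℂ} (hs : 0 < s.re) :
    Summable fun m => emTerm a m s :=
  Summable.of_norm_bounded
    (((summable_add_rpow ha (p := -s.re - 1) (by linarith)).mul_left _).mul_left _)
    (fun m => norm_emTerm_le ha m hs)

lemma sum_range_emTerm (a : ℝ) (s : ℂ) (M : ℕ) :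
    ∑ m ∈ range M, emTerm a m s = (s - 1) * ∑ m ∈ range M, ((m + a : ℝ) : ℂ) ^ (-s) +
      (((M + a : ℝ) : ℂ) ^ (1 - s) - (a : ℂ) ^ (1 - s)) := by
  have h : ∀ m : ℕ, (m + a + 1 : ℝ) = ((m + 1 : ℕ) : ℝ) + a := fun m => by push_cast; ring
  simp only [emTerm, sum_add_distrib, ← mul_sum, h]
  rw [sum_range_sub (fun m : ℕ => (((m : ℝ) + a : ℝ) : ℂ) ^ (1 - s))]
  simp

lemma hasSum_hzeta {a : ℝ} (ha : 0 < a) (ha1 : a ≤ 1) {s : ℂ} (hs : 1 < s.re) :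
    HasSum (fun m : ℕ => ((m + a : ℝ) : ℂ) ^ (-s)) (hzeta a s) := by
  have := HurwitzZeta.hasSum_hurwitzZeta_of_one_lt_re (a := a) ⟨ha.le, ha1⟩ hs
  have h : (fun m : ℕ => ((m + a : ℝ) : ℂ) ^ (-s)) = fun n : ℕ => 1 / ((n : ℂ) + a) ^ s := by
    funext m
    push_cast
    rw [cpow_neg, one_div]
  rw [h]
  exact this

lemma tendsto_add_cpow_zero (a : ℝ) {s : ℂ} (hs : s.re < 0) :
    Tendsto (fun M : ℕ => ((M + a : ℝ) : ℂ) ^ s) atTop (nhds 0) := by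
  have h1 : Tendsto (fun M : ℕ => (M : ℝ) + a) atTop atTop :=
    tendsto_atTop_add_const_right _ _ tendsto_natCast_atTop_atTop
  rw [tendsto_zero_iff_norm_tendsto_zero]
  have h2 := (tendsto_rpow_neg_atTop (y := -s.re) (by linarith)).comp h1
  refine h2.congr' ?_
  filter_upwards [h1.eventually_gt_atTop 0] with M hM
  rw [norm_cpow_eq_rpow_re_of_pos hM]
  simp

lemma tsum_emTerm {a : ℝ} (ha : 0 < a) (ha1 : a ≤ 1) {s : ℂ} (hs : 0 < s.re) (hs1 : s ≠ 1) :
    ∑' m, emTerm a m s = (s - 1) * hzeta a s - (a : ℂ) ^ (1 - s) := by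
  let P : ℂ → ℂ := fun s => (s - 1) * (HurwitzZeta.hurwitzZeta (a : UnitAddCircle) s -
    HurwitzZeta.hurwitzZeta 0 s) + (1 + (s - 1) * riemannZeta₀ s) - (a : ℂ) ^ (1 - s)
  have hP : ∀ s ≠ 1, P s = (s - 1) * hzeta a s - (a : ℂ) ^ (1 - s) := by
    intro s hs1
    have h := riemannZeta_eq_inv_sub_add hs1
    have h0 : s - 1 ≠ 0 := sub_ne_zero.mpr hs1
    simp only [P, hzeta, HurwitzZeta.hurwitzZeta_zero]
    rw [h]
    field_simp
    ring
  have hPd : Differentiable ℂ P := by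
    have h1 := HurwitzZeta.differentiable_hurwitzZeta_sub_hurwitzZeta (a : UnitAddCircle) 0
    have h2 : Differentiable ℂ fun s : ℂ => (a : ℂ) ^ (1 - s) := fun s =>
      ((differentiableAt_const (1 : ℂ)).sub differentiableAt_id).const_cpow
        (Or.inl (ofReal_ne_zero.mpr ha.ne'))
    have h3 : Differentiable ℂ fun s : ℂ => s - 1 := differentiable_id.sub_const 1
    exact ((h3.mul h1).add ((h3.mul differentiable_riemannZeta₀).const_add 1)).sub h2
  rw [← hP s hs1]
  have hU : IsOpen {s : ℂ | 0 < s.re} := isOpen_lt continuous_const continuous_re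
  have h1 : AnalyticOnNhd ℂ (fun s => ∑' m, emTerm a m s) {s | 0 < s.re} :=
    (differentiableOn_tsum_emTerm ha).analyticOnNhd hU
  have h2 : AnalyticOnNhd ℂ P {s | 0 < s.re} := hPd.differentiableOn.analyticOnNhd hU
  refine h1.eqOn_of_preconnected_of_eventuallyEq (z₀ := 2) h2
    (convex_halfSpace_re_gt 0).isPreconnected (by show (0:ℝ) < (2:ℂ).re; norm_num) ?_ hs
  have hV : {s : ℂ | 1 < s.re} ∈ nhds (2 : ℂ) :=
    (isOpen_lt continuous_const continuous_re).mem_nhds (by show (1:ℝ) < (2:ℂ).re; norm_num)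
  filter_upwards [hV] with w hw
  have hw' : 1 < w.re := hw
  have hw1 : w ≠ 1 := by rintro rfl; simp at hw'
  rw [hP w hw1]
  have hl := (summable_emTerm ha (s := w) (by linarith)).hasSum.tendsto_sum_nat
  refine tendsto_nhds_unique hl ?_
  simp only [sum_range_emTerm]
  have hz := (hasSum_hzeta ha ha1 hw').tendsto_sum_nat
  have ht := tendsto_add_cpow_zero a (s := 1 - w) (by simp; linarith)
  simpa [sub_eq_add_neg] using (hz.const_mul (w - 1)).add (ht.sub_const ((a : ℂ) ^ (1 - w)))

/-- First-order Euler–Maclaurin approximation of the Hurwitz zeta function. -/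
theorem norm_sum_sub_hzeta_le {a : ℝ} (ha : 0 < a) (ha1 : a ≤ 1) {s : ℂ} (hs : 0 < s.re)
    (hs1 : s ≠ 1) (M : ℕ) :
    ‖∑ m ∈ range M, ((m + a : ℝ) : ℂ) ^ (-s) - hzeta a s -
        ((M + a : ℝ) : ℂ) ^ (1 - s) / (1 - s)‖ ≤
      ‖s‖ * (((M : ℝ) + a) ^ (-s.re - 1) + ((M : ℝ) + a) ^ (-s.re) / s.re) := by
  have h0 : s - 1 ≠ 0 := sub_ne_zero.mpr hs1
  have h0' : 1 - s ≠ 0 := sub_ne_zero.mpr hs1.symm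
  have h1 := (summable_emTerm ha hs).sum_add_tsum_nat_add M
  rw [sum_range_emTerm, tsum_emTerm ha ha1 hs hs1] at h1
  have h2 : ∑ m ∈ range M, ((m + a : ℝ) : ℂ) ^ (-s) - hzeta a s -
        ((M + a : ℝ) : ℂ) ^ (1 - s) / (1 - s) = -(∑' m, emTerm a (m + M) s) / (s - 1) := by
    have h3 : ∑' m, emTerm a (m + M) s = (s - 1) * hzeta a s - (a : ℂ) ^ (1 - s) -
      ((s - 1) * ∑ m ∈ range M, ((m + a : ℝ) : ℂ) ^ (-s) +
      (((M + a : ℝ) : ℂ) ^ (1 - s) - (a : ℂ) ^ (1 - s))) := by rw [← h1]; ring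
    rw [h3, eq_div_iff h0, ← neg_sub s 1, div_neg, sub_neg_eq_add, add_mul, sub_mul,
      div_mul_cancel₀ _ h0]
    ring
  have hx : 0 < (M : ℝ) + a := by positivity
  have hcast : ∀ m : ℕ, (((m + M : ℕ) : ℝ) + a) = (m : ℝ) + (M + a) := fun m => by
    push_cast; ring
  rw [h2, norm_div, norm_neg, div_le_iff₀ (norm_pos_iff.mpr h0)]
  have hsum := ((summable_add_rpow hx (p := -s.re - 1) (by linarith)).mul_left ‖s‖).mul_left ‖s - 1‖
  have hb := tsum_of_norm_bounded hsum.hasSum (f := fun m => emTerm a (m + M) s) (fun m => by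
    have := norm_emTerm_le ha (m + M) hs
    rwa [hcast] at this)
  refine hb.trans ?_
  rw [tsum_mul_left, tsum_mul_left, mul_comm]
  gcongr
  exact tsum_add_rpow_le hx hs

lemma ofReal_cpow_neg_nat_add {a : ℝ} (ha : 0 < a) (m : ℕ) (p : ℝ) :
    ((m + a : ℝ) : ℂ) ^ (-(p : ℂ)) = ((((m : ℝ) + a) ^ (-p) : ℝ) : ℂ) := by
  rw [ofReal_cpow (by positivity)]
  push_cast
  rfl

lemma norm_sum_rpow_sub_hzeta_le {a : ℝ} (ha : 0 < a) (ha1 : a ≤ 1) {p : ℝ} (hp : 0 < p)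
    (hp1 : p ≠ 1) (M : ℕ) :
    ‖((∑ m ∈ range M, ((m : ℝ) + a) ^ (-p) - ((M : ℝ) + a) ^ (1 - p) / (1 - p) : ℝ) : ℂ) -
        hzeta a p‖ ≤ (p / a + 1) * ((M : ℝ) + a) ^ (-p) := by
  have h := norm_sum_sub_hzeta_le ha ha1 (s := (p : ℂ)) (by simpa using hp)
    (by exact_mod_cast hp1) M
  have e : (((M + a : ℝ) : ℂ)) ^ (1 - (p : ℂ)) = ((((M : ℝ) + a) ^ (1 - p) : ℝ) : ℂ) := by
    rw [ofReal_cpow (by positivity)]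
    push_cast
    rfl
  simp only [ofReal_cpow_neg_nat_add ha, e] at h
  have hx : 0 < (M : ℝ) + a := by positivity
  calc _ = _ := by
        congr 1
        push_cast
        ring
    _ ≤ _ := h
    _ ≤ _ := by
      simp only [ofReal_re, norm_real, Real.norm_eq_abs, abs_of_pos hp, Real.rpow_sub_one hx.ne']
      have h1 : ((M : ℝ) + a) ^ (-p) / ((M : ℝ) + a) ≤ ((M : ℝ) + a) ^ (-p) / a := by
        gcongr
        linarith [(Nat.cast_nonneg M : (0 : ℝ) ≤ M)]
      calc _ ≤ p * (((M : ℝ) + a) ^ (-p) / a + ((M : ℝ) + a) ^ (-p) / p) := by gcongr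
        _ = _ := by field_simp

lemma hzeta_ofReal_im {a : ℝ} (ha : 0 < a) (ha1 : a ≤ 1) {p : ℝ} (hp : 0 < p)
    (hp1 : p ≠ 1) : (hzeta a p).im = 0 := by
  have h1 : Tendsto (fun M : ℕ => (M : ℝ) + a) atTop atTop :=
    tendsto_atTop_add_const_right _ _ tendsto_natCast_atTop_atTop
  have h2 : Tendsto (fun M : ℕ => (p / a + 1) * ((M : ℝ) + a) ^ (-p)) atTop (nhds 0) := by
    simpa using ((tendsto_rpow_neg_atTop hp).comp h1).const_mul (p / a + 1)
  have h3 : |(hzeta a p).im| ≤ 0 := by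
    refine ge_of_tendsto' h2 fun M => ?_
    refine le_trans ?_ (norm_sum_rpow_sub_hzeta_le ha ha1 hp hp1 M)
    refine le_trans ?_ (abs_im_le_norm _)
    simp only [sub_im, ofReal_im, zero_sub, abs_neg, le_refl]
  exact abs_nonpos_iff.mp h3

lemma abs_sum_rpow_sub_le {a : ℝ} (ha : 0 < a) (ha1 : a ≤ 1) {p : ℝ} (hp : 0 < p)
    (hp1 : p ≠ 1) (M : ℕ) :
    |∑ m ∈ range M, ((m : ℝ) + a) ^ (-p) - ((M : ℝ) + a) ^ (1 - p) / (1 - p) - (hzeta a p).re| ≤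
      (p / a + 1) * ((M : ℝ) + a) ^ (-p) := by
  refine le_trans ?_ (norm_sum_rpow_sub_hzeta_le ha ha1 hp hp1 M)
  refine le_trans (le_of_eq ?_) (abs_re_le_norm _)
  simp only [sub_re, ofReal_re]

lemma abs_rpow_sub_rpow_le {x y p : ℝ} (hx : 0 < x) (hy : 0 < y) (hp0 : 0 ≤ p) (hp1 : p ≤ 1) :
    |x ^ p - y ^ p| ≤ |x - y| * x ^ (p - 1) := by
  have h : ∀ {u v : ℝ}, 0 < u → 0 < v → v ^ p - u ^ p ≤ p * (v - u) * u ^ (p - 1) := by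
    intro u v hu hv
    have h1 := rpow_one_add_le_one_add_mul_self (s := v / u - 1) (p := p)
      (by have : 0 < v / u := by positivity
          linarith) hp0 hp1
    rw [add_sub_cancel, Real.div_rpow hv.le hu.le, div_le_iff₀ (by positivity)] at h1
    rw [Real.rpow_sub_one hu.ne']
    calc _ ≤ (1 + p * (v / u - 1)) * u ^ p - u ^ p := by linarith
      _ = _ := by field_simp; ring
  rcases le_total x y with hxy | hxy
  · rw [abs_sub_comm, abs_of_nonneg (sub_nonneg.mpr (Real.rpow_le_rpow hx.le hxy hp0)),
      abs_sub_comm, abs_of_nonneg (sub_nonneg.mpr hxy)]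
    refine (h hx hy).trans ?_
    have : 0 ≤ (y - x) * x ^ (p - 1) := mul_nonneg (by linarith) (by positivity)
    nlinarith
  · rw [abs_of_nonneg (sub_nonneg.mpr (Real.rpow_le_rpow hy.le hxy hp0)),
      abs_of_nonneg (sub_nonneg.mpr hxy)]
    have h2 : x ^ p * (y / x) ≤ y ^ p := by
      have h3 : (y / x) ^ (1 : ℝ) ≤ (y / x) ^ p :=
        Real.rpow_le_rpow_of_exponent_ge (by positivity) ((div_le_one hx).mpr hxy) hp1
      rw [Real.rpow_one, Real.div_rpow hy.le hx.le, le_div_iff₀ (by positivity)] at h3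
      linarith
    rw [Real.rpow_sub_one hx.ne']
    calc _ ≤ x ^ p - x ^ p * (y / x) := by linarith
      _ = _ := by field_simp

lemma abs_sum_Ico_rpow_sub_le {a : ℝ} (ha : 0 < a) (ha1 : a ≤ 1) {q : ℝ} (hq : 0 < q)
    (hq1 : q < 1) {M B : ℕ} {z : ℝ} (hz : (M : ℝ) + a ≤ z) (hB : z < (B : ℝ) + a) :
    |∑ m ∈ Ico M B with ((m : ℕ) : ℝ) + a ≤ z, ((m : ℝ) + a) ^ (-q) -
        (z ^ (1 - q) - ((M : ℝ) + a) ^ (1 - q)) / (1 - q)| ≤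
      (2 * (q / a + 1) + 1 / (1 - q)) * ((M : ℝ) + a) ^ (-q) := by
  have hM0 : (0 : ℝ) ≤ M := Nat.cast_nonneg M
  set n := ⌊z - a⌋₊ + 1 with hn
  have hza : 0 ≤ z - a := by linarith
  have hn1 : z < n + a := by
    have := Nat.lt_floor_add_one (z - a)
    rw [hn]; push_cast; linarith
  have hn2 : (n : ℝ) + a ≤ z + 1 := by
    have := Nat.floor_le hza
    rw [hn]; push_cast; linarith
  have hset : {m ∈ Ico M B | ((m : ℕ) : ℝ) + a ≤ z} = Ico M n := by
    ext m
    simp only [mem_filter, mem_Ico]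
    have key : (m : ℝ) + a ≤ z ↔ m < n := by
      rw [hn, Nat.lt_succ_iff, Nat.le_floor_iff hza]
      constructor <;> intro h <;> linarith
    rw [key]
    constructor
    · rintro ⟨⟨h1, h2⟩, h3⟩; exact ⟨h1, h3⟩
    · rintro ⟨h1, h3⟩
      refine ⟨⟨h1, ?_⟩, h3⟩
      have h4 := key.mpr h3
      have : (m : ℝ) < B := by linarith
      exact_mod_cast this
  have hMn : M ≤ n := by
    have : (M : ℝ) < n := by linarith
    exact_mod_cast this.le
  rw [hset, sum_Ico_eq_sub _ hMn]
  have h1 := abs_sum_rpow_sub_le ha ha1 hq hq1.ne n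
  have h2 := abs_sum_rpow_sub_le ha ha1 hq hq1.ne M
  have hx : 0 < (M : ℝ) + a := by positivity
  have hzp : 0 < z := by linarith
  have h3 := abs_rpow_sub_rpow_le (x := z) (y := n + a) (p := 1 - q) hzp (by linarith)
    (by linarith) (by linarith)
  have h4 : |z - (n + a)| ≤ 1 := by rw [abs_le]; constructor <;> linarith
  have h5 : z ^ (1 - q - 1) ≤ ((M : ℝ) + a) ^ (-q) := by
    rw [show 1 - q - 1 = -q by ring]
    exact Real.rpow_le_rpow_of_nonpos hx hz (by linarith)
  have h6 : ((n : ℝ) + a) ^ (-q) ≤ ((M : ℝ) + a) ^ (-q) :=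
    Real.rpow_le_rpow_of_nonpos hx (by linarith) (by linarith)
  have h7 : |z ^ (1 - q) - ((n : ℝ) + a) ^ (1 - q)| ≤ ((M : ℝ) + a) ^ (-q) := by
    refine h3.trans ((mul_le_mul h4 h5 (by positivity) zero_le_one).trans (by simp))
  have h8 : 0 < 1 - q := by linarith
  have h9 : |z ^ (1 - q) - ((n : ℝ) + a) ^ (1 - q)| / (1 - q) ≤
      1 / (1 - q) * ((M : ℝ) + a) ^ (-q) := by
    rw [div_le_iff₀ h8]
    refine h7.trans (le_of_eq ?_)
    field_simp
  have h10 : (q / a + 1) * ((n : ℝ) + a) ^ (-q) ≤ (q / a + 1) * ((M : ℝ) + a) ^ (-q) := by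
    gcongr
  calc _ = |(∑ m ∈ range n, ((m : ℝ) + a) ^ (-q) - ((n : ℝ) + a) ^ (1 - q) / (1 - q) -
            (hzeta a q).re) -
          (∑ m ∈ range M, ((m : ℝ) + a) ^ (-q) - ((M : ℝ) + a) ^ (1 - q) / (1 - q) -
            (hzeta a q).re) - (z ^ (1 - q) - ((n : ℝ) + a) ^ (1 - q)) / (1 - q)| := by
        congr 1
        ring
    _ ≤ _ := by
      refine (abs_sub _ _).trans ?_
      rw [abs_div, abs_of_pos h8]
      have := abs_sub (∑ m ∈ range n, ((m : ℝ) + a) ^ (-q) - ((n : ℝ) + a) ^ (1 - q) / (1 - q) -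
            (hzeta a q).re) (∑ m ∈ range M, ((m : ℝ) + a) ^ (-q) - ((M : ℝ) + a) ^ (1 - q) / (1 - q) -
            (hzeta a q).re)
      linarith

lemma floor_eq_card_filter {Y x : ℝ} (hY : 0 ≤ Y) (hx : 0 < x) {K : ℕ} (hK : ⌊Y / x⌋₊ ≤ K) :
    #{k ∈ Icc 1 K | ((k : ℕ) : ℝ) * x ≤ Y} = ⌊Y / x⌋₊ := by
  have : {k ∈ Icc 1 K | ((k : ℕ) : ℝ) * x ≤ Y} = Icc 1 ⌊Y / x⌋₊ := by
    ext k
    simp only [mem_filter, mem_Icc]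
    rw [Nat.le_floor_iff (by positivity), le_div_iff₀ hx]
    constructor
    · rintro ⟨⟨h1, h2⟩, h3⟩; exact ⟨h1, h3⟩
    · rintro ⟨h1, h3⟩
      refine ⟨⟨h1, le_trans ?_ hK⟩, h3⟩
      rwa [Nat.le_floor_iff (by positivity), le_div_iff₀ hx]
  rw [this, Nat.card_Icc, Nat.add_sub_cancel]

lemma sum_floor_eq {a : ℝ} (ha : 0 < a) {M B : ℕ} {Y : ℝ} (hY : 0 ≤ Y) (w : ℕ → ℝ) :
    ∑ m ∈ Ico M B, w m * (⌊Y / ((m : ℝ) + a)⌋₊ : ℝ) =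
      ∑ k ∈ Icc 1 ⌊Y / ((M : ℝ) + a)⌋₊, ∑ m ∈ Ico M B with ((m : ℕ) : ℝ) + a ≤ Y / k, w m := by
  simp only [sum_filter]
  rw [sum_comm]
  refine sum_congr rfl fun m hm => ?_
  have hx : 0 < (m : ℝ) + a := by positivity
  have hMm : (M : ℝ) ≤ m := by exact_mod_cast (mem_Ico.mp hm).1
  rw [← floor_eq_card_filter hY hx (K := ⌊Y / ((M : ℝ) + a)⌋₊)
    (Nat.floor_le_floor (by gcongr)), card_filter]
  push_cast
  rw [mul_sum]
  refine sum_congr rfl fun k hk => ?_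
  have hk : 0 < (k : ℝ) := by exact_mod_cast (mem_Icc.mp hk).1
  simp only [le_div_iff₀ hk, mul_comm (k : ℝ), mul_ite, mul_one, mul_zero]

lemma sum_Icc_one_eq_sum_range (f : ℕ → ℝ) (K : ℕ) :
    ∑ k ∈ Icc 1 K, f k = ∑ m ∈ range K, f (m + 1) := by
  rw [range_eq_Ico, sum_Ico_add' f 0 K 1]
  rfl

/-- The hyperbola-type evaluation producing the two main terms. -/
theorem abs_main_term_sub_le {a : ℝ} (ha : 0 < a) (ha1 : a ≤ 1) {σ : ℝ} (hσ : 1 / 2 < σ)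
    (hσ1 : σ < 1) : ∃ C : ℝ, ∀ (M B : ℕ) (Y : ℝ), (M : ℝ) + a ≤ Y → Y < (B : ℝ) + a →
    |Y * ∑ m ∈ range M, ((m : ℝ) + a) ^ (-(2 * σ)) +
        ∑ m ∈ Ico M B, ((m : ℝ) + a) ^ (1 - 2 * σ) * (⌊Y / ((m : ℝ) + a)⌋₊ : ℝ) -
        (Y * (hzeta a (2 * σ : ℝ)).re +
          Y ^ (2 - 2 * σ) * (hzeta 1 (2 - 2 * σ : ℝ)).re / (2 - 2 * σ))| ≤
      C * (((M : ℝ) + a) ^ (2 - 2 * σ) + Y * ((M : ℝ) + a) ^ (-(2 * σ))) := by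
  set q := 2 * σ - 1 with hq
  set p := 2 - 2 * σ with hp
  set C₁ := 2 * (q / a + 1) + 1 / (1 - q) with hC₁
  have hq0 : 0 < q := by linarith
  have hq1 : q < 1 := by linarith
  have hp0 : 0 < p := by linarith
  have hp1 : p < 1 := by linarith
  have hC₁0 : 0 ≤ C₁ := by
    have : 0 < 1 - q := by linarith
    positivity
  refine ⟨2 * σ / a + 1 + C₁ + ((p + 1) + 1 / q + 1) / p, fun M B Y hY hB => ?_⟩
  set x := (M : ℝ) + a with hx
  have hx0 : 0 < x := by positivity
  have hY0 : 0 < Y := by linarith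
  set κ := Y / x with hκ
  have hκ1 : 1 ≤ κ := (one_le_div hx0).mpr hY
  set K := ⌊κ⌋₊ with hK
  have hK1 : (K : ℝ) ≤ κ := Nat.floor_le (by linarith)
  have hK2 : κ < K + 1 := Nat.lt_floor_add_one κ
  have e1 : ∀ m : ℕ, ((m : ℝ) + a) ^ (1 - 2 * σ) = ((m : ℝ) + a) ^ (-q) := fun m => by
    congr 1; ring
  simp only [e1]
  rw [sum_floor_eq ha hY0.le]
  have hin : |∑ k ∈ Icc 1 K, ∑ m ∈ Ico M B with ((m : ℕ) : ℝ) + a ≤ Y / k, ((m : ℝ) + a) ^ (-q) -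
      ∑ k ∈ Icc 1 K, ((Y / k) ^ (1 - q) - x ^ (1 - q)) / (1 - q)| ≤ κ * (C₁ * x ^ (-q)) := by
    rw [← sum_sub_distrib]
    refine (abs_sum_le_sum_abs _ _).trans ?_
    calc _ ≤ ∑ k ∈ Icc 1 K, C₁ * x ^ (-q) := by
          refine sum_le_sum fun k hk => ?_
          obtain ⟨hk1, hk2⟩ := mem_Icc.mp hk
          have hk0 : 0 < (k : ℝ) := by exact_mod_cast hk1
          have hk1' : (1 : ℝ) ≤ k := by exact_mod_cast hk1
          refine abs_sum_Ico_rpow_sub_le ha ha1 hq0 hq1 ?_ ?_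
          · rw [le_div_iff₀ hk0, mul_comm, ← le_div_iff₀ hx0]
            exact le_trans (by exact_mod_cast hk2) hK1
          · refine lt_of_le_of_lt ?_ hB
            exact div_le_self hY0.le hk1'
      _ ≤ _ := by
        rw [sum_const, Nat.card_Icc, Nat.add_sub_cancel, nsmul_eq_mul]
        gcongr
  have hks : ∑ k ∈ Icc 1 K, ((Y / k) ^ (1 - q) - x ^ (1 - q)) / (1 - q) =
      Y ^ p / p * ∑ m ∈ range K, ((m : ℝ) + 1) ^ (-p) - K * x ^ p / p := by
    have e2 : 1 - q = p := by rw [hq, hp]; ring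
    have e3 : ∀ k ∈ Icc 1 K, ((Y / k) ^ p - x ^ p) / p =
        Y ^ p / p * (k : ℝ) ^ (-p) - x ^ p / p := by
      intro k hk
      rw [Real.div_rpow hY0.le (by positivity), Real.rpow_neg (by positivity)]
      ring
    rw [e2, sum_congr rfl e3, sum_sub_distrib, ← mul_sum,
      sum_Icc_one_eq_sum_range (fun k : ℕ => (k : ℝ) ^ (-p)), sum_const, Nat.card_Icc]
    simp only [Nat.cast_add, Nat.cast_one, Nat.add_sub_cancel, nsmul_eq_mul]
    ring
  have hz := abs_sum_rpow_sub_le (a := 1) one_pos le_rfl hp0 hp1.ne K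
  have hm := abs_sum_rpow_sub_le ha ha1 (p := 2 * σ) (by linarith) (by linarith) M
  have hκ0 : 0 < κ := by linarith
  have hxp : x ^ p = Y ^ p * κ ^ (-p) := by
    rw [Real.rpow_neg hκ0.le, ← div_eq_mul_inv, ← Real.div_rpow hY0.le hκ0.le, hκ]
    congr 1
    field_simp
  have hxq : κ * x ^ (-q) = Y * x ^ (-(2 * σ)) := by
    rw [hκ, show -(2 * σ) = -q - 1 by rw [hq]; ring, Real.rpow_sub_one hx0.ne']
    field_simp
  have hxY : Y * x ^ (1 - 2 * σ) = κ * x ^ p := by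
    rw [hκ, show p = 1 - 2 * σ + 1 by rw [hp]; ring, Real.rpow_add_one hx0.ne']
    field_simp
  have hκq : Y ^ p * κ ^ (1 - p) = κ * x ^ p := by
    rw [hxp, show 1 - p = -p + 1 by ring, Real.rpow_add_one hκ0.ne']
    ring
  have h1 : |κ ^ (1 - p) - ((K : ℝ) + 1) ^ (1 - p)| ≤ κ ^ (-p) := by
    refine (abs_rpow_sub_rpow_le hκ0 (by positivity) (by linarith) (by linarith)).trans ?_
    rw [show 1 - p - 1 = -p by ring]
    have : |κ - (K + 1)| ≤ 1 := by rw [abs_le]; constructor <;> linarith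
    have h : 0 ≤ κ ^ (-p) := by positivity
    nlinarith
  have h2 : ((K : ℝ) + 1) ^ (-p) ≤ κ ^ (-p) :=
    Real.rpow_le_rpow_of_nonpos hκ0 hK2.le (by linarith)
  have h1p : 1 - p = q := by rw [hq, hp]; ring
  rw [hks] at hin
  rw [h1p] at hz h1 hκq
  have hYp : 0 ≤ Y ^ p := by positivity
  set S₁ := ∑ m ∈ range M, ((m : ℝ) + a) ^ (-(2 * σ))
  set S₂ := ∑ k ∈ Icc 1 K, ∑ m ∈ Ico M B with ((m : ℕ) : ℝ) + a ≤ Y / k, ((m : ℝ) + a) ^ (-q)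
  set S₃ := ∑ m ∈ range K, ((m : ℝ) + 1) ^ (-p)
  set Z₁ := (hzeta a (2 * σ : ℝ)).re
  set Z₂ := (hzeta 1 (p : ℝ)).re
  have h3 : |S₃ - κ ^ q / q - Z₂| ≤ ((p + 1) + 1 / q) * κ ^ (-p) := by
    have e4 : S₃ - κ ^ q / q - Z₂ = (S₃ - ((K : ℝ) + 1) ^ q / q - Z₂) -
        (κ ^ q - ((K : ℝ) + 1) ^ q) / q := by ring
    rw [e4]
    refine (abs_sub _ _).trans ?_
    rw [abs_div, abs_of_pos hq0]
    have h5 : |κ ^ q - ((K : ℝ) + 1) ^ q| / q ≤ 1 / q * κ ^ (-p) := by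
      rw [div_le_iff₀ hq0]
      refine h1.trans (le_of_eq ?_)
      field_simp
    have h6 : (p / 1 + 1) * ((K : ℝ) + 1) ^ (-p) ≤ (p + 1) * κ ^ (-p) := by
      rw [div_one]; gcongr
    linarith
  clear_value S₁ S₂ S₃ Z₁ Z₂ K q p
  have main : Y * S₁ + S₂ - (Y * Z₁ + Y ^ p * Z₂ / p) =
      Y * (S₁ - x ^ (1 - 2 * σ) / (1 - 2 * σ) - Z₁) +
      (S₂ - (Y ^ p / p * S₃ - K * x ^ p / p)) + Y ^ p / p * (S₃ - κ ^ q / q - Z₂) +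
      (κ - K) * x ^ p / p := by
    have e5 : Y * (x ^ (1 - 2 * σ) / (1 - 2 * σ)) = - (κ * x ^ p / q) := by
      rw [← mul_div_assoc, hxY, show 1 - 2 * σ = -q by rw [hq]; ring, div_neg]
    have e6 : Y ^ p / p * (κ ^ q / q) = κ * x ^ p / (p * q) := by
      rw [← hκq]; field_simp
    have e7 : κ * x ^ p / (p * q) = κ * x ^ p / q + κ * x ^ p / p := by
      have : p + q = 1 := by rw [hp, hq]; ring
      field_simp
      rw [this]
    linear_combination e5 + e6 + e7
  rw [main]
  have b1 : |Y * (S₁ - x ^ (1 - 2 * σ) / (1 - 2 * σ) - Z₁)| ≤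
      (2 * σ / a + 1) * (Y * x ^ (-(2 * σ))) := by
    rw [abs_mul, abs_of_pos hY0]
    calc _ ≤ Y * ((2 * σ / a + 1) * x ^ (-(2 * σ))) := by gcongr
      _ = _ := by ring
  have b2 : |S₂ - (Y ^ p / p * S₃ - K * x ^ p / p)| ≤ C₁ * (Y * x ^ (-(2 * σ))) := by
    refine hin.trans (le_of_eq ?_)
    rw [← hxq]; ring
  have b3 : |Y ^ p / p * (S₃ - κ ^ q / q - Z₂)| ≤ ((p + 1) + 1 / q) / p * x ^ p := by
    rw [abs_mul, abs_of_nonneg (by positivity), hxp]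
    calc _ ≤ Y ^ p / p * (((p + 1) + 1 / q) * κ ^ (-p)) := by gcongr
      _ = _ := by ring
  have b4 : |(κ - K) * x ^ p / p| ≤ 1 / p * x ^ p := by
    rw [abs_div, abs_mul, abs_of_nonneg (sub_nonneg.mpr hK1), abs_of_pos hp0,
      abs_of_nonneg (by positivity : 0 ≤ x ^ p), mul_div_assoc, div_mul_eq_mul_div, one_mul]
    exact mul_le_of_le_one_left (by positivity) (by linarith)
  have hY2 : 0 ≤ Y * x ^ (-(2 * σ)) := by positivity
  have hx2 : 0 ≤ x ^ p := by positivity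
  have hσ0 : 0 < 2 * σ / a + 1 + C₁ := by positivity
  have hp2 : 0 ≤ ((p + 1) + 1 / q + 1) / p := by positivity
  refine (abs_add_le _ _).trans ?_
  refine (add_le_add (abs_add_le _ _) le_rfl).trans ?_
  refine (add_le_add (add_le_add (abs_add_le _ _) le_rfl) le_rfl).trans ?_
  calc _ ≤ (2 * σ / a + 1) * (Y * x ^ (-(2 * σ))) + C₁ * (Y * x ^ (-(2 * σ))) +
        ((p + 1) + 1 / q) / p * x ^ p + 1 / p * x ^ p := by gcongr
    _ = (2 * σ / a + 1 + C₁) * (Y * x ^ (-(2 * σ))) + ((p + 1) + 1 / q + 1) / p * x ^ p := by ring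
    _ ≤ _ := by
      have g1 := mul_nonneg hσ0.le hx2
      have g2 := mul_nonneg hp2 hY2
      rw [mul_add, add_mul _ _ (x ^ p), add_mul _ _ (Y * x ^ (-(2 * σ)))]
      linarith

/-- Smooth functions supported in `[-1/2, 1/2]`. -/
structure IsTest (h : ℝ → ℂ) : Prop where
  smooth : ContDiff ℝ ((⊤ : ℕ∞) : WithTop ℕ∞) h
  zero : ∀ θ, θ ∉ Set.Icc (-1 / 2 : ℝ) (1 / 2) → h θ = 0

namespace IsTest

variable {h k : ℝ → ℂ}

lemma eq_zero_of_le (hh : IsTest h) {θ : ℝ} (hθ : 1 / 2 ≤ |θ|) : h θ = 0 := by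
  have hc : Continuous h := hh.smooth.continuous
  have hcl : IsClosed {x | h x = 0} := isClosed_eq hc continuous_const
  rcases le_abs.mp hθ with h1 | h1
  · have : θ ∈ closure (Set.Ioi θ) := by simp [closure_Ioi]
    refine hcl.closure_subset_iff.mpr (fun x hx => hh.zero x ?_) this
    rintro ⟨_, h3⟩
    have : θ < x := hx
    linarith
  · have : θ ∈ closure (Set.Iio θ) := by simp [closure_Iio]
    refine hcl.closure_subset_iff.mpr (fun x hx => hh.zero x ?_) this
    rintro ⟨h3, _⟩
    have : x < θ := hx
    linarith

lemma left (hh : IsTest h) : h (-1 / 2) = 0 := hh.eq_zero_of_le (by norm_num [abs_div])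

lemma right (hh : IsTest h) : h (1 / 2) = 0 := hh.eq_zero_of_le (by norm_num [abs_div])

lemma hasDerivAt (hh : IsTest h) (θ : ℝ) : HasDerivAt h (deriv h θ) θ :=
  (hh.smooth.differentiable (by simp) θ).hasDerivAt

lemma deriv (hh : IsTest h) : IsTest (deriv h) where
  smooth := (contDiff_infty_iff_deriv.mp hh.smooth).2
  zero θ hθ := by
    have : h =ᶠ[nhds θ] fun _ => 0 :=
      eventually_of_mem (isClosed_Icc.isOpen_compl.mem_nhds hθ) fun x hx => hh.zero x hx
    rw [this.deriv_eq, deriv_const]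

lemma add (hh : IsTest h) (hk : IsTest k) : IsTest fun θ => h θ + k θ where
  smooth := hh.smooth.add hk.smooth
  zero θ hθ := by rw [hh.zero θ hθ, hk.zero θ hθ, add_zero]

lemma mul_left (hh : IsTest h) {f : ℝ → ℂ} (hf : ContDiff ℝ ((⊤ : ℕ∞) : WithTop ℕ∞) f) :
    IsTest fun θ => f θ * h θ where
  smooth := hf.mul hh.smooth
  zero θ hθ := by rw [hh.zero θ hθ, mul_zero]

lemma const_mul (hh : IsTest h) (c : ℂ) : IsTest fun θ => c * h θ := hh.mul_left contDiff_const

lemma continuous (hh : IsTest h) : Continuous h := hh.smooth.continuous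

lemma hasCompactSupport (hh : IsTest h) : HasCompactSupport h :=
  HasCompactSupport.intro isCompact_Icc hh.zero

lemma bounded (hh : IsTest h) : ∃ C, 0 ≤ C ∧ ∀ θ, ‖h θ‖ ≤ C := by
  obtain ⟨C, hC⟩ := hh.hasCompactSupport.exists_bound_of_continuous hh.continuous
  exact ⟨C, (norm_nonneg _).trans (hC 0), hC⟩

end IsTest

/-- The phase factor `exp (i (t θ - q e^θ))`. -/
noncomputable def phase (t q θ : ℝ) : ℂ := cexp (((t * θ - q * Real.exp θ : ℝ) : ℂ) * I)

lemma norm_phase (t q θ : ℝ) : ‖phase t q θ‖ = 1 := norm_exp_ofReal_mul_I _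

lemma hasDerivAt_phase (t q θ : ℝ) :
    HasDerivAt (phase t q) (phase t q θ * (((t - q * Real.exp θ : ℝ) : ℂ) * I)) θ := by
  have h1 : HasDerivAt (fun θ : ℝ => t * θ - q * Real.exp θ) (t - q * Real.exp θ) θ := by
    simpa using ((hasDerivAt_id θ).const_mul t).fun_sub ((Real.hasDerivAt_exp θ).const_mul q)
  exact (h1.ofReal_comp.mul_const I).cexp

lemma continuous_phase (t q : ℝ) : Continuous (phase t q) := by
  unfold phase
  fun_prop

/-- The oscillatory integral `∫ h(θ) exp (i (t θ - q e^θ)) dθ`. -/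
noncomputable def osc (h : ℝ → ℂ) (t q : ℝ) : ℂ :=
  ∫ θ in (-1 / 2 : ℝ)..(1 / 2), h θ * phase t q θ

lemma intervalIntegral_eq_zero_of_hasDerivAt {F F' : ℝ → ℂ}
    (hF : ∀ θ ∈ Set.Icc (-1 / 2 : ℝ) (1 / 2), HasDerivAt F (F' θ) θ)
    (hF' : ContinuousOn F' (Set.Icc (-1 / 2) (1 / 2))) (h0 : F (-1 / 2) = 0) (h1 : F (1 / 2) = 0) :
    ∫ θ in (-1 / 2 : ℝ)..(1 / 2), F' θ = 0 := by
  have hu : Set.uIcc (-1 / 2 : ℝ) (1 / 2) = Set.Icc (-1 / 2) (1 / 2) :=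
    Set.uIcc_of_le (by norm_num)
  rw [intervalIntegral.integral_eq_sub_of_hasDerivAt (f := F) (by rwa [hu])
    (ContinuousOn.intervalIntegrable (by rwa [hu])), h0, h1, sub_zero]

lemma osc_eq_integral {h : ℝ → ℂ} (hh : IsTest h) (t q : ℝ) :
    osc h t q = ∫ θ, h θ * phase t q θ := by
  rw [osc, intervalIntegral.integral_of_le (by norm_num),
    ← integral_Icc_eq_integral_Ioc, setIntegral_eq_integral_of_forall_compl_eq_zero]
  intro θ hθ
  rw [hh.zero θ hθ, zero_mul]

/-- Integration by parts against the phase. -/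
lemma osc_mul_phase_deriv {h : ℝ → ℂ} (hh : IsTest h) (t q : ℝ) :
    ∫ θ in (-1 / 2 : ℝ)..(1 / 2), h θ * ((t - q * Real.exp θ : ℝ) : ℂ) * phase t q θ =
      I * osc (deriv h) t q := by
  have h0 := intervalIntegral_eq_zero_of_hasDerivAt (F := fun θ => h θ * phase t q θ)
    (F' := fun θ => deriv h θ * phase t q θ +
      h θ * (phase t q θ * (((t - q * Real.exp θ : ℝ) : ℂ) * I)))
    (fun θ _ => (hh.hasDerivAt θ).mul (hasDerivAt_phase t q θ))
    (by
      have := hh.continuous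
      have := hh.deriv.continuous
      have := continuous_phase t q
      fun_prop) (by rw [hh.left, zero_mul]) (by rw [hh.right, zero_mul])
  have hi1 : IntervalIntegrable (fun θ => deriv h θ * phase t q θ) volume (-1 / 2) (1 / 2) := by
    have := hh.deriv.continuous
    have := continuous_phase t q
    exact Continuous.intervalIntegrable (by fun_prop) _ _
  have hi2 : IntervalIntegrable
      (fun θ => h θ * (phase t q θ * (((t - q * Real.exp θ : ℝ) : ℂ) * I))) volume
      (-1 / 2) (1 / 2) := by
    have := hh.continuous
    have := continuous_phase t q
    exact Continuous.intervalIntegrable (by fun_prop) _ _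
  rw [intervalIntegral.integral_add hi1 hi2] at h0
  have e : ∫ θ in (-1 / 2 : ℝ)..(1 / 2), h θ * (phase t q θ * (((t - q * Real.exp θ : ℝ) : ℂ) * I))
      = (∫ θ in (-1 / 2 : ℝ)..(1 / 2), h θ * ((t - q * Real.exp θ : ℝ) : ℂ) * phase t q θ) * I := by
    rw [← intervalIntegral.integral_mul_const]
    congr 1
    ext θ
    ring
  rw [e] at h0
  rw [osc]
  linear_combination (-I) * h0 +
    (∫ θ in (-1 / 2 : ℝ)..(1 / 2), h θ * ((t - q * Real.exp θ : ℝ) : ℂ) * phase t q θ) *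
      I_mul_I

lemma norm_intervalIntegral_le_of_bound {F : ℝ → ℂ} {u : ℝ → ℝ}
    (hu : Continuous u) (h : ∀ θ ∈ Set.Icc (-1 / 2 : ℝ) (1 / 2), ‖F θ‖ ≤ u θ) :
    ‖∫ θ in (-1 / 2 : ℝ)..(1 / 2), F θ‖ ≤ ∫ θ in (-1 / 2 : ℝ)..(1 / 2), u θ :=
  intervalIntegral.norm_integral_le_of_norm_le (by norm_num)
    (Eventually.of_forall fun θ hθ => h θ ⟨hθ.1.le, hθ.2⟩) (hu.intervalIntegrable _ _)

lemma exp_half_le : Real.exp (1 / 2) ≤ 1.65 := by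
  have h1 : Real.exp (1 / 2) ^ 2 = Real.exp 1 := by
    rw [← Real.exp_nat_mul]; norm_num
  have h2 := Real.exp_one_lt_d9
  have h3 := Real.exp_pos (1 / 2)
  nlinarith

lemma exp_bounds {θ : ℝ} (hθ : θ ∈ Set.Icc (-1 / 2 : ℝ) (1 / 2)) :
    0.6 ≤ Real.exp θ ∧ Real.exp θ ≤ 1.65 := by
  have h1 := exp_half_le
  constructor
  · have h2 : Real.exp (-(1 / 2)) ≤ Real.exp θ := Real.exp_le_exp.mpr (by linarith [hθ.1])
    have h3 : Real.exp (-(1 / 2)) * Real.exp (1 / 2) = 1 := by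
      rw [← Real.exp_add]; simp
    have h4 := Real.exp_pos (-(1 / 2) : ℝ)
    nlinarith
  · exact (Real.exp_le_exp.mpr hθ.2).trans h1

lemma norm_osc_le_of_bound {h : ℝ → ℂ} {H : ℝ} (hH : ∀ θ, ‖h θ‖ ≤ H) (t q : ℝ) :
    ‖osc h t q‖ ≤ H := by
  have := norm_intervalIntegral_le_of_bound (F := fun θ => h θ * phase t q θ) (u := fun _ => H)
    continuous_const (fun θ _ => by rw [norm_mul, norm_phase, mul_one]; exact hH θ)
  refine this.trans ?_
  simp
  norm_num

lemma integral_deriv_arctan_le {t q : ℝ} (hq : 0 < q) :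
    ∫ θ in (-1 / 2 : ℝ)..(1 / 2), q * Real.exp θ / (q + (t - q * Real.exp θ) ^ 2) ≤
      Real.pi / √q := by
  have hs : 0 < √q := Real.sqrt_pos.mpr hq
  have hpos : ∀ θ, 0 < q + (t - q * Real.exp θ) ^ 2 := fun θ => by positivity
  have hd : ∀ θ : ℝ, HasDerivAt (fun θ => -(Real.arctan ((t - q * Real.exp θ) / √q) / √q))
      (q * Real.exp θ / (q + (t - q * Real.exp θ) ^ 2)) θ := by
    intro θ
    have h1 : HasDerivAt (fun θ : ℝ => (t - q * Real.exp θ) / √q) (-(q * Real.exp θ) / √q) θ := by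
      simpa using (((Real.hasDerivAt_exp θ).const_mul q).const_sub t).div_const (√q)
    refine (h1.arctan.div_const (√q)).fun_neg.congr_deriv ?_
    have h2 := (hpos θ).ne'
    have h3 : 1 + ((t - q * Real.exp θ) / √q) ^ 2 = (q + (t - q * Real.exp θ) ^ 2) / q := by
      rw [div_pow, Real.sq_sqrt hq.le]; field_simp
    rw [h3]
    field_simp
    rw [Real.sq_sqrt hq.le]
  rw [intervalIntegral.integral_eq_sub_of_hasDerivAt (fun θ _ => hd θ)
    (Continuous.intervalIntegrable (by
      refine Continuous.div (by fun_prop) (by fun_prop) fun θ => (hpos θ).ne') _ _)]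
  have h1 := Real.neg_pi_div_two_lt_arctan ((t - q * Real.exp (1 / 2)) / √q)
  have h2 := Real.arctan_lt_pi_div_two ((t - q * Real.exp (-1 / 2)) / √q)
  rw [neg_sub_neg, ← sub_div]
  gcongr
  linarith

/-- Second-derivative bound for the oscillatory integral. -/
theorem exists_norm_osc_le_rpow {h : ℝ → ℂ} (hh : IsTest h) :
    ∃ C, 0 < C ∧ ∀ t q : ℝ, 0 < q → ‖osc h t q‖ ≤ C / √q := by
  obtain ⟨H₀, hH₀, hb₀⟩ := hh.bounded
  obtain ⟨H₁, hH₁, hb₁⟩ := hh.deriv.bounded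
  refine ⟨4 * H₀ * Real.pi + H₁ + 1, by positivity, fun t q hq => ?_⟩
  have hs : 0 < √q := Real.sqrt_pos.mpr hq
  have hsq : √q ^ 2 = q := Real.sq_sqrt hq.le
  set P : ℝ → ℝ := fun θ => t - q * Real.exp θ with hP
  set D : ℝ → ℝ := fun θ => q + P θ ^ 2 with hD
  have hDpos : ∀ θ, 0 < D θ := fun θ => by positivity
  have hDne : ∀ θ, D θ ≠ 0 := fun θ => (hDpos θ).ne'
  have hPd : ∀ θ, HasDerivAt P (-(q * Real.exp θ)) θ := fun θ =>
    ((Real.hasDerivAt_exp θ).const_mul q).const_sub t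
  have hPc : Continuous P := by fun_prop
  have hDc : Continuous D := by fun_prop
  have hRd : ∀ θ, HasDerivAt (fun θ => P θ / D θ)
      ((-(q * Real.exp θ)) * (q - P θ ^ 2) / D θ ^ 2) θ := by
    intro θ
    have h1 := (hPd θ).div (((hPd θ).pow 2).const_add q) (hDne θ)
    refine h1.congr_deriv ?_
    simp only [hD, Pi.pow_apply]
    push_cast
    congr 1
    ring
  have hc0 := hh.continuous
  have hc1 := hh.deriv.continuous
  have hcp := continuous_phase t q
  have hRc : Continuous fun θ => P θ / D θ := hPc.div hDc hDne
  have hR'c : Continuous fun θ => (-(q * Real.exp θ)) * (q - P θ ^ 2) / D θ ^ 2 :=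
    Continuous.div (by fun_prop) (by fun_prop) fun θ => pow_ne_zero 2 (hDne θ)
  have h0 := intervalIntegral_eq_zero_of_hasDerivAt
    (F := fun θ => h θ * ((P θ / D θ : ℝ) : ℂ) * phase t q θ) (F' := fun θ =>
      (deriv h θ * ((P θ / D θ : ℝ) : ℂ) +
        h θ * (((-(q * Real.exp θ)) * (q - P θ ^ 2) / D θ ^ 2 : ℝ) : ℂ)) * phase t q θ +
      h θ * ((P θ / D θ : ℝ) : ℂ) * (phase t q θ * ((P θ : ℂ) * I)))
    (fun θ _ => ((hh.hasDerivAt θ).mul (hRd θ).ofReal_comp).mul (hasDerivAt_phase t q θ))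
    (by fun_prop) (by simp only [hh.left, zero_mul]) (by simp only [hh.right, zero_mul])
  set E : ℝ → ℂ := fun θ => I * ((deriv h θ * ((P θ / D θ : ℝ) : ℂ) +
      h θ * (((-(q * Real.exp θ)) * (q - P θ ^ 2) / D θ ^ 2 : ℝ) : ℂ)) * phase t q θ) +
      h θ * ((q / D θ : ℝ) : ℂ) * phase t q θ with hE
  have hqD : Continuous fun θ => q / D θ := continuous_const.div hDc hDne
  have hEeq : osc h t q = ∫ θ in (-1 / 2 : ℝ)..(1 / 2), E θ := by
    rw [osc, ← sub_eq_zero, ← intervalIntegral.integral_sub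
      (Continuous.intervalIntegrable (by fun_prop) _ _)
      (Continuous.intervalIntegrable (by fun_prop) _ _), ← mul_zero (-I), ← h0,
      ← intervalIntegral.integral_const_mul]
    congr 1
    ext θ
    have hd : ((q / D θ : ℝ) : ℂ) = 1 - (P θ / D θ : ℝ) * (P θ : ℂ) := by
      rw [← ofReal_mul, ← ofReal_one, ← ofReal_sub]
      congr 1
      have := hDne θ
      field_simp
      simp only [hD]
      ring
    simp only [hE]
    rw [hd]
    linear_combination (h θ * ((P θ / D θ : ℝ) : ℂ) * phase t q θ * (P θ : ℂ)) * I_mul_I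
  rw [hEeq]
  have hbound : ∀ θ ∈ Set.Icc (-1 / 2 : ℝ) (1 / 2), ‖E θ‖ ≤
      H₁ / √q + 4 * H₀ * (q * Real.exp θ / (q + (t - q * Real.exp θ) ^ 2)) := by
    intro θ hθ
    have b1 : |P θ / D θ| ≤ 1 / √q := by
      rw [abs_div, abs_of_pos (hDpos θ), div_le_div_iff₀ (hDpos θ) hs, one_mul]
      simp only [hD]
      nlinarith [sq_nonneg (|P θ| - √q), sq_abs (P θ), abs_nonneg (P θ)]
    have b2 : |(-(q * Real.exp θ)) * (q - P θ ^ 2) / D θ ^ 2| ≤ q * Real.exp θ / D θ := by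
      have h1 : |q - P θ ^ 2| ≤ D θ := by
        simp only [hD, abs_le]
        constructor <;> nlinarith [sq_nonneg (P θ)]
      have h2 : 0 < q * Real.exp θ := by positivity
      rw [abs_div, abs_mul, abs_neg, abs_of_pos h2, abs_of_pos (by positivity : 0 < D θ ^ 2),
        div_le_div_iff₀ (by positivity) (hDpos θ)]
      calc _ ≤ q * Real.exp θ * D θ * D θ := by gcongr
        _ = _ := by ring
    have b3 : q / D θ ≤ 2 * (q * Real.exp θ / D θ) := by
      rw [← mul_div_assoc]
      gcongr
      nlinarith [(exp_bounds hθ).1]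
    have b4 : 0 ≤ q / D θ := by positivity
    have b5 : 0 ≤ q * Real.exp θ / D θ := by positivity
    calc ‖E θ‖ ≤ (‖deriv h θ‖ * |P θ / D θ| + ‖h θ‖ *
          |(-(q * Real.exp θ)) * (q - P θ ^ 2) / D θ ^ 2|) + ‖h θ‖ * |q / D θ| := by
          simp only [hE]
          refine (norm_add_le _ _).trans ?_
          rw [norm_mul, norm_I, one_mul, norm_mul, norm_phase, mul_one, norm_mul, norm_mul,
            norm_phase, mul_one, norm_real, Real.norm_eq_abs]
          gcongr
          refine (norm_add_le _ _).trans ?_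
          rw [norm_mul, norm_mul, norm_real, Real.norm_eq_abs, norm_real, Real.norm_eq_abs]
      _ ≤ (H₁ * (1 / √q) + H₀ * (q * Real.exp θ / D θ)) + H₀ * (2 * (q * Real.exp θ / D θ)) := by
          rw [abs_of_nonneg b4]
          have := hb₀ θ
          have := hb₁ θ
          gcongr
      _ ≤ H₁ / √q + 4 * H₀ * (q * Real.exp θ / D θ) := by
          have := mul_nonneg hH₀ b5
          rw [mul_one_div]
          linarith
  refine (norm_intervalIntegral_le_of_bound ?_ hbound).trans ?_
  · refine continuous_const.add (continuous_const.mul (Continuous.div (by fun_prop) (by fun_prop) hDne))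
  · have hi : IntervalIntegrable
        (fun θ => 4 * H₀ * (q * Real.exp θ / (q + (t - q * Real.exp θ) ^ 2))) volume
        (-1 / 2) (1 / 2) :=
      Continuous.intervalIntegrable (continuous_const.mul (Continuous.div (by fun_prop)
        (by fun_prop) hDne)) _ _
    rw [intervalIntegral.integral_add intervalIntegrable_const hi,
      intervalIntegral.integral_const_mul]
    have := integral_deriv_arctan_le (t := t) hq
    rw [intervalIntegral.integral_const]
    have h5 : 4 * H₀ * ∫ θ in (-1 / 2 : ℝ)..(1 / 2), q * Real.exp θ / (q + (t - q * Real.exp θ) ^ 2)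
      ≤ 4 * H₀ * (Real.pi / √q) := by gcongr
    have h6 : 0 < 1 / √q := by positivity
    calc _ ≤ H₁ / √q + 4 * H₀ * (Real.pi / √q) := by
          norm_num at h5 ⊢
          exact h5
      _ ≤ H₁ / √q + 4 * H₀ * (Real.pi / √q) + 1 / √q := by linarith
      _ = _ := by ring

/-- The oscillatory integral with negative powers of the derivative of the phase. -/
noncomputable def oscPow (k : ℕ) (h : ℝ → ℂ) (t q : ℝ) : ℂ :=
  ∫ θ in (-1 / 2 : ℝ)..(1 / 2), h θ * (((t - q * Real.exp θ) ^ k)⁻¹ : ℝ) * phase t q θ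

lemma oscPow_zero (h : ℝ → ℂ) (t q : ℝ) : oscPow 0 h t q = osc h t q := by
  simp [oscPow, osc]

/-- The phase `t θ - q e^θ` has no stationary point near `[-1/2, 1/2]`. -/
def IsNonstationary (t q : ℝ) : Prop :=
  0 < |t| + |q| ∧
    ∀ θ ∈ Set.Icc (-1 / 2 : ℝ) (1 / 2), (|t| + |q|) / 20 ≤ |t - q * Real.exp θ|

lemma IsNonstationary.ne_zero {t q : ℝ} (hn : IsNonstationary t q) {θ : ℝ}
    (hθ : θ ∈ Set.Icc (-1 / 2 : ℝ) (1 / 2)) : t - q * Real.exp θ ≠ 0 := by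
  have := hn.2 θ hθ
  have := hn.1
  exact abs_pos.mp (by linarith)

lemma oscPow_eq {h : ℝ → ℂ} (hh : IsTest h) (k : ℕ) {t q : ℝ} (hn : IsNonstationary t q) :
    oscPow k h t q = I * (oscPow (k + 1) (fun θ => deriv h θ + (-(k + 1 : ℂ)) * h θ) t q +
      (k + 1) * t * oscPow (k + 2) h t q) := by
  set P : ℝ → ℝ := fun θ => t - q * Real.exp θ with hP
  have hPne : ∀ θ ∈ Set.Icc (-1 / 2 : ℝ) (1 / 2), P θ ≠ 0 := fun θ hθ => hn.ne_zero hθ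
  have hPd : ∀ θ, HasDerivAt P (-(q * Real.exp θ)) θ := fun θ =>
    ((Real.hasDerivAt_exp θ).const_mul q).const_sub t
  have hPc : Continuous P := by fun_prop
  have hu : Set.uIcc (-1 / 2 : ℝ) (1 / 2) = Set.Icc (-1 / 2) (1 / 2) :=
    Set.uIcc_of_le (by norm_num)
  have hc0 := hh.continuous
  have hc1 := hh.deriv.continuous
  have hcp := continuous_phase t q
  have hinv : ∀ j : ℕ, ContinuousOn (fun θ => ((((P θ) ^ j)⁻¹ : ℝ) : ℂ))
      (Set.Icc (-1 / 2) (1 / 2)) := fun j =>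
    continuous_ofReal.comp_continuousOn
      ((hPc.pow j).continuousOn.inv₀ fun θ hθ => pow_ne_zero j (hPne θ hθ))
  have hd : ∀ θ ∈ Set.Icc (-1 / 2 : ℝ) (1 / 2), HasDerivAt (fun θ => ((P θ) ^ (k + 1))⁻¹)
      (-(k + 1) * ((P θ) ^ (k + 1))⁻¹ + (k + 1) * t * ((P θ) ^ (k + 2))⁻¹) θ := by
    intro θ hθ
    refine (((hPd θ).fun_pow (k + 1)).fun_inv (pow_ne_zero _ (hPne θ hθ))).congr_deriv ?_
    have h1 := hPne θ hθ
    have h2 : q * Real.exp θ = t - P θ := by simp only [hP]; ring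
    rw [h2]
    field_simp
    push_cast
    ring
  have h0 := intervalIntegral_eq_zero_of_hasDerivAt
    (F := fun θ => h θ * ((((P θ) ^ (k + 1))⁻¹ : ℝ) : ℂ) * phase t q θ) (F' := fun θ =>
      (deriv h θ * ((((P θ) ^ (k + 1))⁻¹ : ℝ) : ℂ) +
        h θ * ((-(k + 1) * ((P θ) ^ (k + 1))⁻¹ + (k + 1) * t * ((P θ) ^ (k + 2))⁻¹ : ℝ) : ℂ)) *
          phase t q θ +
      h θ * ((((P θ) ^ (k + 1))⁻¹ : ℝ) : ℂ) * (phase t q θ * ((P θ : ℂ) * I)))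
    (fun θ hθ => ((hh.hasDerivAt θ).mul (hd θ hθ).ofReal_comp).mul (hasDerivAt_phase t q θ))
    (by
      have := hinv (k + 1)
      have := hinv (k + 2)
      push_cast at *
      fun_prop) (by simp only [hh.left, zero_mul]) (by simp only [hh.right, zero_mul])
  have hi : ∀ (j : ℕ) {g : ℝ → ℂ}, Continuous g → IntervalIntegrable
      (fun θ => g θ * ((((P θ) ^ j)⁻¹ : ℝ) : ℂ) * phase t q θ) volume (-1 / 2) (1 / 2) := by
    intro j g hg
    have := hinv j
    exact ContinuousOn.intervalIntegrable (by rw [hu]; fun_prop)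
  have hg : Continuous fun θ => deriv h θ + (-(k + 1 : ℂ)) * h θ := by fun_prop
  have key : (∫ θ in (-1 / 2 : ℝ)..(1 / 2), (h θ * ((((P θ) ^ k)⁻¹ : ℝ) : ℂ) * phase t q θ)) =
      ∫ θ in (-1 / 2 : ℝ)..(1 / 2), (I * ((deriv h θ + (-(k + 1 : ℂ)) * h θ) *
          ((((P θ) ^ (k + 1))⁻¹ : ℝ) : ℂ) * phase t q θ +
        (k + 1) * t * (h θ * ((((P θ) ^ (k + 2))⁻¹ : ℝ) : ℂ) * phase t q θ))) := by
    rw [← sub_eq_zero, ← intervalIntegral.integral_sub (hi k hc0)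
      (((hi (k + 1) hg).add ((hi (k + 2) hc0).const_mul _)).const_mul _), ← mul_zero (-I), ← h0,
      ← intervalIntegral.integral_const_mul]
    refine intervalIntegral.integral_congr fun θ hθ => ?_
    rw [hu] at hθ
    have h1 : ((((P θ) ^ k)⁻¹ : ℝ) : ℂ) = ((((P θ) ^ (k + 1))⁻¹ : ℝ) : ℂ) * (P θ : ℂ) := by
      rw [← ofReal_mul]
      congr 1
      have := hPne θ hθ
      rw [pow_succ]
      field_simp
    simp only [h1]
    push_cast
    linear_combination (h θ * ((P θ : ℂ) ^ (k + 1))⁻¹ * phase t q θ * (P θ : ℂ)) * I_mul_I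
  rw [oscPow, key, intervalIntegral.integral_const_mul, intervalIntegral.integral_add
    (hi (k + 1) hg) ((hi (k + 2) hc0).const_mul _), intervalIntegral.integral_const_mul]
  rfl

lemma exists_norm_oscPow_le (n : ℕ) : ∀ (k : ℕ) {h : ℝ → ℂ}, IsTest h →
    ∃ C, 0 ≤ C ∧ ∀ t q : ℝ, IsNonstationary t q →
      ‖oscPow k h t q‖ ≤ C / (|t| + |q|) ^ (k + n) := by
  induction n with
  | zero =>
    intro k h hh
    obtain ⟨H, hH, hb⟩ := hh.bounded
    refine ⟨H * 20 ^ k, by positivity, fun t q hn => ?_⟩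
    have hS := hn.1
    have := norm_intervalIntegral_le_of_bound
      (F := fun θ => h θ * (((t - q * Real.exp θ) ^ k)⁻¹ : ℝ) * phase t q θ)
      (u := fun _ => H * (((|t| + |q|) / 20) ^ k)⁻¹) continuous_const (fun θ hθ => by
        have h1 := hn.2 θ hθ
        have h2 := hb θ
        rw [norm_mul, norm_phase, mul_one, norm_mul, norm_real, norm_inv, norm_pow,
          Real.norm_eq_abs]
        gcongr)
    refine this.trans (le_of_eq ?_)
    rw [intervalIntegral.integral_const]
    norm_num [div_pow]
    field_simp
  | succ n ih =>
    intro k h hh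
    obtain ⟨C₁, hC₁, h₁⟩ := ih (k + 1) (hh.deriv.add (hh.const_mul (-(k + 1 : ℂ))))
    obtain ⟨C₂, hC₂, h₂⟩ := ih (k + 2) hh
    refine ⟨C₁ + (k + 1) * C₂, by positivity, fun t q hn => ?_⟩
    have hS := hn.1
    have e1 := h₁ t q hn
    have e2 := h₂ t q hn
    rw [oscPow_eq hh k hn, norm_mul, norm_I, one_mul]
    refine (norm_add_le _ _).trans ?_
    rw [norm_mul, norm_mul, norm_real, Real.norm_eq_abs]
    have e3 : ‖(k + 1 : ℂ)‖ = k + 1 := by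
      have : ((k + 1 : ℝ) : ℂ) = (k + 1 : ℂ) := by push_cast; rfl
      rw [← this, norm_real, Real.norm_of_nonneg (by positivity)]
    rw [e3]
    calc _ ≤ C₁ / (|t| + |q|) ^ (k + 1 + n) + (k + 1) * (|t| + |q|) *
          (C₂ / (|t| + |q|) ^ (k + 2 + n)) := by
          gcongr
          linarith [abs_nonneg q]
      _ = _ := by
          rw [show k + 2 + n = k + 1 + n + 1 by ring, show k + (n + 1) = k + 1 + n by ring, pow_succ]
          field_simp

/-- Arbitrary polynomial decay away from stationary points. -/
theorem exists_norm_osc_le_of_nonstationary {h : ℝ → ℂ} (hh : IsTest h) (n : ℕ) :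
    ∃ C, 0 ≤ C ∧ ∀ t q : ℝ, IsNonstationary t q → ‖osc h t q‖ ≤ C / (|t| + |q|) ^ n := by
  obtain ⟨C, hC, hb⟩ := exists_norm_oscPow_le n 0 hh
  exact ⟨C, hC, fun t q hn => by simpa [oscPow_zero] using hb t q hn⟩

lemma isNonstationary_zero {t : ℝ} (ht : t ≠ 0) : IsNonstationary t 0 := by
  have := abs_pos.mpr ht
  refine ⟨by simpa using this, fun θ _ => ?_⟩
  simp
  linarith

lemma isNonstationary_of_two_mul_abs_le {t q : ℝ} (ht : 0 < |t|) (h : 2 * |q| ≤ |t|) :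
    IsNonstationary t q := by
  refine ⟨by linarith [abs_nonneg q], fun θ hθ => ?_⟩
  have h1 := abs_sub_abs_le_abs_sub t (q * Real.exp θ)
  rw [abs_mul, abs_of_pos (Real.exp_pos θ)] at h1
  have h2 := mul_le_mul_of_nonneg_left (exp_bounds hθ).2 (abs_nonneg q)
  linarith

lemma isNonstationary_of_two_mul_abs_le' {t q : ℝ} (hq : 0 < |q|) (h : 2 * |t| ≤ |q|) :
    IsNonstationary t q := by
  refine ⟨by linarith [abs_nonneg t], fun θ hθ => ?_⟩
  have h1 := abs_sub_abs_le_abs_sub (q * Real.exp θ) t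
  rw [abs_mul, abs_of_pos (Real.exp_pos θ), abs_sub_comm] at h1
  have h2 := mul_le_mul_of_nonneg_left (exp_bounds hθ).1 (abs_nonneg q)
  linarith

lemma isNonstationary_of_nonpos {t q : ℝ} (ht : t ≤ 0) (hq : 0 ≤ q) (h : 0 < |t| + |q|) :
    IsNonstationary t q := by
  refine ⟨h, fun θ hθ => ?_⟩
  have h2 := mul_le_mul_of_nonneg_left (exp_bounds hθ).1 hq
  rw [abs_of_nonpos ht, abs_of_nonneg hq, abs_of_nonpos (by nlinarith)]
  nlinarith

lemma isNonstationary_of_nonneg {t q : ℝ} (ht : 0 ≤ t) (hq : q ≤ 0) (h : 0 < |t| + |q|) :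
    IsNonstationary t q := by
  refine ⟨h, fun θ hθ => ?_⟩
  have h2 := mul_le_mul_of_nonneg_left (exp_bounds hθ).1 (neg_nonneg.mpr hq)
  rw [abs_of_nonneg ht, abs_of_nonpos hq, abs_of_nonneg (by nlinarith)]
  nlinarith

lemma hasDerivAt_osc {h : ℝ → ℂ} (hh : IsTest h) (t q : ℝ) :
    HasDerivAt (fun t => osc h t q) (osc (fun θ => (θ : ℂ) * h θ) t q * I) t := by
  obtain ⟨H, hH, hb⟩ := hh.bounded
  have hc0 := hh.continuous
  have hF' : ∀ t' θ : ℝ, HasDerivAt (fun t => h θ * phase t q θ)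
      (h θ * (phase t' q θ * ((θ : ℂ) * I))) t' := by
    intro t' θ
    have h1 : HasDerivAt (fun t : ℝ => t * θ - q * Real.exp θ) θ t' := by
      simpa using ((hasDerivAt_id t').mul_const θ).sub_const (q * Real.exp θ)
    exact ((h1.ofReal_comp.mul_const I).cexp).const_mul _
  have := intervalIntegral.hasDerivAt_integral_of_dominated_loc_of_deriv_le
    (μ := volume) (a := (-1 / 2 : ℝ)) (b := 1 / 2) (F := fun t θ => h θ * phase t q θ)
    (F' := fun t θ => h θ * (phase t q θ * ((θ : ℂ) * I))) (x₀ := t) (s := Set.univ)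
    (bound := fun _ => H) univ_mem
    (Eventually.of_forall fun t' => by
      have := continuous_phase t' q
      exact Continuous.aestronglyMeasurable (by fun_prop))
    (by
      have := continuous_phase t q
      exact Continuous.intervalIntegrable (by fun_prop) _ _)
    (by
      have := continuous_phase t q
      exact Continuous.aestronglyMeasurable (by fun_prop))
    (Eventually.of_forall fun θ hθ t' _ => by
      rw [Set.uIoc_of_le (by norm_num)] at hθ
      rw [norm_mul, norm_mul, norm_phase, one_mul, norm_mul, norm_I, mul_one, norm_real,
        Real.norm_eq_abs]
      have h1 : |θ| ≤ 1 := abs_le.mpr ⟨by linarith [hθ.1], by linarith [hθ.2]⟩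
      calc _ ≤ H * 1 := by
            have := hb θ
            gcongr
        _ = H := mul_one H)
    (by simp)
    (Eventually.of_forall fun θ _ t' _ => hF' t' θ)
  refine this.2.congr_deriv ?_
  rw [osc, ← intervalIntegral.integral_mul_const]
  congr 1
  ext θ
  ring

lemma continuous_osc {h : ℝ → ℂ} (hh : IsTest h) (q : ℝ) : Continuous fun t => osc h t q :=
  continuous_iff_continuousAt.mpr fun t => (hasDerivAt_osc hh t q).continuousAt

lemma IsTest.exists_exp_sub_one {h : ℝ → ℂ} (hh : IsTest h) :
    ∃ k : ℝ → ℂ, IsTest k ∧ ∀ θ : ℝ, (θ : ℂ) * k θ = ((Real.exp θ - 1 : ℝ) : ℂ) * h θ := by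
  refine ⟨fun θ => dslope cexp 0 (θ : ℂ) * h θ, hh.mul_left ?_, fun θ => ?_⟩
  · have h1 : Differentiable ℂ (dslope cexp 0) := by
      have := (Complex.differentiableOn_dslope (f := cexp) (s := Set.univ) (c := 0)
        univ_mem).mpr differentiable_exp.differentiableOn
      exact differentiableOn_univ.mp this
    have h2 : ContDiff ℝ ((⊤ : ℕ∞) : WithTop ℕ∞) (dslope cexp 0) := h1.contDiff.restrict_scalars ℝ
    exact h2.comp ofRealCLM.contDiff
  · have := sub_smul_dslope cexp 0 (θ : ℂ)
    simp only [sub_zero, smul_eq_mul, Complex.exp_zero] at this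
    push_cast
    rw [← mul_assoc, this]

/-- `(t - q) osc h = i osc (deriv h) - i q ∂_t osc k`, where `θ k(θ) = (e^θ - 1) h(θ)`. -/
lemma sub_mul_osc {h k : ℝ → ℂ} (hh : IsTest h) (hk : IsTest k)
    (hkh : ∀ θ : ℝ, (θ : ℂ) * k θ = ((Real.exp θ - 1 : ℝ) : ℂ) * h θ) (t q : ℝ) :
    ((t - q : ℝ) : ℂ) * osc h t q =
      I * osc (deriv h) t q + q * osc (fun θ => (θ : ℂ) * k θ) t q := by
  rw [← osc_mul_phase_deriv hh, osc, osc, ← intervalIntegral.integral_const_mul,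
    ← intervalIntegral.integral_const_mul, ← intervalIntegral.integral_add]
  · congr 1
    ext θ
    rw [hkh]
    push_cast
    ring
  · have := hh.continuous
    have := continuous_phase t q
    exact Continuous.intervalIntegrable (by fun_prop) _ _
  · have := hk.continuous
    have := continuous_phase t q
    exact Continuous.intervalIntegrable (by fun_prop) _ _

lemma integral_Ioi_const_div_sq {c C : ℝ} (hc : 0 < c) :
    IntegrableOn (fun s : ℝ => C / s ^ 2) (Set.Ioi c) ∧
      ∫ s in Set.Ioi c, C / s ^ 2 = C / c := by
  have h1 : ∀ s ∈ Set.Ioi c, C / s ^ 2 = C * s ^ (-2 : ℝ) := by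
    intro s hs
    have : 0 < s := hc.trans hs
    rw [Real.rpow_neg this.le]
    norm_cast
  have h2 : IntegrableOn (fun s : ℝ => C * s ^ (-2 : ℝ)) (Set.Ioi c) :=
    (integrableOn_Ioi_rpow_of_lt (by norm_num : (-2 : ℝ) < -1) hc).const_mul C
  refine ⟨h2.congr_fun (fun s hs => (h1 s hs).symm) measurableSet_Ioi, ?_⟩
  rw [setIntegral_congr_fun measurableSet_Ioi h1, integral_const_mul,
    integral_Ioi_rpow_of_lt (by norm_num) hc]
  norm_num
  rw [Real.rpow_neg_one]
  field_simp

lemma intervalIntegral_const_div_sq {c d C : ℝ} (hc : 0 < c) (hcd : c ≤ d) :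
    IntervalIntegrable (fun s : ℝ => C / s ^ 2) volume c d ∧
      ∫ s in c..d, C / s ^ 2 = C / c - C / d := by
  have hpos : ∀ s ∈ Set.uIcc c d, 0 < s := fun s hs => by
    rw [Set.uIcc_of_le hcd] at hs
    exact hc.trans_le hs.1
  have hi : IntervalIntegrable (fun s : ℝ => C / s ^ 2) volume c d :=
    ContinuousOn.intervalIntegrable (continuousOn_const.div (by fun_prop)
      fun s hs => pow_ne_zero 2 (hpos s hs).ne')
  refine ⟨hi, ?_⟩
  rw [intervalIntegral.integral_eq_sub_of_hasDerivAt (f := fun s => -(C / s)) _ hi]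
  · ring
  · intro s hs
    have h3 : HasDerivAt (fun s : ℝ => -C * s⁻¹) (C / s ^ 2) s :=
      ((hasDerivAt_inv (hpos s hs).ne').const_mul (-C)).congr_deriv (by ring)
    exact h3.congr_of_eventuallyEq (Eventually.of_forall fun x => by simp only; ring)

lemma norm_osc_sub_le {h : ℝ → ℂ} (hh : IsTest h) : ∃ C, 0 < C ∧
    ∀ ε : ℝ, (ε = 1 ∨ ε = -1) → ∀ q s : ℝ, 1 ≤ q → q ≤ s →
      ‖osc h (q + ε * s) q‖ ≤ C / s ^ 2 := by
  obtain ⟨C, hC, hb⟩ := exists_norm_osc_le_of_nonstationary hh 2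
  refine ⟨C + 1, by positivity, fun ε hε q s hq hs => ?_⟩
  have hs0 : 0 < s := by linarith
  have : IsNonstationary (q + ε * s) q ∧ s ≤ |q + ε * s| + |q| := by
    rcases hε with rfl | rfl
    · rw [abs_of_nonneg (by linarith), abs_of_nonneg (by linarith)]
      refine ⟨isNonstationary_of_two_mul_abs_le ?_ ?_, by linarith⟩
      · rw [abs_of_nonneg (by linarith)]; linarith
      · rw [abs_of_nonneg (by linarith), abs_of_nonneg (by linarith)]; linarith
    · rw [abs_of_nonpos (a := q + -1 * s) (by linarith), abs_of_nonneg (a := q) (by linarith)]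
      refine ⟨isNonstationary_of_nonpos (by linarith) (by linarith) ?_, by linarith⟩
      have : 0 < |q| := abs_pos.mpr (by linarith)
      positivity
  calc _ ≤ C / (|q + ε * s| + |q|) ^ 2 := hb _ _ this.1
    _ ≤ (C + 1) / s ^ 2 := by
      have := this.2
      gcongr
      linarith

/-- Estimate for the piece `[d, q]` of the tail by integration by parts. -/
lemma exists_norm_integral_osc_piece_le {h : ℝ → ℂ} (hh : IsTest h) : ∃ C, 0 < C ∧
    ∀ ε : ℝ, (ε = 1 ∨ ε = -1) → ∀ q d : ℝ, 1 ≤ q → 0 < d → d ≤ q →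
      ‖∫ s in d..q, osc h (q + ε * s) q‖ ≤ C * √q / d := by
  obtain ⟨k, hk, hkh⟩ := hh.exists_exp_sub_one
  obtain ⟨C₁, hC₁, hb₁⟩ := exists_norm_osc_le_rpow hh.deriv
  obtain ⟨C₂, hC₂, hb₂⟩ := exists_norm_osc_le_rpow hk
  refine ⟨C₁ + 2 * C₂, by positivity, fun ε hε q d hq hd hdq => ?_⟩
  have hq0 : 0 < q := by linarith
  have hsq : 0 < √q := Real.sqrt_pos.mpr hq0
  have hqq : q / √q = √q := Real.div_sqrt
  have hε2 : ε * ε = 1 := by rcases hε with rfl | rfl <;> norm_num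
  have hεa : |ε| = 1 := by rcases hε with rfl | rfl <;> norm_num
  have hpos : ∀ s ∈ Set.uIcc d q, s ≠ 0 := fun s hs => by
    rw [Set.uIcc_of_le hdq] at hs
    exact (hd.trans_le hs.1).ne'
  have hlin : ∀ s : ℝ, HasDerivAt (fun s : ℝ => q + ε * s) ε s := fun s => by
    simpa using ((hasDerivAt_id s).const_mul ε).const_add q
  have hc : ∀ {g : ℝ → ℂ}, IsTest g → Continuous fun s => osc g (q + ε * s) q := fun hg =>
    (continuous_osc hg q).comp (by fun_prop)
  have hθk : IsTest fun θ => (θ : ℂ) * k θ := hk.mul_left ofRealCLM.contDiff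
  have hGd : ∀ s ∈ Set.uIcc d q, HasDerivAt
      (fun s : ℝ => osc k (q + ε * s) q * (((1 / s : ℝ)) : ℂ))
      (osc (fun θ => (θ : ℂ) * k θ) (q + ε * s) q * I * ε * ((1 / s : ℝ) : ℂ) +
        osc k (q + ε * s) q * ((-(1 / s ^ 2) : ℝ) : ℂ)) s := by
    intro s hs
    have h1 := (hasDerivAt_osc hk (q + ε * s) q).scomp s (hlin s)
    have h2 : HasDerivAt (fun s : ℝ => 1 / s) (-(1 / s ^ 2)) s := by
      simpa using hasDerivAt_inv (hpos s hs)
    refine (h1.mul h2.ofReal_comp).congr_deriv ?_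
    simp only [real_smul]
    push_cast
    simp only [Function.comp_apply]
    ring
  have hinv : ContinuousOn (fun s : ℝ => ((1 / s : ℝ) : ℂ)) (Set.uIcc d q) :=
    continuous_ofReal.comp_continuousOn (continuousOn_const.div continuousOn_id hpos)
  have hinv2 : ContinuousOn (fun s : ℝ => ((1 / s ^ 2 : ℝ) : ℂ)) (Set.uIcc d q) :=
    continuous_ofReal.comp_continuousOn (continuousOn_const.div (by fun_prop)
      fun s hs => pow_ne_zero 2 (hpos s hs))
  have hcont := (hc hk).continuousOn (s := Set.uIcc d q)
  have hcont1 := (hc hh.deriv).continuousOn (s := Set.uIcc d q)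
  have hcont2 := (hc hθk).continuousOn (s := Set.uIcc d q)
  have hFTC := intervalIntegral.integral_eq_sub_of_hasDerivAt hGd
    (ContinuousOn.intervalIntegrable (by push_cast at *; fun_prop))
  set R : ℝ → ℂ := fun s => I * ε * osc (deriv h) (q + ε * s) q * ((1 / s : ℝ) : ℂ) -
    I * q * (osc k (q + ε * s) q * ((1 / s ^ 2 : ℝ) : ℂ)) with hR
  have hRi : IntervalIntegrable R volume d q :=
    ContinuousOn.intervalIntegrable (by simp only [hR]; push_cast at *; fun_prop)
  have key : ∫ s in d..q, osc h (q + ε * s) q =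
      (∫ s in d..q, R s) + (-(I * q)) * (osc k (q + ε * q) q * (((1 / q : ℝ)) : ℂ) -
        osc k (q + ε * d) q * (((1 / d : ℝ)) : ℂ)) := by
    rw [← hFTC, ← intervalIntegral.integral_const_mul, ← intervalIntegral.integral_add hRi
      (ContinuousOn.intervalIntegrable (by push_cast at *; fun_prop))]
    refine intervalIntegral.integral_congr fun s hs => ?_
    have e := sub_mul_osc hh hk hkh (q + ε * s) q
    have hs0 := hpos s hs
    have hsc : (s : ℂ) ≠ 0 := ofReal_ne_zero.mpr hs0
    have hεc : (ε : ℂ) * ε = 1 := by exact_mod_cast hε2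
    simp only [hR]
    have e' : osc h (q + ε * s) q = (I * osc (deriv h) (q + ε * s) q +
        q * osc (fun θ => (θ : ℂ) * k θ) (q + ε * s) q) * ε * ((1 / s : ℝ) : ℂ) := by
      rw [← e]
      push_cast
      field_simp
      linear_combination (-osc h (q + ε * s) q * s) * hεc
    rw [e']
    push_cast
    linear_combination ((q : ℂ) * osc (fun θ => (θ : ℂ) * k θ) (q + ε * s) q * ε * (1 / s)) *
      I_mul_I
  have hRb : ‖∫ s in d..q, R s‖ ≤ ∫ s in d..q, (C₁ * √q + C₂ * √q) / s ^ 2 := by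
    refine intervalIntegral.norm_integral_le_of_norm_le hdq (Eventually.of_forall fun s hs => ?_)
      (intervalIntegral_const_div_sq hd hdq).1
    have hs0 : 0 < s := hd.trans hs.1
    have b1 := hb₁ (q + ε * s) q hq0
    have b2 := hb₂ (q + ε * s) q hq0
    have b3 : 1 / s ≤ q / s ^ 2 := by
      rw [div_le_div_iff₀ hs0 (by positivity)]
      nlinarith [hs.2]
    simp only [hR]
    refine (norm_sub_le _ _).trans ?_
    simp only [norm_mul, norm_I, one_mul, norm_real, Real.norm_eq_abs, hεa, abs_of_pos hq0]
    rw [abs_of_pos (by positivity : 0 < 1 / s), abs_of_pos (by positivity : 0 < 1 / s ^ 2)]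
    calc _ ≤ C₁ / √q * (q / s ^ 2) + q * (C₂ / √q * (1 / s ^ 2)) := by gcongr
      _ = (C₁ * (q / √q) + C₂ * (q / √q)) / s ^ 2 := by ring
      _ = _ := by rw [hqq]
  rw [(intervalIntegral_const_div_sq hd hdq).2] at hRb
  have b1 := hb₂ (q + ε * q) q hq0
  have b2 := hb₂ (q + ε * d) q hq0
  rw [key]
  calc _ ≤ ((C₁ * √q + C₂ * √q) / d - (C₁ * √q + C₂ * √q) / q) +
        q * (C₂ / √q * (1 / q) + C₂ / √q * (1 / d)) := by
        refine (norm_add_le _ _).trans (add_le_add hRb ?_)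
        rw [norm_mul, norm_neg, norm_mul, norm_I, one_mul, norm_real, Real.norm_of_nonneg hq0.le]
        gcongr
        refine (norm_sub_le _ _).trans ?_
        rw [norm_mul, norm_mul, norm_real, norm_real, Real.norm_of_nonneg (by positivity),
          Real.norm_of_nonneg (by positivity)]
        gcongr
    _ = (C₁ + 2 * C₂) * √q / d - C₁ * √q / q := by
        rw [show q * (C₂ / √q * (1 / q) + C₂ / √q * (1 / d)) =
          C₂ * (q / √q) / q + C₂ * (q / √q) / d by field_simp, hqq]
        ring
    _ ≤ _ := by
        have : 0 ≤ C₁ * √q / q := by positivity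
        linarith

lemma integrable_osc {h : ℝ → ℂ} (hh : IsTest h) (q : ℝ) : Integrable fun t => osc h t q := by
  obtain ⟨C, hC, hb⟩ := exists_norm_osc_le_of_nonstationary hh 2
  have key : ∀ t : ℝ, 2 * |q| + 1 ≤ |t| → ‖osc h t q‖ ≤ 2 * C * ‖(1 + t ^ 2)⁻¹‖ := by
    intro t ht
    have h0 := abs_nonneg q
    have h1 := hb t q (isNonstationary_of_two_mul_abs_le (by linarith) (by linarith))
    have h2 : 1 + t ^ 2 ≤ 2 * (|t| + |q|) ^ 2 := by
      rw [← sq_abs t]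
      nlinarith
    rw [Real.norm_of_nonneg (by positivity)]
    refine h1.trans ?_
    rw [← div_eq_mul_inv, div_le_div_iff₀ (by nlinarith) (by positivity)]
    nlinarith
  refine (continuous_osc hh q).locallyIntegrable.integrable_of_isBigO_atBot_atTop
    (g := fun t => (1 + t ^ 2)⁻¹) (g' := fun t => (1 + t ^ 2)⁻¹) ?_
    (integrable_inv_one_add_sq.integrableAtFilter _) ?_
    (integrable_inv_one_add_sq.integrableAtFilter _)
  · refine Asymptotics.IsBigO.of_bound (2 * C) ?_
    filter_upwards [eventually_le_atBot (-(2 * |q| + 1))] with t ht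
    exact key t (by rw [le_abs]; right; linarith)
  · refine Asymptotics.IsBigO.of_bound (2 * C) ?_
    filter_upwards [eventually_ge_atTop (2 * |q| + 1)] with t ht
    exact key t (by rw [le_abs]; left; linarith)

/-- Fourier inversion for the oscillatory integral. -/
lemma integral_osc {h : ℝ → ℂ} (hh : IsTest h) (q : ℝ) :
    ∫ t, osc h t q = 2 * Real.pi * (h 0 * cexp (((-q : ℝ) : ℂ) * I)) := by
  set F : ℝ → ℂ := fun θ => h θ * phase 0 q θ with hF
  have hc := hh.continuous
  have hcp := continuous_phase 0 q
  have hFc : Continuous F := by fun_prop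
  have hFi : Integrable F := hFc.integrable_of_hasCompactSupport
    (hh.hasCompactSupport.mul_right)
  have hft : (FourierTransform.fourier F : ℝ → ℂ) = fun w => osc h (w * (-(2 * Real.pi))) q := by
    ext w
    rw [Real.fourier_real_eq_integral_exp_smul, osc_eq_integral hh]
    congr 1
    ext θ
    simp only [hF, smul_eq_mul, phase]
    rw [mul_left_comm, ← Complex.exp_add]
    congr 2
    push_cast
    ring
  have hpi : (-(2 * Real.pi)) ≠ 0 := by have := Real.pi_pos; linarith
  have hFi' : Integrable (FourierTransform.fourier F : ℝ → ℂ) := by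
    rw [hft]
    exact (integrable_comp_mul_right_iff _ hpi).mpr (integrable_osc hh q)
  have inv := hFi.fourierInv_fourier_eq hFi' hFc.continuousAt (v := 0)
  rw [Real.fourierInv_eq', hft] at inv
  simp only [inner_zero_right, mul_zero, ofReal_zero, zero_mul, Complex.exp_zero, one_smul] at inv
  rw [Measure.integral_comp_mul_right (fun t => osc h t q)] at inv
  have hp : |(-(2 * Real.pi))⁻¹| = (2 * Real.pi)⁻¹ := by
    rw [abs_inv, abs_neg, abs_of_pos (by positivity)]
  rw [hp] at inv
  have h2 : (2 * Real.pi : ℂ) * ((((2 * Real.pi)⁻¹ : ℝ)) • ∫ t, osc h t q) = ∫ t, osc h t q := by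
    rw [real_smul, ← mul_assoc]
    push_cast
    rw [mul_inv_cancel₀ (by norm_num [Real.pi_ne_zero]), one_mul]
  rw [← h2, inv]
  simp [hF, phase]

/-- The size of the error term at an endpoint. -/
noncomputable def edge (q d : ℝ) : ℝ := √q / (√q + |d|)

lemma edge_nonneg (q d : ℝ) : 0 ≤ edge q d := by unfold edge; positivity

lemma edge_neg (q d : ℝ) : edge q (-d) = edge q d := by unfold edge; rw [abs_neg]

lemma exists_norm_integral_tail_le {h : ℝ → ℂ} (hh : IsTest h) : ∃ C, 0 < C ∧
    ∀ ε : ℝ, (ε = 1 ∨ ε = -1) → ∀ q d : ℝ, 1 ≤ q → 0 ≤ d →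
      ‖∫ s in Set.Ioi d, osc h (q + ε * s) q‖ ≤ C * edge q d := by
  obtain ⟨C₁, hC₁, hb₁⟩ := norm_osc_sub_le hh
  obtain ⟨C₂, hC₂, hb₂⟩ := exists_norm_integral_osc_piece_le hh
  obtain ⟨C₃, hC₃, hb₃⟩ := exists_norm_osc_le_rpow hh
  refine ⟨2 * (C₁ + C₂ + C₃), by positivity, fun ε hε q d hq hd => ?_⟩
  have hq0 : 0 < q := by linarith
  have hsq1 : 1 ≤ √q := by rw [Real.one_le_sqrt]; exact hq
  have hsq : 0 < √q := by linarith
  have hsqq : √q * √q = q := Real.mul_self_sqrt hq0.le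
  have hqi : Integrable fun s => osc h (q + ε * s) q := by
    have hε0 : ε ≠ 0 := by rcases hε with rfl | rfl <;> norm_num
    have h1 : Integrable fun s => osc h (q + s) q := (integrable_osc hh q).comp_add_left q
    exact (integrable_comp_mul_left_iff (fun s => osc h (q + s) q) hε0).mpr h1
  have far : ∀ e, q ≤ e → ‖∫ s in Set.Ioi e, osc h (q + ε * s) q‖ ≤ C₁ / e := by
    intro e he
    have he0 : 0 < e := by linarith
    rw [← (integral_Ioi_const_div_sq (C := C₁) he0).2]
    refine norm_integral_le_of_norm_le (integral_Ioi_const_div_sq he0).1 ?_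
    filter_upwards [ae_restrict_mem measurableSet_Ioi] with s hs
    exact hb₁ ε hε q s hq (he.trans (le_of_lt hs))
  have mid : ∀ e, √q ≤ e → ‖∫ s in Set.Ioi e, osc h (q + ε * s) q‖ ≤ (C₁ + C₂) * √q / e := by
    intro e he
    have he0 : 0 < e := by linarith
    rcases le_total q e with h1 | h1
    · refine (far e h1).trans ?_
      gcongr
      nlinarith
    · rw [← intervalIntegral.integral_interval_add_Ioi hqi.integrableOn (b := q) hqi.integrableOn]
      refine (norm_add_le _ _).trans ?_
      have e1 := hb₂ ε hε q e hq he0 h1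
      have e2 := far q le_rfl
      have e3 : C₁ / q ≤ C₁ * √q / e := by
        rw [div_le_div_iff₀ hq0 he0]
        calc C₁ * e ≤ C₁ * (1 * q) := by gcongr; linarith
          _ ≤ C₁ * (√q * q) := by gcongr
          _ = _ := by ring
      calc _ ≤ C₂ * √q / e + C₁ * √q / e := by linarith
        _ = _ := by ring
  rw [edge, abs_of_nonneg hd]
  rcases le_total (√q) d with h1 | h1
  · have hd0 : 0 < d := by linarith
    refine (mid d h1).trans ?_
    rw [mul_div_assoc, mul_assoc 2, mul_left_comm]
    have : √q / d ≤ 2 * (√q / (√q + d)) := by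
      rw [← mul_div_assoc, div_le_div_iff₀ hd0 (by positivity)]
      nlinarith
    exact mul_le_mul (by linarith) this (by positivity) (by positivity)
  · rw [← intervalIntegral.integral_interval_add_Ioi hqi.integrableOn (b := √q) hqi.integrableOn]
    have e1 : ‖∫ s in d..√q, osc h (q + ε * s) q‖ ≤ C₃ := by
      refine (intervalIntegral.norm_integral_le_of_norm_le_const (C := C₃ / √q)
        fun s _ => hb₃ _ _ hq0).trans ?_
      rw [abs_of_nonneg (by linarith), div_mul_eq_mul_div, div_le_iff₀ hsq]
      gcongr
      linarith
    have e2 := mid (√q) le_rfl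
    rw [mul_div_assoc, div_self hsq.ne', mul_one] at e2
    have e3 : 1 ≤ 2 * (√q / (√q + d)) := by
      rw [← mul_div_assoc, one_le_div (by positivity)]
      linarith
    calc _ ≤ (C₁ + C₂ + C₃) * 1 := (norm_add_le _ _).trans (by linarith)
      _ ≤ (C₁ + C₂ + C₃) * (2 * (√q / (√q + d))) := by gcongr
      _ = _ := by ring

lemma integral_Ioi_osc (h : ℝ → ℂ) (q T : ℝ) :
    ∫ t in Set.Ioi T, osc h t q = ∫ s in Set.Ioi (T - q), osc h (q + 1 * s) q := by
  have := (measurePreserving_add_left volume q).setIntegral_preimage_emb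
    (measurableEmbedding_addLeft q) (fun t => osc h t q) (Set.Ioi T)
  rw [← this]
  simp

lemma integral_Iic_osc (h : ℝ → ℂ) (q T : ℝ) :
    ∫ t in Set.Iic T, osc h t q = ∫ s in Set.Ioi (q - T), osc h (q + (-1) * s) q := by
  have := (Measure.measurePreserving_sub_left volume q).setIntegral_preimage_emb
    (MeasurableEquiv.subLeft q).measurableEmbedding (fun t => osc h t q) (Set.Iic T)
  rw [← this, ← integral_Ici_eq_integral_Ioi]
  simp [← sub_eq_add_neg]

/-- The truncated Fourier integral of the oscillatory integral. -/
theorem exists_norm_integral_osc_sub_le {h : ℝ → ℂ} (hh : IsTest h) : ∃ C, 0 < C ∧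
    ∀ q T₁ T₂ : ℝ, 1 ≤ q → T₁ ≤ T₂ →
      ‖(∫ t in T₁..T₂, osc h t q) -
        (if T₁ < q ∧ q ≤ T₂ then 2 * Real.pi * (h 0 * cexp (((-q : ℝ) : ℂ) * I)) else 0)‖ ≤
      C * (edge q (q - T₁) + edge q (q - T₂)) := by
  obtain ⟨C, hC, hb⟩ := exists_norm_integral_tail_le hh
  refine ⟨C, hC, fun q T₁ T₂ hq hT => ?_⟩
  have hi := integrable_osc hh q
  have hr : ∀ T, q ≤ T → ‖∫ t in Set.Ioi T, osc h t q‖ ≤ C * edge q (q - T) := by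
    intro T h1
    rw [integral_Ioi_osc, ← edge_neg, neg_sub]
    exact hb 1 (Or.inl rfl) q _ hq (by linarith)
  have hl : ∀ T, T ≤ q → ‖∫ t in Set.Iic T, osc h t q‖ ≤ C * edge q (q - T) := by
    intro T h1
    rw [integral_Iic_osc]
    exact hb (-1) (Or.inr rfl) q _ hq (by linarith)
  rw [mul_add]
  by_cases h1 : T₁ < q
  · by_cases h2 : q ≤ T₂
    · rw [if_pos ⟨h1, h2⟩, ← integral_osc hh,
        ← intervalIntegral.integral_Iic_add_Ioi (b := T₂) hi.integrableOn hi.integrableOn,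
        ← intervalIntegral.integral_Iic_sub_Iic (a := T₁) hi.integrableOn hi.integrableOn]
      have e1 := hl T₁ h1.le
      have e2 := hr T₂ h2
      rw [sub_sub, ← add_assoc, add_comm (∫ t in Set.Iic T₁, osc h t q), add_assoc, sub_add_cancel_left,
        norm_neg]
      exact (norm_add_le _ _).trans (add_le_add e1 e2)
    · rw [if_neg (fun h => h2 h.2), sub_zero,
        ← intervalIntegral.integral_Iic_sub_Iic hi.integrableOn hi.integrableOn]
      exact (norm_sub_le _ _).trans (by linarith [hl T₁ h1.le, hl T₂ (not_le.mp h2).le])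
  · rw [if_neg (fun h => h1 h.1), sub_zero,
      ← intervalIntegral.integral_Ioi_sub_Ioi hi.integrableOn hT]
    exact (norm_sub_le _ _).trans (by linarith [hr T₁ (not_lt.mp h1), hr T₂ ((not_lt.mp h1).trans hT)])

/-- Decay of the oscillatory integral outside the stationary range. -/
theorem exists_norm_osc_le_div_sq {h : ℝ → ℂ} (hh : IsTest h) : ∃ C, 0 < C ∧
    ∀ t q : ℝ, 0 < t → (2 * t ≤ q ∨ q < 0) → ‖osc h t q‖ ≤ C / q ^ 2 := by
  obtain ⟨C, hC, hb⟩ := exists_norm_osc_le_of_nonstationary hh 2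
  refine ⟨C + 1, by positivity, fun t q ht hq => ?_⟩
  have hq0 : 0 < |q| := abs_pos.mpr (by rcases hq with h1 | h1 <;> linarith)
  have hn : IsNonstationary t q := by
    rcases hq with h1 | h1
    · refine isNonstationary_of_two_mul_abs_le' hq0 ?_
      rwa [abs_of_pos ht, abs_of_pos (by linarith)]
    · exact isNonstationary_of_nonneg ht.le h1.le (by positivity)
  refine (hb t q hn).trans ?_
  rw [← sq_abs q]
  gcongr
  · linarith
  · linarith [abs_nonneg t]

/-- Rapid decay of the Fourier transform of a test function. -/
theorem exists_norm_osc_zero_le {h : ℝ → ℂ} (hh : IsTest h) (n : ℕ) : ∃ C, 0 < C ∧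
    ∀ t : ℝ, t ≠ 0 → ‖osc h t 0‖ ≤ C / |t| ^ n := by
  obtain ⟨C, hC, hb⟩ := exists_norm_osc_le_of_nonstationary hh n
  refine ⟨C + 1, by positivity, fun t ht => ?_⟩
  have := hb t 0 (isNonstationary_zero ht)
  rw [abs_zero, add_zero] at this
  refine this.trans ?_
  have := abs_pos.mpr ht
  gcongr
  linarith

lemma IsTest.exp_mul {g : ℝ → ℂ} (hg : IsTest g) : IsTest fun θ => (Real.exp θ : ℂ) * g θ :=
  hg.mul_left (ofRealCLM.contDiff.comp Real.contDiff_exp)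

lemma exists_norm_osc_int_le {h : ℝ → ℂ} (hh : IsTest h) {u T : ℝ} (hu : 0 < u) (hT : 0 < T) :
    ∃ D : ℤ → ℝ, Summable D ∧ ∀ t, 0 < t → t ≤ T → ∀ k : ℤ,
      ‖osc h t (2 * Real.pi * k * u)‖ ≤ D k := by
  obtain ⟨H, hH, hb₀⟩ := hh.bounded
  obtain ⟨C, hC, hb⟩ := exists_norm_osc_le_div_sq hh
  set E := (C + 4 * H * T ^ 2) / (2 * Real.pi * u) ^ 2 with hE
  refine ⟨fun k => E * (1 / (k : ℝ) ^ 2) + if k = 0 then H else 0, ?_, fun t ht htT k => ?_⟩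
  · exact ((Real.summable_one_div_int_pow.mpr (by norm_num)).mul_left _).add
      (summable_of_hasFiniteSupport ((Set.finite_singleton 0).subset fun k hk => by
        by_contra h0
        exact hk (if_neg h0)))
  · have hE0 : 0 ≤ E := by positivity
    by_cases hk : k = 0
    · subst hk
      simpa using norm_osc_le_of_bound hb₀ t 0
    · have hkr : (k : ℝ) ≠ 0 := Int.cast_ne_zero.mpr hk
      set q := 2 * Real.pi * k * u with hq
      have hq0 : q ≠ 0 := by positivity
      have e : E * (1 / (k : ℝ) ^ 2) = (C + 4 * H * T ^ 2) / q ^ 2 := by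
        rw [hE, hq]; field_simp
      simp only [if_neg hk, add_zero]
      rw [e]
      by_cases h1 : 2 * t ≤ q ∨ q < 0
      · refine (hb t q ht h1).trans ?_
        gcongr
        have : 0 ≤ 4 * H * T ^ 2 := by positivity
        linarith
      · push Not at h1
        refine (norm_osc_le_of_bound hb₀ t q).trans ?_
        rw [le_div_iff₀ (by positivity)]
        have : q ^ 2 ≤ (2 * T) ^ 2 := pow_le_pow_left₀ h1.2 (by linarith) 2
        nlinarith

/-- Poisson summation for a sum over a multiplicative window around `u`. -/
lemma sum_test_eq_tsum_osc {g : ℝ → ℂ} (hg : IsTest g) {a : ℝ} (ha : 0 < a) (ha1 : a ≤ 1)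
    {u t : ℝ} (hu : 0 < u) (ht : 0 < t) {B : ℕ} (hB : u * Real.exp (1 / 2) ≤ B + a) :
    ∑ n ∈ range B, g (Real.log ((n + a) / u)) * cexp (((t * Real.log ((n + a) / u) : ℝ) : ℂ) * I) =
      ∑' k : ℤ, u * osc (fun θ => (Real.exp θ : ℂ) * g θ) t (2 * Real.pi * k * u) *
        cexp (((2 * Real.pi * k * a : ℝ) : ℂ) * I) := by
  set f : ℝ → ℂ := fun v => if 0 < v then
    g (Real.log (v / u)) * cexp (((t * Real.log (v / u) : ℝ) : ℂ) * I) else 0 with hf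
  have hgc := hg.continuous
  have hlog : ∀ v, 0 < v → Real.exp (Real.log (v / u)) = v / u := fun v hv =>
    Real.exp_log (div_pos hv hu)
  have hz1 : ∀ v, v < u * Real.exp (-1 / 2) → f v = 0 := by
    intro v hv
    simp only [hf]
    split_ifs with h0
    · rw [hg.zero, zero_mul]
      rintro ⟨h1, _⟩
      have := Real.exp_le_exp.mpr h1
      rw [hlog v h0, le_div_iff₀ hu] at this
      linarith
    · rfl
  have hz2 : ∀ v, u * Real.exp (1 / 2) ≤ v → f v = 0 := by
    intro v hv
    have h0 : 0 < v := lt_of_lt_of_le (by positivity) hv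
    simp only [hf]
    rw [if_pos h0, hg.eq_zero_of_le, zero_mul]
    refine le_trans ?_ (le_abs_self _)
    rw [Real.le_log_iff_exp_le (div_pos h0 hu), le_div_iff₀ hu]
    linarith
  have hfc : Continuous f := by
    rw [continuous_iff_continuousAt]
    intro v
    by_cases hv : 0 < v
    · have : f =ᶠ[nhds v] fun v =>
          g (Real.log (v / u)) * cexp (((t * Real.log (v / u) : ℝ) : ℂ) * I) :=
        eventually_of_mem (Ioi_mem_nhds hv) fun x hx => if_pos hx
      refine ContinuousAt.congr ?_ this.symm
      have h1 : ContinuousAt (fun v => Real.log (v / u)) v :=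
        (continuousAt_id.div_const u).log (div_pos hv hu).ne'
      have h2 : ContinuousAt (fun v => ((Real.log (v / u) : ℝ) : ℂ)) v :=
        continuous_ofReal.continuousAt.comp h1
      refine (hgc.continuousAt.comp h1).mul ?_
      push_cast
      fun_prop
    · have h1 : v < u * Real.exp (-1 / 2) := lt_of_le_of_lt (not_lt.mp hv) (by positivity)
      have : f =ᶠ[nhds v] fun _ => 0 := eventually_of_mem (Iio_mem_nhds h1) hz1
      exact continuousAt_const.congr this.symm
  have hfs : HasCompactSupport f := by
    refine HasCompactSupport.intro (K := Set.Icc 0 (u * Real.exp (1 / 2))) isCompact_Icc ?_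
    intro v hv
    by_cases h0 : 0 ≤ v
    · exact hz2 v (le_of_lt (not_le.mp fun h1 => hv ⟨h0, h1⟩))
    · exact hz1 v (lt_trans (not_le.mp h0) (by positivity))
  have hft : ∀ k : ℤ, (FourierTransform.fourier f : ℝ → ℂ) k =
      u * osc (fun θ => (Real.exp θ : ℂ) * g θ) t (2 * Real.pi * k * u) := by
    intro k
    rw [Real.fourier_real_eq_integral_exp_smul, osc_eq_integral hg.exp_mul]
    have himg : (fun θ : ℝ => u * Real.exp θ) '' Set.univ = Set.Ioi 0 := by
      ext v
      simp only [Set.image_univ, Set.mem_range, Set.mem_Ioi]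
      constructor
      · rintro ⟨θ, rfl⟩; positivity
      · intro hv
        exact ⟨Real.log (v / u), by rw [hlog v hv]; field_simp⟩
    have hs : ∫ v : ℝ, cexp (((-2 * Real.pi * v * k : ℝ) : ℂ) * I) • f v =
        ∫ v in Set.Ioi 0, cexp (((-2 * Real.pi * v * k : ℝ) : ℂ) * I) • f v := by
      refine (setIntegral_eq_integral_of_forall_compl_eq_zero fun v hv => ?_).symm
      have : f v = 0 := if_neg hv
      rw [this, smul_zero]
    rw [hs, ← himg, integral_image_eq_integral_abs_deriv_smul (f' := fun θ => u * Real.exp θ)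
      MeasurableSet.univ
      (fun θ _ => ((Real.hasDerivAt_exp θ).const_mul u).hasDerivWithinAt)
      (fun x _ y _ hxy => Real.exp_injective (mul_left_cancel₀ hu.ne' hxy)),
      setIntegral_univ, ← integral_const_mul]
    congr 1
    ext θ
    have h0 : 0 < u * Real.exp θ := by positivity
    simp only [hf]
    rw [if_pos h0, mul_div_cancel_left₀ _ hu.ne', Real.log_exp, abs_of_pos h0]
    simp only [smul_eq_mul, real_smul, phase]
    rw [mul_left_comm (cexp _), ← Complex.exp_add]
    rw [show ((-2 * Real.pi * (u * Real.exp θ) * k : ℝ) : ℂ) * I + ((t * θ : ℝ) : ℂ) * I =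
      ((t * θ - 2 * Real.pi * k * u * Real.exp θ : ℝ) : ℂ) * I by push_cast; ring]
    push_cast
    ring
  have hsum : Summable fun k : ℤ => (FourierTransform.fourier f : ℝ → ℂ) k := by
    obtain ⟨D, hD, hb⟩ := exists_norm_osc_int_le hg.exp_mul hu ht
    refine Summable.of_norm_bounded (hD.mul_left u) fun k => ?_
    rw [hft, norm_mul, norm_real, Real.norm_of_nonneg hu.le]
    have := hb t ht le_rfl k
    gcongr
  have hdecay : f =O[cocompact ℝ] fun x : ℝ => |x| ^ (-2 : ℝ) := by
    have h1 : f =ᶠ[cocompact ℝ] fun _ => (0 : ℂ) := by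
      rw [hasCompactSupport_iff_eventuallyEq] at hfs
      exact hfs.filter_mono (by exact cocompact_le_coclosedCompact)
    exact h1.trans_isBigO (Asymptotics.isBigO_zero _ _)
  have hP := Real.tsum_eq_tsum_fourier_of_rpow_decay_of_summable hfc one_lt_two hdecay hsum a
  have hL : ∑' n : ℤ, f (a + n) = ∑ n ∈ range B, f (a + n) := by
    rw [tsum_eq_sum (s := (range B).map Nat.castEmbedding), sum_map]
    · simp
    · intro n hn
      rcases lt_or_ge n 0 with h0 | h0
      · refine if_neg ?_
        have : (n : ℝ) ≤ -1 := by exact_mod_cast Int.le_sub_one_of_lt h0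
        linarith
      · lift n to ℕ using h0
        refine hz2 _ ?_
        have : B ≤ n := by
          by_contra hlt
          exact hn (by simpa using not_le.mp hlt)
        have : (B : ℝ) ≤ n := by exact_mod_cast this
        push_cast
        linarith
  rw [hL] at hP
  rw [show ∑ n ∈ range B, g (Real.log ((n + a) / u)) *
      cexp (((t * Real.log ((n + a) / u) : ℝ) : ℂ) * I) = ∑ n ∈ range B, f (a + n) from
    sum_congr rfl fun n _ => by
      simp only [hf]
      rw [if_pos (by positivity), add_comm a], hP]
  congr 1
  ext k
  rw [hft, fourier_coe_apply]
  congr 2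
  push_cast
  ring

lemma hasSum_finset_ite {f : ℤ → ℝ} (K : ℕ) :
    HasSum (fun k : ℤ => if k ∈ (Icc 1 K).map Nat.castEmbedding then f k else 0)
      (∑ k ∈ Icc 1 K, f k) := by
  have : HasSum (fun k : ℤ => if k ∈ (Icc 1 K).map Nat.castEmbedding then f k else 0) _ :=
    hasSum_sum_of_ne_finset_zero (s := (Icc 1 K).map Nat.castEmbedding)
      (fun k hk => if_neg hk)
  rw [sum_ite_mem, inter_self, sum_map] at this
  exact this

/-- The windowed sum integrated over `[T₁, T₂]`. -/
noncomputable def windowInt (g : ℝ → ℂ) (a u T₁ T₂ : ℝ) (B : ℕ) : ℂ :=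
  ∑ n ∈ range B, g (Real.log ((n + a) / u)) *
    ∫ t in T₁..T₂, cexp (((t * Real.log ((n + a) / u) : ℝ) : ℂ) * I)

lemma hasSum_windowInt {g : ℝ → ℂ} (hg : IsTest g) {a : ℝ} (ha : 0 < a) (ha1 : a ≤ 1)
    {u T₁ T₂ : ℝ} (hu : 0 < u) (hT₁ : 0 < T₁) (hT : T₁ ≤ T₂) {B : ℕ}
    (hB : u * Real.exp (1 / 2) ≤ B + a) :
    HasSum (fun k : ℤ => u * (∫ t in T₁..T₂, osc (fun θ => (Real.exp θ : ℂ) * g θ) t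
        (2 * Real.pi * k * u)) * cexp (((2 * Real.pi * k * a : ℝ) : ℂ) * I))
      (windowInt g a u T₁ T₂ B) := by
  have hu' : Set.uIcc T₁ T₂ = Set.Icc T₁ T₂ := Set.uIcc_of_le hT
  have h1 : windowInt g a u T₁ T₂ B = ∫ t in T₁..T₂, ∑' k : ℤ,
      u * osc (fun θ => (Real.exp θ : ℂ) * g θ) t (2 * Real.pi * k * u) *
        cexp (((2 * Real.pi * k * a : ℝ) : ℂ) * I) := by
    rw [intervalIntegral.integral_congr (g := fun t => ∑ n ∈ range B,
      g (Real.log ((n + a) / u)) * cexp (((t * Real.log ((n + a) / u) : ℝ) : ℂ) * I))]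
    · rw [intervalIntegral.integral_finsetSum, windowInt]
      · exact sum_congr rfl fun n _ => by rw [intervalIntegral.integral_const_mul]
      · exact fun n _ => Continuous.intervalIntegrable (by fun_prop) _ _
    · intro t ht
      rw [hu'] at ht
      exact (sum_test_eq_tsum_osc hg ha ha1 hu (hT₁.trans_le ht.1) hB).symm
  rw [h1]
  have hc : ∀ k : ℤ, Continuous fun t => u * osc (fun θ => (Real.exp θ : ℂ) * g θ) t
      (2 * Real.pi * k * u) * cexp (((2 * Real.pi * k * a : ℝ) : ℂ) * I) := fun k =>
    (continuous_const.mul (continuous_osc hg.exp_mul _)).mul continuous_const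
  obtain ⟨D, hD, hb⟩ := exists_norm_osc_int_le hg.exp_mul hu (hT₁.trans_le hT)
  have := intervalIntegral.hasSum_intervalIntegral_of_summable_norm (a := T₁) (b := T₂)
    (f := fun k : ℤ => (⟨_, hc k⟩ : C(ℝ, ℂ)))
    (by
      refine Summable.of_nonneg_of_le (fun k => norm_nonneg _) (fun k => ?_) (hD.mul_left u)
      have hDk : 0 ≤ D k := (norm_nonneg _).trans (hb T₁ hT₁ hT k)
      rw [ContinuousMap.norm_le _ (by positivity)]
      rintro ⟨t, ht⟩
      change t ∈ Set.uIcc T₁ T₂ at ht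
      rw [hu'] at ht
      change ‖(u : ℂ) * osc (fun θ => (Real.exp θ : ℂ) * g θ) t (2 * Real.pi * k * u) *
        cexp (((2 * Real.pi * k * a : ℝ) : ℂ) * I)‖ ≤ _
      rw [norm_mul, norm_exp_ofReal_mul_I, mul_one, norm_mul, norm_real, Real.norm_of_nonneg hu.le]
      have := hb t (hT₁.trans_le ht.1) ht.2 k
      gcongr)
  refine this.congr_fun ?_
  intro k
  exact (intervalIntegral.integral_mul_const _ _).trans
    (congrArg (· * _) (intervalIntegral.integral_const_mul _ _)) |>.symm

theorem exists_norm_windowInt_sub_le {g : ℝ → ℂ} (hg : IsTest g) (j : ℕ) : ∃ C, 0 < C ∧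
    ∀ a : ℝ, 0 < a → a ≤ 1 → ∀ T T₁ T₂ : ℝ, 1 ≤ T → T / 2 ≤ T₁ → T₁ ≤ T₂ → T₂ ≤ 4 * T →
    ∀ m B : ℕ, 1 ≤ m + a → (m + a) * Real.exp (1 / 2) ≤ B + a →
      ‖windowInt g a (m + a) T₁ T₂ B - 2 * Real.pi * g 0 * ((m + a) *
        #{k ∈ Icc 1 ⌊2 * T / (m + a)⌋₊ | T₁ < 2 * Real.pi * ((k : ℕ) : ℝ) * (m + a) ∧
          2 * Real.pi * ((k : ℕ) : ℝ) * (m + a) ≤ T₂} : ℝ)‖ ≤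
      C * (m + a) * (T / T ^ j + T / (m + a) ^ 2 + ∑ k ∈ Icc 1 ⌊2 * T / (m + a)⌋₊,
        (edge (2 * Real.pi * k * (m + a)) (2 * Real.pi * k * (m + a) - T₁) +
          edge (2 * Real.pi * k * (m + a)) (2 * Real.pi * k * (m + a) - T₂))) := by
  set h : ℝ → ℂ := fun θ => (Real.exp θ : ℂ) * g θ with hh
  have hht : IsTest h := hg.exp_mul
  have h0 : h 0 = g 0 := by simp [hh]
  obtain ⟨C₁, hC₁, hb₁⟩ := exists_norm_osc_zero_le hht j
  obtain ⟨C₂, hC₂, hb₂⟩ := exists_norm_osc_le_div_sq hht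
  obtain ⟨C₃, hC₃, hb₃⟩ := exists_norm_integral_osc_sub_le hht
  set Z := ∑' k : ℤ, 1 / (k : ℝ) ^ 2 with hZ
  have hZs : HasSum (fun k : ℤ => 1 / (k : ℝ) ^ 2) Z :=
    (Real.summable_one_div_int_pow.mpr (by norm_num)).hasSum
  have hZ0 : 0 ≤ Z := tsum_nonneg fun k => by positivity
  refine ⟨4 * C₁ * 2 ^ j + 4 * C₂ * Z + C₃, by positivity, ?_⟩
  intro a ha ha1 T T₁ T₂ hT hT₁ hT₁₂ hT₂ m B hm hB
  set u : ℝ := m + a with hu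
  have hu0 : 0 < u := by linarith
  have hT₁0 : 0 < T₁ := by linarith
  set K := ⌊2 * T / u⌋₊ with hK
  set F : Finset ℤ := (Icc 1 K).map Nat.castEmbedding with hF
  set q : ℤ → ℝ := fun k => 2 * Real.pi * k * u with hq
  set A : ℤ → ℂ := fun k => u * (∫ t in T₁..T₂, osc h t (q k)) *
    cexp (((2 * Real.pi * k * a : ℝ) : ℂ) * I) with hA
  have hAs : HasSum A (windowInt g a u T₁ T₂ B) :=
    hasSum_windowInt hg ha ha1 hu0 hT₁0 hT₁₂ hB
  set M : ℤ → ℝ := fun k => if k ∈ F then (if T₁ < q k ∧ q k ≤ T₂ then u else 0) else 0 with hM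
  have hMs : HasSum M (u * #{k ∈ Icc 1 K | T₁ < 2 * Real.pi * ((k : ℕ) : ℝ) * u ∧
      2 * Real.pi * ((k : ℕ) : ℝ) * u ≤ T₂}) := by
    have := hasSum_finset_ite (f := fun k => if T₁ < q k ∧ q k ≤ T₂ then u else 0) K
    rw [← sum_filter, sum_const, nsmul_eq_mul, mul_comm] at this
    simpa [hq] using this
  have hMs' : HasSum (fun k => 2 * Real.pi * g 0 * (M k : ℂ)) _ :=
    ((hasSum_ofReal.mpr hMs).mul_left (2 * Real.pi * g 0 : ℂ))
  have hE := hAs.sub hMs'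
  rw [← hE.tsum_eq]
  set bd : ℤ → ℝ := fun k => (if k = 0 then u * (4 * T * (C₁ / (T / 2) ^ j)) else 0) +
    u * (4 * T * (C₂ / (2 * Real.pi * u) ^ 2)) * (1 / (k : ℝ) ^ 2) +
    (if k ∈ F then u * (C₃ * (edge (q k) (q k - T₁) + edge (q k) (q k - T₂))) else 0) with hbd
  have hbds : HasSum bd (u * (4 * T * (C₁ / (T / 2) ^ j)) +
      u * (4 * T * (C₂ / (2 * Real.pi * u) ^ 2)) * Z +
      ∑ k ∈ Icc 1 K, u * (C₃ * (edge (q k) (q k - T₁) + edge (q k) (q k - T₂)))) :=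
    ((hasSum_ite_eq 0 _).add (hZs.mul_left _)).add (hasSum_finset_ite
      (f := fun k => u * (C₃ * (edge (q k) (q k - T₁) + edge (q k) (q k - T₂)))) K)
  have hlen : |T₂ - T₁| ≤ 4 * T := by rw [abs_of_nonneg (by linarith)]; linarith
  have hnA : ∀ k, ‖A k‖ = u * ‖∫ t in T₁..T₂, osc h t (q k)‖ := fun k => by
    simp only [hA]
    rw [norm_mul, norm_exp_ofReal_mul_I, mul_one, norm_mul, norm_real, Real.norm_of_nonneg hu0.le]
  have hle : ∀ k, ‖A k - 2 * Real.pi * g 0 * (M k : ℂ)‖ ≤ bd k := by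
    intro k
    by_cases hkF : k ∈ F
    · have hk := hkF
      simp only [hF, Finset.mem_map, mem_Icc, Nat.castEmbedding_apply] at hk
      obtain ⟨k', ⟨hk1, hkK⟩, rfl⟩ := hk
      have hk1r : (1 : ℝ) ≤ k' := by exact_mod_cast hk1
      have hq1 : 1 ≤ q k' := by
        simp only [hq]
        push_cast
        have := Real.pi_gt_three
        calc (1 : ℝ) ≤ 2 * 3 * 1 * 1 := by norm_num
          _ ≤ _ := by gcongr
      have e1 := hb₃ (q k') T₁ T₂ hq1 hT₁₂
      have e2 : A k' - 2 * Real.pi * g 0 * (M k' : ℂ) = u * ((∫ t in T₁..T₂, osc h t (q k')) -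
          (if T₁ < q k' ∧ q k' ≤ T₂ then
            2 * Real.pi * (h 0 * cexp (((-(q k') : ℝ) : ℂ) * I)) else 0)) *
          cexp (((2 * Real.pi * (k' : ℤ) * a : ℝ) : ℂ) * I) := by
        simp only [hA, hM, if_pos hkF]
        split_ifs
        · have e3 : cexp (((-(q k') : ℝ) : ℂ) * I) *
              cexp (((2 * Real.pi * (k' : ℤ) * a : ℝ) : ℂ) * I) = 1 := by
            rw [← Complex.exp_add]
            have := Complex.exp_int_mul_two_pi_mul_I (-(k' * m : ℕ))
            rw [← this]
            congr 1
            simp only [hq, hu]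
            push_cast
            ring
          rw [h0]
          linear_combination (2 * Real.pi * g 0 * u) * e3
        · simp
      rw [e2, norm_mul, norm_exp_ofReal_mul_I, mul_one, norm_mul, norm_real,
        Real.norm_of_nonneg hu0.le]
      simp only [hbd, if_pos hkF]
      have : 0 ≤ (if (k' : ℤ) = 0 then u * (4 * T * (C₁ / (T / 2) ^ j)) else 0) := by
        split_ifs <;> positivity
      have : 0 ≤ u * (4 * T * (C₂ / (2 * Real.pi * u) ^ 2)) * (1 / ((k' : ℤ) : ℝ) ^ 2) := by
        positivity
      have : u * ‖(∫ t in T₁..T₂, osc h t (q k')) -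
          (if T₁ < q k' ∧ q k' ≤ T₂ then
            2 * Real.pi * (h 0 * cexp (((-(q k') : ℝ) : ℂ) * I)) else 0)‖ ≤
          u * (C₃ * (edge (q k') (q k' - T₁) + edge (q k') (q k' - T₂))) := by gcongr
      linarith
    · simp only [hM, hbd, if_neg hkF, ofReal_zero, mul_zero, sub_zero, add_zero]
      rw [hnA]
      by_cases hk0 : k = 0
      · subst hk0
        simp only [if_pos, Int.cast_zero, ne_eq, OfNat.ofNat_ne_zero, not_false_eq_true, zero_pow,
          div_zero, mul_zero, add_zero]
        gcongr
        refine (intervalIntegral.norm_integral_le_of_norm_le_const (C := C₁ / (T / 2) ^ j)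
          fun t ht => ?_).trans ?_
        · rw [Set.uIoc_of_le hT₁₂] at ht
          have ht0 : T / 2 ≤ t := by linarith [ht.1]
          have := hb₁ t (by linarith)
          simp only [hq, Int.cast_zero, mul_zero, zero_mul]
          refine this.trans ?_
          rw [abs_of_nonneg (by linarith)]
          gcongr
        · rw [mul_comm]
          gcongr
      · rw [if_neg hk0, zero_add, mul_assoc]
        gcongr
        refine (intervalIntegral.norm_integral_le_of_norm_le_const (C := C₂ / (q k) ^ 2)
          fun t ht => ?_).trans ?_
        · rw [Set.uIoc_of_le hT₁₂] at ht
          refine hb₂ t (q k) (by linarith [ht.1]) ?_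
          rcases lt_or_gt_of_ne hk0 with h1 | h1
          · right
            have : (k : ℝ) < 0 := by exact_mod_cast h1
            simp only [hq]
            have : 0 < 2 * Real.pi * u := by positivity
            nlinarith
          · left
            lift k to ℕ using h1.le
            have hkK : K < k := by
              by_contra hcon
              refine hkF ?_
              simp only [hF, Finset.mem_map, mem_Icc, Nat.castEmbedding_apply]
              exact ⟨k, ⟨by exact_mod_cast h1, not_lt.mp hcon⟩, rfl⟩
            have h2 : 2 * T / u < k := (Nat.floor_lt (by positivity)).mp hkK
            rw [div_lt_iff₀ hu0] at h2
            have := Real.pi_gt_three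
            simp only [hq, Int.cast_natCast]
            have h3 : 2 * 3 * (k * u) ≤ 2 * Real.pi * (k * u) := by gcongr
            linarith [ht.2]
        · have : C₂ / q k ^ 2 = C₂ / (2 * Real.pi * u) ^ 2 * (1 / (k : ℝ) ^ 2) := by
            have : (k : ℝ) ≠ 0 := Int.cast_ne_zero.mpr hk0
            simp only [hq]
            field_simp
          rw [this]
          calc _ ≤ C₂ / (2 * Real.pi * u) ^ 2 * (1 / (k : ℝ) ^ 2) * (4 * T) := by gcongr
            _ = _ := by ring
  refine (tsum_of_norm_bounded hbds hle).trans ?_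
  have e1 : u * (4 * T * (C₁ / (T / 2) ^ j)) = u * (4 * C₁ * 2 ^ j * (T / T ^ j)) := by
    rw [div_pow]; field_simp
  have e2 : u * (4 * T * (C₂ / (2 * Real.pi * u) ^ 2)) * Z ≤ u * (4 * C₂ * Z * (T / u ^ 2)) := by
    have : C₂ / (2 * Real.pi * u) ^ 2 ≤ C₂ / u ^ 2 := by
      have := Real.pi_gt_three
      gcongr
      nlinarith
    calc _ ≤ u * (4 * T * (C₂ / u ^ 2)) * Z := by gcongr
      _ = _ := by ring
  set S := ∑ k ∈ Icc 1 K, (edge (2 * Real.pi * k * u) (2 * Real.pi * k * u - T₁) +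
    edge (2 * Real.pi * k * u) (2 * Real.pi * k * u - T₂)) with hS
  have hS0 : 0 ≤ S := sum_nonneg fun k _ => add_nonneg (edge_nonneg _ _) (edge_nonneg _ _)
  have e3 : ∑ k ∈ Icc 1 K, u * (C₃ * (edge (q k) (q k - T₁) + edge (q k) (q k - T₂))) =
      u * (C₃ * S) := by
    rw [hS, mul_sum, mul_sum]
    simp [hq]
  rw [e1, e3]
  have p1 : 0 ≤ T / T ^ j := by positivity
  have p2 : 0 ≤ T / u ^ 2 := by positivity
  calc _ ≤ u * (4 * C₁ * 2 ^ j * (T / T ^ j)) + u * (4 * C₂ * Z * (T / u ^ 2)) + u * (C₃ * S) := by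
        linarith
    _ = u * (4 * C₁ * 2 ^ j * (T / T ^ j) + 4 * C₂ * Z * (T / u ^ 2) + C₃ * S) := by ring
    _ ≤ u * ((4 * C₁ * 2 ^ j + 4 * C₂ * Z + C₃) * (T / T ^ j) +
        (4 * C₁ * 2 ^ j + 4 * C₂ * Z + C₃) * (T / u ^ 2) +
        (4 * C₁ * 2 ^ j + 4 * C₂ * Z + C₃) * S) := by
        have : 0 ≤ 4 * C₁ * 2 ^ j := by positivity
        have : 0 ≤ 4 * C₂ * Z := by positivity
        gcongr <;> linarith
    _ = _ := by ring

lemma sum_range_succ_rpow_neg_le {p : ℝ} (hp0 : 0 ≤ p) (hp1 : p < 1) (n : ℕ) :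
    ∑ m ∈ range n, ((m : ℝ) + 1) ^ (-p) ≤ (n : ℝ) ^ (1 - p) / (1 - p) := by
  have hp : 0 < 1 - p := by linarith
  induction n with
  | zero => simp [Real.zero_rpow hp.ne']
  | succ n ih =>
    rw [sum_range_succ]
    refine (add_le_add_left ih _).trans ?_
    have hn : (0 : ℝ) < n + 1 := by positivity
    have h1 := rpow_one_add_le_one_add_mul_self (s := -(1 / ((n : ℝ) + 1))) (p := 1 - p)
      (by rw [neg_le_neg_iff, div_le_one hn]; linarith [n.cast_nonneg (α := ℝ)]) hp.le (by linarith)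
    have e1 : 1 + -(1 / ((n : ℝ) + 1)) = n / (n + 1) := by field_simp; ring
    rw [e1, Real.div_rpow n.cast_nonneg hn.le, div_le_iff₀ (by positivity)] at h1
    have e2 : ((n : ℝ) + 1) ^ (1 - p) = (n + 1) * ((n : ℝ) + 1) ^ (-p) := by
      rw [sub_eq_add_neg, Real.rpow_add hn, Real.rpow_one]
    rw [div_add' _ _ _ hp.ne', div_le_div_iff_of_pos_right hp]
    push_cast
    have e3 : (1 + (1 - p) * -(1 / ((n : ℝ) + 1))) * ((n : ℝ) + 1) ^ (1 - p) =
        ((n : ℝ) + 1) ^ (1 - p) - (1 - p) * ((n : ℝ) + 1) ^ (-p) := by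
      rw [e2]
      field_simp
      ring
    linarith

lemma sum_Ico_add_rpow_neg_le {a p : ℝ} (ha : 0 ≤ a) (hp0 : 0 ≤ p) (hp1 : p < 1) {M : ℕ}
    (hM : 1 ≤ M) (n : ℕ) :
    ∑ m ∈ Ico M n, ((m : ℝ) + a) ^ (-p) ≤ (n : ℝ) ^ (1 - p) / (1 - p) := by
  refine le_trans ?_ (sum_range_succ_rpow_neg_le hp0 hp1 n)
  calc ∑ m ∈ Ico M n, ((m : ℝ) + a) ^ (-p) ≤ ∑ m ∈ Ico 1 n, ((m : ℝ) + a) ^ (-p) :=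
        sum_le_sum_of_subset_of_nonneg (Ico_subset_Ico_left hM) fun m _ _ => by positivity
    _ ≤ ∑ m ∈ Ico 1 n, (m : ℝ) ^ (-p) := sum_le_sum fun m hm => by
        have : (1 : ℝ) ≤ m := by exact_mod_cast (mem_Ico.mp hm).1
        exact Real.rpow_le_rpow_of_nonpos (by linarith) (by linarith) (by linarith)
    _ = ∑ m ∈ range (n - 1), ((m : ℝ) + 1) ^ (-p) := by
        rw [sum_Ico_eq_sum_range]
        exact sum_congr rfl fun m _ => by push_cast; rw [add_comm]
    _ ≤ _ := sum_le_sum_of_subset_of_nonneg (range_mono (Nat.sub_le _ _))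
        fun m _ _ => by positivity

lemma sum_range_div_add_le {Q c : ℝ} (hQ : 0 < Q) (hc : 0 < c) (n : ℕ) :
    ∑ i ∈ range (n + 1), Q / (Q + c * i) ≤ 1 + Q / c * (1 + Real.log n) := by
  rw [sum_range_succ']
  have h1 : ∑ i ∈ range n, Q / (Q + c * ((i + 1 : ℕ) : ℝ)) ≤ Q / c * harmonic n := by
    rw [harmonic]
    push_cast
    rw [mul_sum]
    refine sum_le_sum fun i _ => ?_
    rw [← div_eq_mul_inv, div_div]
    gcongr
    linarith
  have h2 : Q / c * (harmonic n : ℝ) ≤ Q / c * (1 + Real.log n) := by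
    gcongr
    exact harmonic_le_one_add_log n
  simp only [CharP.cast_eq_zero, mul_zero, add_zero, div_self hQ.ne']
  linarith

lemma sum_range_div_add_abs_le {Q c w : ℝ} (hQ : 0 < Q) (hc : 0 < c) (hw : 0 ≤ w) {J : ℕ}
    (hJ : w < J) :
    ∑ m ∈ range J, Q / (Q + c * |m - w|) ≤ 2 * (1 + Q / c * (1 + Real.log J)) := by
  set n := ⌊w⌋₊ with hn
  have hnJ : n + 1 ≤ J := (Nat.floor_lt hw).mpr hJ
  have h1 : (n : ℝ) ≤ w := Nat.floor_le hw
  have h2 : w < n + 1 := Nat.lt_floor_add_one w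
  have hT : ∀ k ≤ J + 1, ∑ i ∈ range k, Q / (Q + c * i) ≤ 1 + Q / c * (1 + Real.log J) := by
    intro k hk
    exact (sum_le_sum_of_subset_of_nonneg (range_mono hk) fun m _ _ => by positivity).trans
      (sum_range_div_add_le hQ hc J)
  rw [← sum_range_add_sum_Ico _ hnJ, two_mul]
  refine add_le_add ((le_trans ?_ (hT (n + 1) (by omega)))) (le_trans ?_ (hT (J - (n + 1)) (by omega)))
  · rw [← sum_range_reflect]
    refine sum_le_sum fun m hm => ?_
    have hm' : m ≤ n := Nat.lt_succ_iff.mp (mem_range.mp hm)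
    rw [Nat.add_sub_cancel, Nat.cast_sub hm', abs_of_nonpos (by linarith [m.cast_nonneg (α := ℝ)])]
    gcongr
    linarith
  · rw [sum_Ico_eq_sum_range]
    refine sum_le_sum fun m _ => ?_
    push_cast
    rw [abs_of_nonneg (by linarith [m.cast_nonneg (α := ℝ)])]
    gcongr
    linarith

lemma edge_le {q d Q : ℝ} (hQ : √q ≤ Q) (hQ0 : 0 < Q) : edge q d ≤ Q / (Q + |d|) := by
  unfold edge
  rcases (Real.sqrt_nonneg q).eq_or_lt with h | h
  · rw [← h, zero_div]; positivity
  · rw [div_le_div_iff₀ (by positivity) (by positivity)]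
    nlinarith [abs_nonneg d]

lemma rpow_neg_mul_edge_le {p T U k α : ℝ} (hp0 : 0 < p) (hp1 : p < 1) (hT : 0 < T)
    (hU : T / 2 ≤ U) (hk : 0 < k) (hα : 0 < α) (hkα : k * α ≤ 2 * T) :
    α ^ (-p) * edge (2 * Real.pi * k * α) (2 * Real.pi * k * α - U) ≤
      32 * (T / k) ^ (-p) * (4 * √T / (4 * √T + 2 * Real.pi * k * |α - U / (2 * Real.pi * k)|)) +
        16 / √T * α ^ (-p) := by
  have hs : 0 < √T := Real.sqrt_pos.mpr hT
  have hss : √T * √T = T := Real.mul_self_sqrt hT.le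
  have hpi := Real.pi_gt_three
  have hpi4 := Real.pi_lt_four
  set v := U / (2 * Real.pi * k) with hv
  have hU0 : 0 < U := by linarith
  have hv0 : 0 < v := by positivity
  have hUv : U = 2 * Real.pi * k * v := by rw [hv]; field_simp
  have hd : |2 * Real.pi * k * α - U| = 2 * Real.pi * k * |α - v| := by
    rw [hUv, ← mul_sub, abs_mul, abs_of_pos (by positivity : 0 < 2 * Real.pi * k)]
  have hq : √(2 * Real.pi * k * α) ≤ 4 * √T := by
    rw [Real.sqrt_le_left (by positivity)]
    have : 2 * Real.pi * (k * α) ≤ 2 * 4 * (2 * T) := by gcongr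
    nlinarith
  have he := edge_le (d := 2 * Real.pi * k * α - U) hq (by positivity)
  rw [hd] at he
  have hαp : 0 < α ^ (-p) := by positivity
  set R := 4 * √T / (4 * √T + 2 * Real.pi * k * |α - v|) with hR
  have hR0 : 0 ≤ R := by positivity
  rcases le_or_gt (v / 2) α with h | h
  · have h1 : α ^ (-p) ≤ 32 * (T / k) ^ (-p) := by
      have h2 : T / k / 32 ≤ α := by
        refine le_trans ?_ h
        rw [hv, div_div, div_div, div_le_div_iff₀ (by positivity) (by positivity)]
        have : 2 * Real.pi * k * 2 ≤ 2 * 4 * k * 2 := by gcongr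
        calc T * (2 * Real.pi * k * 2) ≤ T * (2 * 4 * k * 2) := by gcongr
          _ = T / 2 * (k * 32) := by ring
          _ ≤ _ := by gcongr
      calc α ^ (-p) ≤ (T / k / 32) ^ (-p) :=
            Real.rpow_le_rpow_of_nonpos (by positivity) h2 (by linarith)
        _ = 32 ^ p * (T / k) ^ (-p) := by
            rw [Real.div_rpow (by positivity) (by norm_num), Real.rpow_neg (by norm_num : (0:ℝ) ≤ 32),
              div_inv_eq_mul, mul_comm]
        _ ≤ 32 ^ (1 : ℝ) * (T / k) ^ (-p) := by
            gcongr
            norm_num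
        _ = _ := by rw [Real.rpow_one]
    calc _ ≤ 32 * (T / k) ^ (-p) * R := mul_le_mul h1 he (edge_nonneg _ _) (by positivity)
      _ ≤ _ := le_add_of_nonneg_right (by positivity)
  · have h1 : R ≤ 16 / √T := by
      have h3 : T / 4 ≤ 2 * Real.pi * k * |α - v| := by
        have : v / 2 ≤ |α - v| := by rw [abs_of_neg (by linarith)]; linarith
        calc T / 4 ≤ U / 2 := by linarith
          _ = 2 * Real.pi * k * (v / 2) := by rw [hUv]; ring
          _ ≤ _ := by gcongr
      rw [hR, div_le_div_iff₀ (by positivity) hs]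
      nlinarith
    calc _ ≤ α ^ (-p) * (16 / √T) := by gcongr; exact he.trans h1
      _ = 16 / √T * α ^ (-p) := mul_comm _ _
      _ ≤ _ := le_add_of_nonneg_left (by positivity)

set_option maxHeartbeats 800000 in
lemma exists_sum_edge_le {p : ℝ} (hp0 : 0 < p) (hp1 : p < 1) : ∃ C, 0 < C ∧
    ∀ a T U : ℝ, 0 < a → a ≤ 1 → 2000 ≤ T → T / 2 ≤ U → U ≤ 4 * T → ∀ M B : ℕ, 1 ≤ M →
      √T ≤ M + a →
      ∑ m ∈ Ico M B, ((m : ℝ) + a) ^ (-p) * ∑ k ∈ Icc 1 ⌊2 * T / (m + a)⌋₊,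
        edge (2 * Real.pi * k * (m + a)) (2 * Real.pi * k * (m + a) - U) ≤
      C * (T ^ ((1 - p) / 2) * Real.log T) := by
  refine ⟨(320 + 48 / (1 - p)) * (3 / p), by have : 0 < 1 - p := by linarith
                                             positivity, ?_⟩
  intro a T U ha ha1 hT hU hU4 M B hM hMa
  have h1p : 0 < 1 - p := by linarith
  have hT0 : 0 < T := by linarith
  have hs : 0 < √T := Real.sqrt_pos.mpr hT0
  have hss : √T * √T = T := Real.mul_self_sqrt hT0.le
  have hs30 : 40 ≤ √T := Real.le_sqrt_of_sq_le (by linarith)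
  have hpi := Real.pi_gt_three
  have hpi4 := Real.pi_lt_four
  have hlog : 1 ≤ Real.log T := by
    rw [Real.le_log_iff_exp_le hT0]
    linarith [Real.exp_one_lt_d9]
  set K := ⌊2 * √T⌋₊ with hK
  have hKs : (K : ℝ) ≤ 2 * √T := Nat.floor_le (by positivity)
  set E : ℕ → ℕ → ℝ := fun k m => ((m : ℝ) + a) ^ (-p) *
    edge (2 * Real.pi * k * (m + a)) (2 * Real.pi * k * (m + a) - U) with hE
  have hE0 : ∀ k m, 0 ≤ E k m := fun k m => mul_nonneg (by positivity) (edge_nonneg _ _)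
  have hk : ∀ k ∈ Icc 1 K, ∑ m ∈ Ico M B with (k : ℝ) * ((m : ℕ) + a) ≤ 2 * T, E k m ≤
      (320 + 48 / (1 - p)) * (T ^ (1 / 2 - p) * Real.log T) * (k : ℝ) ^ (-(1 - p)) := by
    intro k hk
    have hk1 : (1 : ℝ) ≤ k := by exact_mod_cast (mem_Icc.mp hk).1
    have hkK : (k : ℝ) ≤ 2 * √T := le_trans (by exact_mod_cast (mem_Icc.mp hk).2) hKs
    have hk0 : (0 : ℝ) < k := by linarith
    set J := ⌊2 * T / k⌋₊ + 1 with hJ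
    have hJl : 2 * T / k < J := by rw [hJ]; push_cast; exact Nat.lt_floor_add_one _
    have hTk : √T / 2 ≤ T / k := by
      rw [div_le_div_iff₀ (by norm_num) hk0]
      nlinarith
    have hJu : (J : ℝ) ≤ 3 * (T / k) := by
      have : (⌊2 * T / k⌋₊ : ℝ) ≤ 2 * T / k := Nat.floor_le (by positivity)
      have e : 2 * T / k = 2 * (T / k) := mul_div_assoc _ _ _
      rw [hJ]; push_cast
      linarith
    set v := U / (2 * Real.pi * k) with hv
    have hva : 0 ≤ v - a := by
      have : 1 ≤ v := by
        rw [hv, one_le_div (by positivity)]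
        calc 2 * Real.pi * k ≤ 2 * 4 * (2 * √T) := by gcongr
          _ ≤ T / 2 := by nlinarith
          _ ≤ U := hU
      linarith
    have hvJ : v - a < J := by
      have : v ≤ 2 * T / k := by
        rw [hv, div_le_div_iff₀ (by positivity) hk0]
        have : 4 * T * k ≤ 2 * T * (2 * 3 * k) := by nlinarith
        calc U * k ≤ 4 * T * k := by gcongr
          _ ≤ 2 * T * (2 * 3 * k) := this
          _ ≤ _ := by gcongr
      linarith
    have hlJ : 1 + Real.log J ≤ 4 * Real.log T := by
      have h1 : Real.log J ≤ Real.log (T * T) := by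
        refine Real.log_le_log (by rw [hJ]; positivity) (hJu.trans ?_)
        have : T / k ≤ T := div_le_self hT0.le hk1
        nlinarith
      rw [Real.log_mul hT0.ne' hT0.ne'] at h1
      linarith
    have hsub : ∀ m ∈ (Ico M B).filter (fun m => (k : ℝ) * ((m : ℕ) + a) ≤ 2 * T), m ∈ Ico M J := by
      intro m hm
      rw [mem_filter, mem_Ico] at hm
      rw [mem_Ico]
      refine ⟨hm.1.1, ?_⟩
      have : (m : ℝ) < J := by
        refine lt_of_le_of_lt ?_ hJl
        rw [le_div_iff₀ hk0]
        nlinarith [hm.2]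
      exact_mod_cast this
    set W : ℕ → ℝ := fun m => 4 * √T / (4 * √T + 2 * Real.pi * k * |m - (v - a)|) with hW
    have hW0 : ∀ m, 0 ≤ W m := fun m => by positivity
    have h1 : ∑ m ∈ Ico M B with (k : ℝ) * ((m : ℕ) + a) ≤ 2 * T, E k m ≤
        ∑ m ∈ Ico M J, (32 * (T / k) ^ (-p) * W m + 16 / √T * ((m : ℝ) + a) ^ (-p)) := by
      refine (sum_le_sum fun m hm => ?_).trans (sum_le_sum_of_subset_of_nonneg hsub
        fun m _ _ => by have := hW0 m; positivity)
      have hm2 := (mem_filter.mp hm).2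
      have := rpow_neg_mul_edge_le hp0 hp1 hT0 hU hk0 (by positivity : (0:ℝ) < m + a) hm2
      simp only [hE, hW]
      rw [show (m : ℝ) - (v - a) = m + a - v by ring]
      exact this
    rw [sum_add_distrib, ← mul_sum, ← mul_sum] at h1
    have h2 : ∑ m ∈ Ico M J, W m ≤ 10 * (√T / k * Real.log T) := by
      refine (sum_le_sum_of_subset_of_nonneg (t := range J) (fun m hm => mem_range.mpr
        (mem_Ico.mp hm).2) fun m _ _ => hW0 m).trans ?_
      refine (sum_range_div_add_abs_le (by positivity) (by positivity) hva hvJ).trans ?_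
      have e1 : 1 ≤ 2 * (√T / k * Real.log T) := by
        have : 1 ≤ 2 * (√T / k) := by rw [← mul_div_assoc, one_le_div hk0]; exact hkK
        nlinarith
      have e2 : 4 * √T / (2 * Real.pi * k) ≤ 2 / 3 * (√T / k) := by
        rw [div_le_iff₀ (by positivity)]
        have : 2 / 3 * (√T / k) * (2 * Real.pi * k) = 4 / 3 * Real.pi * √T := by field_simp; ring
        rw [this]
        nlinarith
      have e3 : 4 * √T / (2 * Real.pi * k) * (1 + Real.log J) ≤
          2 / 3 * (√T / k) * (4 * Real.log T) := by
        refine mul_le_mul e2 hlJ ?_ (by positivity)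
        have : 1 ≤ (J : ℝ) := by rw [hJ]; push_cast; linarith [(⌊2 * T / k⌋₊).cast_nonneg (α := ℝ)]
        linarith [Real.log_nonneg this]
      linarith
    have h3 : ∑ m ∈ Ico M J, ((m : ℝ) + a) ^ (-p) ≤ 3 * (T / k) ^ (1 - p) / (1 - p) := by
      refine (sum_Ico_add_rpow_neg_le ha.le hp0.le hp1 hM J).trans ?_
      gcongr
      calc (J : ℝ) ^ (1 - p) ≤ (3 * (T / k)) ^ (1 - p) := by gcongr
        _ = 3 ^ (1 - p) * (T / k) ^ (1 - p) := Real.mul_rpow (by norm_num) (by positivity)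
        _ ≤ 3 ^ (1 : ℝ) * (T / k) ^ (1 - p) := by gcongr <;> linarith
        _ = _ := by rw [Real.rpow_one]
    have e1 : (T / k) ^ (-p) * (√T / k) = T ^ (1 / 2 - p) * (k : ℝ) ^ (-(1 - p)) := by
      rw [Real.div_rpow hT0.le hk0.le, Real.sqrt_eq_rpow, Real.rpow_neg hk0.le, div_inv_eq_mul,
        show 1 / 2 - p = -p + 1 / 2 by ring, Real.rpow_add hT0, show -(1 - p) = p - 1 by ring,
        Real.rpow_sub hk0, Real.rpow_one]
      ring
    have e2 : 1 / √T * (T / k) ^ (1 - p) = T ^ (1 / 2 - p) * (k : ℝ) ^ (-(1 - p)) := by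
      rw [Real.div_rpow hT0.le hk0.le, Real.sqrt_eq_rpow, one_div, ← Real.rpow_neg hT0.le,
        div_eq_mul_inv (T ^ (1 - p)), ← Real.rpow_neg hk0.le, ← mul_assoc, ← Real.rpow_add hT0]
      congr 2
      ring
    set X := T ^ (1 / 2 - p) * (k : ℝ) ^ (-(1 - p)) with hX
    have hX0 : 0 ≤ X := by positivity
    calc _ ≤ 32 * (T / k) ^ (-p) * (10 * (√T / k * Real.log T)) +
          16 / √T * (3 * (T / k) ^ (1 - p) / (1 - p)) := h1.trans (by gcongr)
      _ = 320 * ((T / k) ^ (-p) * (√T / k)) * Real.log T +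
          48 / (1 - p) * (1 / √T * (T / k) ^ (1 - p)) * 1 := by ring
      _ = 320 * X * Real.log T + 48 / (1 - p) * X * 1 := by rw [e1, e2]
      _ ≤ 320 * X * Real.log T + 48 / (1 - p) * X * Real.log T := by gcongr
      _ = _ := by rw [hX]; ring
  calc _ = ∑ m ∈ Ico M B, ∑ k ∈ Icc 1 ⌊2 * T / (m + a)⌋₊, E k m := by
        simp only [hE, mul_sum]
    _ ≤ ∑ m ∈ Ico M B, ∑ k ∈ Icc 1 K with (k : ℕ) * ((m : ℝ) + a) ≤ 2 * T, E k m := by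
        refine sum_le_sum fun m hm => ?_
        have hm1 : (0 : ℝ) < m + a := by positivity
        have hmM : (M : ℝ) ≤ m := by exact_mod_cast (mem_Ico.mp hm).1
        refine sum_le_sum_of_subset_of_nonneg (fun k hk => ?_) fun k _ _ => hE0 k m
        rw [mem_Icc, Nat.le_floor_iff (by positivity), le_div_iff₀ hm1] at hk
        rw [mem_filter, mem_Icc]
        refine ⟨⟨hk.1, Nat.le_floor ?_⟩, hk.2⟩
        have h1 : (k : ℝ) * √T ≤ 2 * √T * √T := by
          calc (k : ℝ) * √T ≤ k * (m + a) := by gcongr; linarith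
            _ ≤ 2 * T := hk.2
            _ = _ := by rw [mul_assoc, hss]
        exact le_of_mul_le_mul_right h1 hs
    _ = ∑ k ∈ Icc 1 K, ∑ m ∈ Ico M B with (k : ℝ) * ((m : ℕ) + a) ≤ 2 * T, E k m := by
        simp only [sum_filter]
        exact sum_comm
    _ ≤ ∑ k ∈ Icc 1 K, (320 + 48 / (1 - p)) * (T ^ (1 / 2 - p) * Real.log T) *
          (k : ℝ) ^ (-(1 - p)) := sum_le_sum hk
    _ ≤ (320 + 48 / (1 - p)) * (T ^ (1 / 2 - p) * Real.log T) * (3 / p * T ^ (p / 2)) := by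
        rw [← mul_sum]
        gcongr
        have h2 := sum_Ico_add_rpow_neg_le (a := 0) (p := 1 - p) le_rfl h1p.le (by linarith)
          (le_refl 1) (K + 1)
        rw [Ico_add_one_right_eq_Icc] at h2
        simp only [add_zero, sub_sub_cancel] at h2
        refine h2.trans ?_
        have h3 : ((K + 1 : ℕ) : ℝ) ≤ 3 * √T := by push_cast; linarith
        have h4 : ((K + 1 : ℕ) : ℝ) ^ p ≤ 3 * T ^ (p / 2) := by
          calc ((K + 1 : ℕ) : ℝ) ^ p ≤ (3 * √T) ^ p := by gcongr
            _ = 3 ^ p * T ^ (p / 2) := by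
              rw [Real.mul_rpow (by norm_num) hs.le, Real.sqrt_eq_rpow, ← Real.rpow_mul hT0.le]
              congr 2
              ring
            _ ≤ 3 ^ (1 : ℝ) * T ^ (p / 2) := by gcongr; norm_num
            _ = _ := by rw [Real.rpow_one]
        rw [div_mul_eq_mul_div]
        gcongr
    _ = _ := by
        have : T ^ ((1 - p) / 2) = T ^ (1 / 2 - p) * T ^ (p / 2) := by
          rw [← Real.rpow_add hT0]
          congr 1
          ring
        rw [this]
        ring

/-- The secondary main term. -/
noncomputable def secondTerm (σ T : ℝ) : ℝ :=
  2 * Real.pi * ((T / (2 * Real.pi)) ^ (2 - 2 * σ) * (hzeta 1 ((2 - 2 * σ : ℝ) : ℂ)).re / (2 - 2 * σ))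

lemma card_window_eq {α T T₁ T₂ : ℝ} (hα : 0 < α) (hT₁ : 0 ≤ T₁) (hT₁₂ : T₁ ≤ T₂)
    (hT₂ : T₂ ≤ 4 * T) :
    (#{k ∈ Icc 1 ⌊2 * T / α⌋₊ | T₁ < 2 * Real.pi * ((k : ℕ) : ℝ) * α ∧
      2 * Real.pi * ((k : ℕ) : ℝ) * α ≤ T₂} : ℝ) =
    (⌊T₂ / (2 * Real.pi) / α⌋₊ : ℝ) - ⌊T₁ / (2 * Real.pi) / α⌋₊ := by
  have hpi := Real.pi_gt_three
  have h2pi : 0 < 2 * Real.pi := by linarith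
  have hT : 0 ≤ T := by linarith
  have hK : ∀ U, 0 ≤ U → U ≤ 4 * T → ⌊U / (2 * Real.pi) / α⌋₊ ≤ ⌊2 * T / α⌋₊ := by
    intro U hU hU4
    refine Nat.floor_le_floor ?_
    gcongr
    rw [div_le_iff₀ h2pi]
    nlinarith
  have h1 := floor_eq_card_filter (Y := T₁ / (2 * Real.pi)) (by positivity) hα
    (hK T₁ hT₁ (by linarith))
  have h2 := floor_eq_card_filter (Y := T₂ / (2 * Real.pi)) (div_nonneg (by linarith) h2pi.le) hα
    (hK T₂ (by linarith) hT₂)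
  have e : ∀ (U : ℝ) (k : ℕ), (k : ℝ) * α ≤ U / (2 * Real.pi) ↔ 2 * Real.pi * (k : ℝ) * α ≤ U := by
    intro U k
    rw [le_div_iff₀ h2pi]
    constructor <;> intro h <;> linarith
  rw [← h1, ← h2, eq_sub_iff_add_eq, ← Nat.cast_add, ← card_union_of_disjoint]
  · congr 2
    ext k
    simp only [mem_union, mem_filter, e]
    constructor
    · rintro (h | h)
      · exact ⟨h.1, h.2.2⟩
      · exact ⟨h.1, h.2.trans hT₁₂⟩
    · intro h
      rcases lt_or_ge T₁ (2 * Real.pi * k * α) with h3 | h3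
      · exact Or.inl ⟨h.1, h3, h.2⟩
      · exact Or.inr ⟨h.1, h3⟩
  · rw [disjoint_left]
    intro k hk hk'
    simp only [mem_filter, e] at hk hk'
    linarith [hk.2.1, hk'.2]

/-- The hyperbola-method main term of the windowed sum. -/
lemma exists_abs_sum_floor_sub_le {a σ : ℝ} (ha : 0 < a) (ha1 : a ≤ 1) (hσ : 1 / 2 < σ)
    (hσ1 : σ < 1) : ∃ C, 0 < C ∧ ∀ T U : ℝ, 2000 ≤ T → T / 2 ≤ U → U ≤ 4 * T →
    ∀ M B : ℕ, √T ≤ M + a → M + a ≤ √T + 1 → 2 * T ≤ B →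
      |U * ∑ m ∈ range M, ((m : ℝ) + a) ^ (-(2 * σ)) + 2 * Real.pi * ∑ m ∈ Ico M B,
          ((m : ℝ) + a) ^ (1 - 2 * σ) * ⌊U / (2 * Real.pi) / (m + a)⌋₊ -
        (U * (hzeta a ((2 * σ : ℝ) : ℂ)).re + secondTerm σ U)| ≤ C * T ^ (1 - σ) := by
  obtain ⟨C, hC⟩ := abs_main_term_sub_le ha ha1 hσ hσ1
  refine ⟨8 * (|C| * 3) + 1, by positivity, ?_⟩
  intro T U hT hU hU4 M B hM hM1 hB
  have hpi := Real.pi_gt_three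
  have hpi4 := Real.pi_lt_four
  have hT0 : 0 < T := by linarith
  have hs : 0 < √T := Real.sqrt_pos.mpr hT0
  have hss : √T * √T = T := Real.mul_self_sqrt hT0.le
  have hs40 : 40 ≤ √T := Real.le_sqrt_of_sq_le (by linarith)
  set Y := U / (2 * Real.pi) with hY
  have hUY : U = 2 * Real.pi * Y := by rw [hY]; field_simp
  have hYT : Y ≤ T := by
    rw [hY, div_le_iff₀ (by positivity)]
    nlinarith
  have hY1 : T / 16 ≤ Y := by
    rw [hY, div_le_div_iff₀ (by norm_num) (by positivity)]
    nlinarith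
  have key := hC M B Y (by nlinarith) (by linarith)
  have e1 : ((M : ℝ) + a) ^ (2 - 2 * σ) ≤ 2 * T ^ (1 - σ) := by
    calc ((M : ℝ) + a) ^ (2 - 2 * σ) ≤ (2 * √T) ^ (2 - 2 * σ) := by
          gcongr <;> linarith
      _ = 2 ^ (2 - 2 * σ) * T ^ (1 - σ) := by
          rw [Real.mul_rpow (by norm_num) hs.le, Real.sqrt_eq_rpow, ← Real.rpow_mul hT0.le]
          congr 2
          ring
      _ ≤ 2 ^ (1 : ℝ) * T ^ (1 - σ) := by
          gcongr
          · norm_num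
          · linarith
      _ = _ := by rw [Real.rpow_one]
  have e2 : Y * ((M : ℝ) + a) ^ (-(2 * σ)) ≤ T ^ (1 - σ) := by
    calc Y * ((M : ℝ) + a) ^ (-(2 * σ)) ≤ T * √T ^ (-(2 * σ)) := by
          refine mul_le_mul hYT ?_ (by positivity) hT0.le
          exact Real.rpow_le_rpow_of_nonpos hs hM (by linarith)
      _ = T ^ (1 : ℝ) * T ^ (-σ) := by
          rw [Real.sqrt_eq_rpow, ← Real.rpow_mul hT0.le, Real.rpow_one]
          congr 2
          ring
      _ = _ := by rw [← Real.rpow_add hT0]; congr 1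
  have e3 : |C| * (((M : ℝ) + a) ^ (2 - 2 * σ) + Y * ((M : ℝ) + a) ^ (-(2 * σ))) ≤
      |C| * 3 * T ^ (1 - σ) := by
    rw [mul_assoc]
    gcongr
    linarith
  have hYnn : 0 ≤ Y := by linarith
  have e4 : C * (((M : ℝ) + a) ^ (2 - 2 * σ) + Y * ((M : ℝ) + a) ^ (-(2 * σ))) ≤
      |C| * (((M : ℝ) + a) ^ (2 - 2 * σ) + Y * ((M : ℝ) + a) ^ (-(2 * σ))) := by
    gcongr
    exact le_abs_self C
  have e5 : U * ∑ m ∈ range M, ((m : ℝ) + a) ^ (-(2 * σ)) + 2 * Real.pi * ∑ m ∈ Ico M B,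
          ((m : ℝ) + a) ^ (1 - 2 * σ) * ⌊Y / (m + a)⌋₊ -
        (U * (hzeta a ((2 * σ : ℝ) : ℂ)).re + secondTerm σ U) = 2 * Real.pi *
      (Y * ∑ m ∈ range M, ((m : ℝ) + a) ^ (-(2 * σ)) + ∑ m ∈ Ico M B,
          ((m : ℝ) + a) ^ (1 - 2 * σ) * ⌊Y / (m + a)⌋₊ -
        (Y * (hzeta a ((2 * σ : ℝ) : ℂ)).re +
          Y ^ (2 - 2 * σ) * (hzeta 1 ((2 - 2 * σ : ℝ) : ℂ)).re / (2 - 2 * σ))) := by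
    rw [secondTerm, ← hY]
    conv_lhs => rw [hUY]
    ring
  rw [e5, abs_mul, abs_of_pos (by positivity : 0 < 2 * Real.pi)]
  calc _ ≤ 2 * 4 * (|C| * 3 * T ^ (1 - σ)) := by
        gcongr
        exact key.trans (e4.trans e3)
    _ ≤ (8 * (|C| * 3) + 1) * T ^ (1 - σ) := by
        have : 0 < T ^ (1 - σ) := by positivity
        linarith

lemma sum_Ico_add_rpow_le {a : ℝ} (ha : 0 < a) {q : ℝ} (hq : 0 < q) {M : ℕ} (hM : 1 ≤ M + a) (B : ℕ) :
    ∑ m ∈ Ico M B, ((m : ℝ) + a) ^ (-q - 1) ≤ (1 + 1 / q) * ((M : ℝ) + a) ^ (-q) := by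
  have hx : 0 < (M : ℝ) + a := by linarith
  rw [sum_Ico_eq_sum_range]
  have h1 : ∑ k ∈ range (B - M), (((M + k : ℕ) : ℝ) + a) ^ (-q - 1) ≤
      ∑' k : ℕ, ((k : ℝ) + (M + a)) ^ (-q - 1) := by
    refine le_of_eq_of_le (sum_congr rfl fun k _ => ?_)
      ((summable_add_rpow hx (by linarith)).sum_le_tsum (range (B - M))
        (fun k _ => by positivity))
    push_cast
    ring_nf
  refine (h1.trans (tsum_add_rpow_le hx hq)).trans ?_
  have h2 : ((M : ℝ) + a) ^ (-q - 1) ≤ ((M : ℝ) + a) ^ (-q) :=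
    Real.rpow_le_rpow_of_exponent_le hM (by linarith)
  calc _ ≤ ((M : ℝ) + a) ^ (-q) + ((M : ℝ) + a) ^ (-q) / q := by linarith
    _ = _ := by ring

lemma one_le_rpow_mul_log {T p : ℝ} (hT : 2000 ≤ T) (hp : 0 ≤ p) : 1 ≤ T ^ p * Real.log T := by
  have hlog : 1 ≤ Real.log T := by
    rw [Real.le_log_iff_exp_le (by linarith)]
    linarith [Real.exp_one_lt_d9]
  exact one_le_mul_of_one_le_of_one_le (Real.one_le_rpow (by linarith) hp) hlog

lemma rpow_le_rpow_mul_log {T p : ℝ} (hT : 2000 ≤ T) : T ^ p ≤ T ^ p * Real.log T := by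
  have hlog : 1 ≤ Real.log T := by
    rw [Real.le_log_iff_exp_le (by linarith)]
    linarith [Real.exp_one_lt_d9]
  have : 0 < T ^ p := Real.rpow_pos_of_pos (by linarith) _
  nlinarith

lemma exists_sum_window_error_le {σ : ℝ} (hσ : 1 / 2 < σ) (hσ1 : σ < 1) (A : ℕ) :
    ∃ C, 0 < C ∧ ∀ a T T₁ T₂ : ℝ, 0 < a → a ≤ 1 → 2000 ≤ T → T / 2 ≤ T₁ → T₁ ≤ T₂ →
    T₂ ≤ 4 * T → ∀ M B : ℕ, 1 ≤ M → √T ≤ M + a → (B : ℝ) ≤ T ^ A →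
      ∑ m ∈ Ico M B, ((m : ℝ) + a) ^ (1 - 2 * σ) * (T / T ^ (A + 1) + T / ((m : ℝ) + a) ^ 2 +
        ∑ k ∈ Icc 1 ⌊2 * T / (m + a)⌋₊,
          (edge (2 * Real.pi * k * (m + a)) (2 * Real.pi * k * (m + a) - T₁) +
            edge (2 * Real.pi * k * (m + a)) (2 * Real.pi * k * (m + a) - T₂))) ≤
      C * (T ^ (1 - σ) * Real.log T) := by
  obtain ⟨C, hC, hb⟩ := exists_sum_edge_le (p := 2 * σ - 1) (by linarith) (by linarith)
  refine ⟨1 + (1 + 1 / (2 * σ)) + 2 * C, by positivity, ?_⟩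
  intro a T T₁ T₂ ha ha1 hT hT₁ hT₁₂ hT₂ M B hM hMa hB
  have hT0 : 0 < T := by linarith
  have hM1 : (1 : ℝ) ≤ M := by exact_mod_cast hM
  have h1 := hb a T T₁ ha ha1 hT hT₁ (by linarith) M B hM hMa
  have h2 := hb a T T₂ ha ha1 hT (by linarith) hT₂ M B hM hMa
  rw [show (1 - (2 * σ - 1)) / 2 = 1 - σ by ring, show -(2 * σ - 1) = 1 - 2 * σ by ring] at h1 h2
  have h3 : ∑ m ∈ Ico M B, ((m : ℝ) + a) ^ (1 - 2 * σ) * (T / T ^ (A + 1)) ≤ 1 := by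
    calc _ ≤ ∑ m ∈ Ico M B, 1 * (T / T ^ (A + 1)) := by
          refine sum_le_sum fun m hm => ?_
          have : (M : ℝ) ≤ m := by exact_mod_cast (mem_Ico.mp hm).1
          gcongr
          exact Real.rpow_le_one_of_one_le_of_nonpos (by linarith) (by linarith)
      _ = (B - M : ℕ) / T ^ A := by
          rw [sum_const, Nat.card_Ico, nsmul_eq_mul, pow_succ]
          field_simp
      _ ≤ 1 := by
          rw [div_le_one (by positivity)]
          exact le_trans (by exact_mod_cast Nat.sub_le _ _) hB
  have h4 : ∑ m ∈ Ico M B, ((m : ℝ) + a) ^ (1 - 2 * σ) * (T / ((m : ℝ) + a) ^ 2) ≤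
      (1 + 1 / (2 * σ)) * T ^ (1 - σ) := by
    calc _ = T * ∑ m ∈ Ico M B, ((m : ℝ) + a) ^ (-(2 * σ) - 1) := by
          rw [mul_sum]
          refine sum_congr rfl fun m _ => ?_
          have hm : 0 < (m : ℝ) + a := by positivity
          rw [show -(2 * σ) - 1 = 1 - 2 * σ - (2 : ℕ) by push_cast; ring, Real.rpow_sub_natCast hm.ne']
          ring
      _ ≤ T * ((1 + 1 / (2 * σ)) * ((M : ℝ) + a) ^ (-(2 * σ))) := by
          gcongr
          exact sum_Ico_add_rpow_le ha (by linarith) (by linarith) B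
      _ ≤ T * ((1 + 1 / (2 * σ)) * √T ^ (-(2 * σ))) := by
          gcongr T * (_ * ?_)
          exact Real.rpow_le_rpow_of_nonpos (Real.sqrt_pos.mpr hT0) hMa (by linarith)
      _ = (1 + 1 / (2 * σ)) * (T ^ (1 : ℝ) * T ^ (-σ)) := by
          rw [Real.sqrt_eq_rpow, ← Real.rpow_mul hT0.le, Real.rpow_one,
            show 1 / 2 * (-(2 * σ)) = -σ by ring]
          ring
      _ = _ := by rw [← Real.rpow_add hT0, ← sub_eq_add_neg]
  simp only [sum_add_distrib, mul_add ((_ : ℝ) ^ (1 - 2 * σ))]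
  have h5 := one_le_rpow_mul_log hT (by linarith : 0 ≤ 1 - σ)
  have h6 := rpow_le_rpow_mul_log (p := 1 - σ) hT
  have h7 : (1 + 1 / (2 * σ)) * T ^ (1 - σ) ≤ (1 + 1 / (2 * σ)) * (T ^ (1 - σ) * Real.log T) := by
    gcongr
  linarith

/-- The diagonal terms below `√T` together with the smooth windows above `√T` give the main
terms. -/
theorem exists_norm_window_sum_sub_le {a σ : ℝ} (ha : 0 < a) (ha1 : a ≤ 1) (hσ : 1 / 2 < σ)
    (hσ1 : σ < 1) {g : ℝ → ℂ} (hg : IsTest g) (hg0 : g 0 = 1) (A : ℕ) :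
    ∃ C, 0 < C ∧ ∀ T T₁ T₂ : ℝ, 2000 ≤ T → T / 2 ≤ T₁ → T₁ ≤ T₂ → T₂ ≤ 4 * T →
    ∀ M B B' : ℕ, √T ≤ M + a → M + a ≤ √T + 1 → 2 * T ≤ B → (B : ℝ) ≤ T ^ A →
    (∀ m < B, ((m : ℝ) + a) * Real.exp (1 / 2) ≤ B' + a) →
    ∀ ψ : ℕ → ℝ, (∀ m, 0 ≤ ψ m) → (∀ m, ψ m ≤ 1) → (∀ m : ℕ, (m : ℝ) + a ≤ 2 * T → ψ m = 1) →
      ‖(((T₂ - T₁) * ∑ m ∈ range M, ((m : ℝ) + a) ^ (-(2 * σ)) : ℝ) : ℂ) +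
        ∑ m ∈ Ico M B, ((ψ m * ((m : ℝ) + a) ^ (-(2 * σ)) : ℝ) : ℂ) *
          windowInt g a (m + a) T₁ T₂ B' -
        (((T₂ - T₁) * (hzeta a ((2 * σ : ℝ) : ℂ)).re + secondTerm σ T₂ - secondTerm σ T₁ : ℝ) : ℂ)‖
      ≤ C * (T ^ (1 - σ) * Real.log T) := by
  obtain ⟨C₁, hC₁, hb₁⟩ := exists_norm_windowInt_sub_le hg (A + 1)
  obtain ⟨C₂, hC₂, hb₂⟩ := exists_sum_window_error_le hσ hσ1 A
  obtain ⟨C₃, hC₃, hb₃⟩ := exists_abs_sum_floor_sub_le ha ha1 hσ hσ1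
  refine ⟨C₁ * C₂ + 2 * C₃, by positivity, ?_⟩
  intro T T₁ T₂ hT hT₁ hT₁₂ hT₂ M B B' hM hM1 hB hBA hB' ψ hψ0 hψ1 hψ
  have hT0 : 0 < T := by linarith
  have hpi := Real.pi_gt_three
  have hM1' : 1 ≤ M := by
    have hs40 : 40 ≤ √T := Real.le_sqrt_of_sq_le (by linarith)
    have : (1 : ℝ) ≤ M := by linarith
    exact_mod_cast this
  set D : ℕ → ℝ := fun m => (#{k ∈ Icc 1 ⌊2 * T / ((m : ℝ) + a)⌋₊ |
      T₁ < 2 * Real.pi * ((k : ℕ) : ℝ) * (m + a) ∧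
        2 * Real.pi * ((k : ℕ) : ℝ) * (m + a) ≤ T₂} : ℝ) with hD
  set E : ℕ → ℝ := fun m => T / T ^ (A + 1) + T / ((m : ℝ) + a) ^ 2 +
        ∑ k ∈ Icc 1 ⌊2 * T / ((m : ℝ) + a)⌋₊,
          (edge (2 * Real.pi * k * (m + a)) (2 * Real.pi * k * (m + a) - T₁) +
            edge (2 * Real.pi * k * (m + a)) (2 * Real.pi * k * (m + a) - T₂)) with hE
  have h1 : ‖∑ m ∈ Ico M B, ((ψ m * ((m : ℝ) + a) ^ (-(2 * σ)) : ℝ) : ℂ) *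
          windowInt g a (m + a) T₁ T₂ B' -
        ((2 * Real.pi * ∑ m ∈ Ico M B, ((m : ℝ) + a) ^ (1 - 2 * σ) * D m : ℝ) : ℂ)‖ ≤
      C₁ * C₂ * (T ^ (1 - σ) * Real.log T) := by
    calc _ ≤ ∑ m ∈ Ico M B, C₁ * (((m : ℝ) + a) ^ (1 - 2 * σ) * E m) := by
          rw [mul_sum, ofReal_sum, ← sum_sub_distrib]
          refine (norm_sum_le _ _).trans (sum_le_sum fun m hm => ?_)
          rw [mem_Ico] at hm
          have hmM : (M : ℝ) ≤ m := by exact_mod_cast hm.1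
          have hM1r : (1 : ℝ) ≤ M := by exact_mod_cast hM1'
          have hα : 0 < (m : ℝ) + a := by positivity
          have hαe : ((m : ℝ) + a) ^ (1 - 2 * σ) = ((m : ℝ) + a) * ((m : ℝ) + a) ^ (-(2 * σ)) := by
            rw [sub_eq_add_neg, Real.rpow_add hα, Real.rpow_one]
          have e1 : 2 * Real.pi * (((m : ℝ) + a) ^ (1 - 2 * σ) * D m) =
              ψ m * ((m : ℝ) + a) ^ (-(2 * σ)) * (2 * Real.pi * ((m + a) * D m)) := by
            rcases le_or_gt ((m : ℝ) + a) (2 * T) with h | h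
            · rw [hψ m h, hαe]; ring
            · have : D m = 0 := by
                simp only [hD, Nat.cast_eq_zero, card_eq_zero]
                refine filter_eq_empty_iff.mpr fun k hk => ?_
                rintro ⟨-, h4⟩
                have hk1 : (1 : ℝ) ≤ k := by exact_mod_cast (mem_Icc.mp hk).1
                have : 2 * 3 * 1 * (m + a) ≤ 2 * Real.pi * k * (m + a) := by gcongr
                linarith
              rw [this]; ring
          rw [e1, ofReal_mul (ψ m * ((m : ℝ) + a) ^ (-(2 * σ))) (2 * Real.pi * ((m + a) * D m)),
            ← mul_sub, norm_mul, norm_real, Real.norm_of_nonneg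
            (mul_nonneg (hψ0 m) (by positivity))]
          have := hb₁ a ha ha1 T T₁ T₂ (by linarith) hT₁ hT₁₂ hT₂ m B' (by linarith) (hB' m hm.2)
          rw [hg0, mul_one] at this
          calc _ ≤ 1 * ((m : ℝ) + a) ^ (-(2 * σ)) * (C₁ * (m + a) * E m) := by
                refine mul_le_mul (by gcongr; exact hψ1 m) ?_ (norm_nonneg _) (by positivity)
                refine le_of_eq_of_le ?_ this
                simp only [hD]
                push_cast
                ring_nf
            _ = _ := by rw [hαe]; ring
      _ = C₁ * ∑ m ∈ Ico M B, ((m : ℝ) + a) ^ (1 - 2 * σ) * E m := by rw [mul_sum]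
      _ ≤ C₁ * (C₂ * (T ^ (1 - σ) * Real.log T)) := by
          gcongr
          exact hb₂ a T T₁ T₂ ha ha1 hT hT₁ hT₁₂ hT₂ M B hM1' hM hBA
      _ = _ := by ring
  have h2 := hb₃ T T₂ hT (by linarith) hT₂ M B hM hM1 hB
  have h3 := hb₃ T T₁ hT hT₁ (by linarith) M B hM hM1 hB
  set S := ∑ m ∈ range M, ((m : ℝ) + a) ^ (-(2 * σ)) with hS
  set z := (hzeta a ((2 * σ : ℝ) : ℂ)).re with hz
  have h4 : |(T₂ - T₁) * S + 2 * Real.pi * ∑ m ∈ Ico M B, ((m : ℝ) + a) ^ (1 - 2 * σ) * D m -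
      ((T₂ - T₁) * z + secondTerm σ T₂ - secondTerm σ T₁)| ≤ 2 * C₃ * T ^ (1 - σ) := by
    have : ∑ m ∈ Ico M B, ((m : ℝ) + a) ^ (1 - 2 * σ) * D m =
        ∑ m ∈ Ico M B, ((m : ℝ) + a) ^ (1 - 2 * σ) * ⌊T₂ / (2 * Real.pi) / (m + a)⌋₊ -
        ∑ m ∈ Ico M B, ((m : ℝ) + a) ^ (1 - 2 * σ) * ⌊T₁ / (2 * Real.pi) / (m + a)⌋₊ := by
      rw [← sum_sub_distrib]
      refine sum_congr rfl fun m _ => ?_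
      rw [← mul_sub, ← card_window_eq (by positivity) (by linarith) hT₁₂ hT₂]
    rw [this]
    rw [abs_le] at h2 h3 ⊢
    constructor <;> nlinarith [h2.1, h2.2, h3.1, h3.2]
  have h5 := rpow_le_rpow_mul_log (p := 1 - σ) hT
  have h4' : ‖(((T₂ - T₁) * S + 2 * Real.pi * ∑ m ∈ Ico M B, ((m : ℝ) + a) ^ (1 - 2 * σ) * D m -
      ((T₂ - T₁) * z + secondTerm σ T₂ - secondTerm σ T₁) : ℝ) : ℂ)‖ ≤
      2 * C₃ * (T ^ (1 - σ) * Real.log T) := by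
    rw [norm_real, Real.norm_eq_abs]
    exact h4.trans (by gcongr)
  have h6 := (norm_add_le _ _).trans (add_le_add h1 h4')
  refine le_of_eq_of_le ?_ (h6.trans (le_of_eq (by ring)))
  congr 1
  push_cast
  ring

lemma norm_integral_cexp_le {θ : ℝ} (hθ : θ ≠ 0) (T₁ T₂ : ℝ) :
    ‖∫ t in T₁..T₂, cexp (((t * θ : ℝ) : ℂ) * I)‖ ≤ 2 / |θ| := by
  have hc : (θ : ℂ) * I ≠ 0 := mul_ne_zero (ofReal_ne_zero.mpr hθ) I_ne_zero
  have e : ∀ t : ℝ, cexp (((t * θ : ℝ) : ℂ) * I) = cexp (θ * I * t) := fun t => by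
    congr 1; push_cast; ring
  simp only [e]
  rw [integral_exp_mul_complex hc, norm_div, norm_mul, norm_I, mul_one, norm_real, Real.norm_eq_abs]
  gcongr
  refine (norm_sub_le _ _).trans ?_
  have h : ∀ t : ℝ, ‖cexp (θ * I * t)‖ = 1 := fun t => by rw [← e, norm_exp_ofReal_mul_I]
  rw [h, h]
  norm_num

/-- The `(m, n)` term of the smoothly localised mean square. -/
noncomputable def kern (a σ : ℝ) (η : ℝ → ℂ) (T₁ T₂ : ℝ) (m n : ℕ) : ℂ :=
  ((((m : ℝ) + a) ^ (-σ) * ((n : ℝ) + a) ^ (-σ) : ℝ) : ℂ) *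
    (η (Real.log ((n + a) / (m + a))) *
      ∫ t in T₁..T₂, cexp (((t * Real.log ((n + a) / (m + a)) : ℝ) : ℂ) * I))

lemma kern_self {a : ℝ} (ha : 0 < a) (σ : ℝ) {η : ℝ → ℂ} (hη : η 0 = 1) (T₁ T₂ : ℝ) (m : ℕ) :
    kern a σ η T₁ T₂ m m = (((T₂ - T₁) * ((m : ℝ) + a) ^ (-(2 * σ)) : ℝ) : ℂ) := by
  have hm : 0 < (m : ℝ) + a := by positivity
  rw [kern, div_self hm.ne', Real.log_one, hη, ← Real.rpow_add hm,
    show -σ + -σ = -(2 * σ) by ring]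
  simp [mul_comm]

lemma exp_half_lt_two : Real.exp (1 / 2) < 2 := by
  have h := Real.exp_one_lt_d9
  have h2 : Real.exp (1 / 2) * Real.exp (1 / 2) = Real.exp 1 := by
    rw [← Real.exp_add]; norm_num
  nlinarith [Real.exp_pos (1 / 2)]

lemma test_log_eq_zero {η : ℝ → ℂ} (hη : IsTest η) {x y : ℝ} (hx : 0 < x) (hy : 0 < y)
    (h : 2 * x ≤ y ∨ 2 * y ≤ x) : η (Real.log (y / x)) = 0 := by
  have h2 : 1 / 2 ≤ Real.log 2 := by
    rw [Real.le_log_iff_exp_le (by norm_num)]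
    exact exp_half_lt_two.le
  refine hη.eq_zero_of_le ?_
  rcases h with h | h
  · refine le_trans (h2.trans ?_) (le_abs_self _)
    refine Real.log_le_log (by norm_num) ?_
    rwa [le_div_iff₀ hx]
  · refine le_trans (h2.trans ?_) (neg_le_abs _)
    rw [← Real.log_inv, inv_div]
    refine Real.log_le_log (by norm_num) ?_
    rwa [le_div_iff₀ hy]

lemma abs_sub_div_le_abs_log {x y : ℝ} (hx : 0 < x) (hy : 0 < y) (h : y ≤ 2 * x) :
    |y - x| / (2 * x) ≤ |Real.log (y / x)| := by
  have key : ∀ {u v : ℝ}, 0 < u → 0 < v → (v - u) / v ≤ Real.log (v / u) := by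
    intro u v hu hv
    have := Real.one_sub_inv_le_log_of_pos (div_pos hv hu)
    rw [inv_div] at this
    rwa [sub_div, div_self hv.ne']
  rcases le_total x y with h1 | h1
  · rw [abs_of_nonneg (by linarith)]
    refine le_trans ?_ ((key hx hy).trans (le_abs_self _))
    gcongr
  · rw [abs_of_nonpos (by linarith)]
    have := key hy hx
    rw [← inv_div y x, Real.log_inv] at this
    refine le_trans ?_ (this.trans (neg_le_abs _))
    rw [neg_sub]
    gcongr
    linarith

lemma exists_norm_kern_le {σ : ℝ} (hσ0 : 0 ≤ σ) (hσ1 : σ ≤ 1) {η : ℝ → ℂ} (hη : IsTest η) :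
    ∃ C, 0 < C ∧ ∀ a T₁ T₂ : ℝ, 0 < a → a ≤ 1 → ∀ m n : ℕ, n ≠ m →
      ‖kern a σ η T₁ T₂ m n‖ ≤ if n < 2 * m + 2 then
        C * ((m : ℝ) + a) ^ (1 - 2 * σ) * (1 / (1 + 1 * |(n : ℝ) - m|)) else 0 := by
  obtain ⟨H, hH, hb⟩ := hη.bounded
  refine ⟨16 * (H + 1), by positivity, ?_⟩
  intro a T₁ T₂ ha ha1 m n hnm
  have hm : 0 < (m : ℝ) + a := by positivity
  have hn : 0 < (n : ℝ) + a := by positivity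
  have hpos : 0 ≤ if n < 2 * m + 2 then
        16 * (H + 1) * ((m : ℝ) + a) ^ (1 - 2 * σ) * (1 / (1 + 1 * |(n : ℝ) - m|)) else 0 := by
    split_ifs <;> positivity
  rcases le_or_gt (2 * ((m : ℝ) + a)) (n + a) with h1 | h1
  · rw [kern, test_log_eq_zero hη hm hn (Or.inl h1)]
    simpa using hpos
  rcases le_or_gt (2 * ((n : ℝ) + a)) (m + a) with h2 | h2
  · rw [kern, test_log_eq_zero hη hm hn (Or.inr h2)]
    simpa using hpos
  have hlt : n < 2 * m + 2 := by
    have : (n : ℝ) < 2 * m + 2 := by linarith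
    exact_mod_cast this
  rw [if_pos hlt]
  set θ := Real.log (((n : ℝ) + a) / (m + a)) with hθ
  have hd : 1 ≤ |(n : ℝ) - m| := by
    have : (1 : ℤ) ≤ |(n : ℤ) - m| := Int.one_le_abs (sub_ne_zero.mpr (by exact_mod_cast hnm))
    exact_mod_cast this
  have hθl := abs_sub_div_le_abs_log hm hn h1.le
  rw [add_sub_add_right_eq_sub, ← hθ] at hθl
  have hθ0 : 0 < |θ| := lt_of_lt_of_le (by positivity) hθl
  have hi := norm_integral_cexp_le (abs_pos.mp hθ0) T₁ T₂
  have e1 : 2 / |θ| ≤ 8 * (((m : ℝ) + a) * (1 / (1 + 1 * |(n : ℝ) - m|))) := by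
    calc 2 / |θ| ≤ 2 / (|(n : ℝ) - m| / (2 * (m + a))) := by gcongr
      _ = 4 * (m + a) / |(n : ℝ) - m| := by field_simp; ring
      _ ≤ _ := by
        rw [mul_one_div, ← mul_div_assoc, div_le_div_iff₀ (by positivity) (by positivity)]
        nlinarith
  have e2 : ((n : ℝ) + a) ^ (-σ) ≤ 2 * ((m : ℝ) + a) ^ (-σ) := by
    calc ((n : ℝ) + a) ^ (-σ) ≤ (((m : ℝ) + a) / 2) ^ (-σ) :=
          Real.rpow_le_rpow_of_nonpos (by positivity) (by linarith) (by linarith)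
      _ = 2 ^ σ * ((m : ℝ) + a) ^ (-σ) := by
          rw [Real.div_rpow hm.le (by norm_num), Real.rpow_neg (by norm_num : (0 : ℝ) ≤ 2),
            div_inv_eq_mul, mul_comm]
      _ ≤ 2 ^ (1 : ℝ) * ((m : ℝ) + a) ^ (-σ) := by gcongr; norm_num
      _ = _ := by rw [Real.rpow_one]
  have e3 : ((m : ℝ) + a) ^ (1 - 2 * σ) = (m + a) * (((m : ℝ) + a) ^ (-σ) * ((m : ℝ) + a) ^ (-σ)) := by
    rw [← Real.rpow_add hm, show 1 - 2 * σ = 1 + (-σ + -σ) by ring, Real.rpow_add hm 1, Real.rpow_one]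
  rw [kern, norm_mul, norm_mul, norm_real, Real.norm_of_nonneg (by positivity)]
  calc _ ≤ (((m : ℝ) + a) ^ (-σ) * (2 * ((m : ℝ) + a) ^ (-σ))) *
        ((H + 1) * (8 * (((m : ℝ) + a) * (1 / (1 + 1 * |(n : ℝ) - m|))))) := by
        gcongr
        · exact (hb _).trans (by linarith)
        · exact hi.trans e1
    _ = _ := by rw [e3]; ring

lemma exists_sum_norm_kern_le {σ : ℝ} (hσ0 : 0 ≤ σ) (hσ1 : σ ≤ 1) {η : ℝ → ℂ} (hη : IsTest η) :
    ∃ C, 0 < C ∧ ∀ a T₁ T₂ : ℝ, 0 < a → a ≤ 1 → ∀ m B : ℕ,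
      ∑ n ∈ (range B).erase m, ‖kern a σ η T₁ T₂ m n‖ ≤
        C * ((m : ℝ) + a) ^ (1 - 2 * σ) * (2 + Real.log (2 * m + 2)) := by
  obtain ⟨C, hC, hb⟩ := exists_norm_kern_le hσ0 hσ1 hη
  refine ⟨2 * C, by positivity, ?_⟩
  intro a T₁ T₂ ha ha1 m B
  have hm : 0 < (m : ℝ) + a := by positivity
  calc _ ≤ ∑ n ∈ (range B).erase m, (if n < 2 * m + 2 then
        C * ((m : ℝ) + a) ^ (1 - 2 * σ) * (1 / (1 + 1 * |(n : ℝ) - m|)) else 0) :=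
        sum_le_sum fun n hn => hb a T₁ T₂ ha ha1 m n (ne_of_mem_erase hn)
    _ ≤ ∑ n ∈ range (2 * m + 2), C * ((m : ℝ) + a) ^ (1 - 2 * σ) *
          (1 / (1 + 1 * |(n : ℝ) - m|)) := by
        rw [← sum_filter]
        refine sum_le_sum_of_subset_of_nonneg (fun n hn => ?_) fun n _ _ => by positivity
        exact mem_range.mpr (mem_filter.mp hn).2
    _ = C * ((m : ℝ) + a) ^ (1 - 2 * σ) * ∑ n ∈ range (2 * m + 2),
          (1 / (1 + 1 * |(n : ℝ) - m|)) := by rw [mul_sum]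
    _ ≤ C * ((m : ℝ) + a) ^ (1 - 2 * σ) * (2 * (1 + 1 / 1 * (1 + Real.log ((2 * m + 2 : ℕ) : ℝ)))) := by
        gcongr
        refine sum_range_div_add_abs_le one_pos one_pos m.cast_nonneg ?_
        push_cast
        linarith [m.cast_nonneg (α := ℝ)]
    _ = _ := by push_cast; ring

lemma sum_kern_eq {a : ℝ} (ha : 0 < a) (σ : ℝ) (η : ℝ → ℂ) (T₁ T₂ : ℝ) (m B : ℕ) :
    ∑ n ∈ range B, kern a σ η T₁ T₂ m n = ((((m : ℝ) + a) ^ (-(2 * σ)) : ℝ) : ℂ) *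
      windowInt (fun θ => (Real.exp (-σ * θ) : ℂ) * η θ) a (m + a) T₁ T₂ B := by
  rw [windowInt, mul_sum]
  refine sum_congr rfl fun n _ => ?_
  have hm : 0 < (m : ℝ) + a := by positivity
  have hn : 0 < (n : ℝ) + a := by positivity
  have e : ((m : ℝ) + a) ^ (-σ) * ((n : ℝ) + a) ^ (-σ) =
      ((m : ℝ) + a) ^ (-(2 * σ)) * Real.exp (-σ * Real.log ((n + a) / (m + a))) := by
    rw [mul_comm (-σ), ← Real.rpow_def_of_pos (by positivity), Real.div_rpow hn.le hm.le,
      show -(2 * σ) = -σ + -σ by ring, Real.rpow_add hm]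
    have : ((m : ℝ) + a) ^ (-σ) ≠ 0 := by positivity
    field_simp
  rw [kern, e]
  push_cast
  ring

lemma log_le_mul_rpow {a ε : ℝ} (ha : 0 < a) (ha1 : a ≤ 1) (hε : 0 < ε) (m : ℕ) :
    2 + Real.log (2 * m + 2) ≤ (2 / a ^ ε + (2 / a) ^ ε / ε) * ((m : ℝ) + a) ^ ε := by
  have hm : 0 < (m : ℝ) + a := by positivity
  have h1 : Real.log (2 * m + 2) ≤ (2 / a) ^ ε / ε * ((m : ℝ) + a) ^ ε := by
    refine (Real.log_le_rpow_div (by positivity) hε).trans ?_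
    rw [div_mul_eq_mul_div]
    gcongr
    rw [← Real.mul_rpow (by positivity) hm.le]
    gcongr
    have h2 : 2 ≤ 2 / a := by rw [le_div_iff₀ ha]; linarith
    have h3 : 2 / a * a = 2 := by field_simp
    nlinarith [m.cast_nonneg (α := ℝ)]
  have h2 : 2 ≤ 2 / a ^ ε * ((m : ℝ) + a) ^ ε := by
    rw [div_mul_eq_mul_div, le_div_iff₀ (by positivity)]
    gcongr
    linarith [m.cast_nonneg (α := ℝ)]
  linarith

lemma summable_rpow_mul_log {a σ : ℝ} (ha : 0 < a) (ha1 : a ≤ 1) (hσ : 1 / 2 < σ) :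
    Summable fun m : ℕ => ((m : ℝ) + a) ^ (-(2 * σ)) * (2 + Real.log (2 * m + 2)) := by
  have hε : 0 < (2 * σ - 1) / 2 := by linarith
  refine Summable.of_nonneg_of_le (fun m => ?_) (fun m => ?_)
    ((summable_add_rpow ha (p := -(2 * σ) + (2 * σ - 1) / 2) (by linarith)).mul_left
      (2 / a ^ ((2 * σ - 1) / 2) + (2 / a) ^ ((2 * σ - 1) / 2) / ((2 * σ - 1) / 2)))
  · have : 0 ≤ Real.log (2 * m + 2) := Real.log_nonneg (by linarith [m.cast_nonneg (α := ℝ)])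
    positivity
  · have hm : 0 < (m : ℝ) + a := by positivity
    rw [Real.rpow_add hm]
    calc _ ≤ ((m : ℝ) + a) ^ (-(2 * σ)) * ((2 / a ^ ((2 * σ - 1) / 2) +
          (2 / a) ^ ((2 * σ - 1) / 2) / ((2 * σ - 1) / 2)) * ((m : ℝ) + a) ^ ((2 * σ - 1) / 2)) := by
          gcongr
          exact log_le_mul_rpow ha ha1 hε m
      _ = _ := by ring

lemma exists_sum_range_rpow_mul_log_le {a σ : ℝ} (ha : 0 < a) (hσ : 1 / 2 < σ)
    (hσ1 : σ < 1) : ∃ C, 0 < C ∧ ∀ (T : ℝ) (M : ℕ), 2000 ≤ T → (M : ℝ) ≤ √T + 1 →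
      ∑ m ∈ range M, ((m : ℝ) + a) ^ (1 - 2 * σ) * (2 + Real.log (2 * m + 2)) ≤
        C * (T ^ (1 - σ) * Real.log T) := by
  have h1σ : 0 < 2 - 2 * σ := by linarith
  refine ⟨(a ^ (1 - 2 * σ) + 2 / (2 - 2 * σ)) * 3, by positivity, ?_⟩
  intro T M hT hM
  have hT0 : 0 < T := by linarith
  have hs : 0 < √T := Real.sqrt_pos.mpr hT0
  have hss : √T * √T = T := Real.mul_self_sqrt hT0.le
  have hs40 : 40 ≤ √T := Real.le_sqrt_of_sq_le (by linarith)
  have hlog : 1 ≤ Real.log T := by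
    rw [Real.le_log_iff_exp_le hT0]
    linarith [Real.exp_one_lt_d9]
  have hTσ : 1 ≤ T ^ (1 - σ) := Real.one_le_rpow (by linarith) (by linarith)
  have h1 : ∑ m ∈ range M, ((m : ℝ) + a) ^ (1 - 2 * σ) ≤
      (a ^ (1 - 2 * σ) + 2 / (2 - 2 * σ)) * T ^ (1 - σ) := by
    have h2 : ∑ m ∈ range M, ((m : ℝ) + a) ^ (1 - 2 * σ) ≤
        a ^ (1 - 2 * σ) + ∑ m ∈ Ico 1 M, ((m : ℝ) + a) ^ (1 - 2 * σ) := by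
      rcases M.eq_zero_or_pos with rfl | hM0
      · simp; positivity
      · rw [range_eq_Ico, sum_eq_sum_Ico_succ_bot hM0]
        simp
    have h3 := sum_Ico_add_rpow_neg_le (p := 2 * σ - 1) ha.le (by linarith) (by linarith)
      (le_refl 1) M
    rw [show -(2 * σ - 1) = 1 - 2 * σ by ring, show 1 - (2 * σ - 1) = 2 - 2 * σ by ring] at h3
    have h4 : (M : ℝ) ^ (2 - 2 * σ) ≤ 2 * T ^ (1 - σ) := by
      calc (M : ℝ) ^ (2 - 2 * σ) ≤ (2 * √T) ^ (2 - 2 * σ) := by gcongr; linarith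
        _ = 2 ^ (2 - 2 * σ) * T ^ (1 - σ) := by
          rw [Real.mul_rpow (by norm_num) hs.le, Real.sqrt_eq_rpow, ← Real.rpow_mul hT0.le]
          congr 2
          ring
        _ ≤ 2 ^ (1 : ℝ) * T ^ (1 - σ) := by
          gcongr
          · norm_num
          · linarith
        _ = _ := by rw [Real.rpow_one]
    have h5 : (M : ℝ) ^ (2 - 2 * σ) / (2 - 2 * σ) ≤ 2 / (2 - 2 * σ) * T ^ (1 - σ) := by
      rw [div_mul_eq_mul_div]
      gcongr
    have h6 : a ^ (1 - 2 * σ) ≤ a ^ (1 - 2 * σ) * T ^ (1 - σ) :=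
      le_mul_of_one_le_right (by positivity) hTσ
    linarith
  calc _ ≤ ∑ m ∈ range M, ((m : ℝ) + a) ^ (1 - 2 * σ) * (3 * Real.log T) := by
        refine sum_le_sum fun m hm => ?_
        have hm' : (m : ℝ) ≤ M := by exact_mod_cast (mem_range.mp hm).le
        gcongr
        have : Real.log (2 * m + 2) ≤ Real.log T := by
          refine Real.log_le_log (by positivity) ?_
          nlinarith
        linarith
    _ = (∑ m ∈ range M, ((m : ℝ) + a) ^ (1 - 2 * σ)) * (3 * Real.log T) := by rw [sum_mul]
    _ ≤ (a ^ (1 - 2 * σ) + 2 / (2 - 2 * σ)) * T ^ (1 - σ) * (3 * Real.log T) := by gcongr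
    _ = _ := by ring

lemma exists_nat_add_near_sqrt {a T : ℝ} (ha1 : a ≤ 1) (hT : 2000 ≤ T) :
    ∃ M : ℕ, √T ≤ M + a ∧ M + a ≤ √T + 1 := by
  have hs40 : 40 ≤ √T := Real.le_sqrt_of_sq_le (by linarith)
  refine ⟨⌈√T - a⌉₊, ?_, ?_⟩
  · linarith [Nat.le_ceil (√T - a)]
  · linarith [Nat.ceil_lt_add_one (show 0 ≤ √T - a by linarith)]

lemma norm_coeff_mul_kern_le {a σ K c₀ : ℝ} {c : ℕ → ℝ} (ha : 0 < a) (hK : ∀ m, |c m| ≤ K)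
    (hK₀ : |c₀| ≤ K) (hc : ∀ m, |c m - c₀| ≤ K / (m + a)) {η : ℝ → ℂ} (hη : IsTest η)
    (T₁ T₂ : ℝ) (m n : ℕ) :
    ‖((c m * c n - c₀ ^ 2 : ℝ) : ℂ) * kern a σ η T₁ T₂ m n‖ ≤
      3 * K ^ 2 / (m + a) * ‖kern a σ η T₁ T₂ m n‖ := by
  have hm : 0 < (m : ℝ) + a := by positivity
  have hn : 0 < (n : ℝ) + a := by positivity
  have hK0 : 0 ≤ K := (abs_nonneg _).trans hK₀
  rcases le_or_gt (2 * ((n : ℝ) + a)) (m + a) with h2 | h2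
  · rw [kern, test_log_eq_zero hη hm hn (Or.inr h2)]
    simp
  rw [norm_mul, norm_real, Real.norm_eq_abs]
  gcongr
  have e : c m * c n - c₀ ^ 2 = c m * (c n - c₀) + c₀ * (c m - c₀) := by ring
  have h3 : K / (n + a) ≤ 2 * K / (m + a) := by
    rw [div_le_div_iff₀ hn hm]
    nlinarith
  calc |c m * c n - c₀ ^ 2| ≤ |c m| * |c n - c₀| + |c₀| * |c m - c₀| := by
        rw [e, ← abs_mul, ← abs_mul]; exact abs_add_le _ _
    _ ≤ K * (2 * K / (m + a)) + K * (K / (m + a)) := by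
        gcongr
        · exact hK m
        · exact (hc n).trans h3
        · exact hc m
    _ = _ := by ring

lemma exists_abs_sum_diag_sub_le {a σ K c₀ : ℝ} {c : ℕ → ℝ} (ha : 0 < a)
    (hσ : 1 / 2 < σ) (hK : ∀ m, |c m| ≤ K)
    (hK₀ : |c₀| ≤ K) (hc : ∀ m, |c m - c₀| ≤ K / (m + a)) :
    (Summable fun m : ℕ => (c m ^ 2 - c₀ ^ 2) * ((m : ℝ) + a) ^ (-(2 * σ))) ∧
    ∃ C, 0 < C ∧ ∀ (T : ℝ) (M B : ℕ), 2000 ≤ T → √T ≤ M + a → ∀ ψ : ℕ → ℝ, (∀ m, 0 ≤ ψ m) →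
      (∀ m, ψ m ≤ 1) → (∀ m < M, ψ m = 1) → (∀ m, B ≤ m → ψ m = 0) →
      |∑ m ∈ range B, ψ m * ((c m ^ 2 - c₀ ^ 2) * ((m : ℝ) + a) ^ (-(2 * σ))) -
        ∑' m : ℕ, (c m ^ 2 - c₀ ^ 2) * ((m : ℝ) + a) ^ (-(2 * σ))| ≤ C * T ^ (-σ) := by
  have hK0 : 0 ≤ K := (abs_nonneg _).trans hK₀
  set F : ℕ → ℝ := fun m => (c m ^ 2 - c₀ ^ 2) * ((m : ℝ) + a) ^ (-(2 * σ)) with hF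
  have hFb : ∀ m, |F m| ≤ 2 * K ^ 2 * ((m : ℝ) + a) ^ (-(2 * σ) - 1) := by
    intro m
    have hm : 0 < (m : ℝ) + a := by positivity
    have e : c m ^ 2 - c₀ ^ 2 = (c m + c₀) * (c m - c₀) := by ring
    have h1 : |c m ^ 2 - c₀ ^ 2| ≤ 2 * K * (K / (m + a)) := by
      rw [e, abs_mul]
      gcongr
      · exact (abs_add_le _ _).trans (by linarith [hK m])
      · exact hc m
    rw [hF]
    simp only
    rw [abs_mul, abs_of_nonneg (by positivity : 0 ≤ ((m : ℝ) + a) ^ (-(2 * σ))),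
      Real.rpow_sub_one hm.ne']
    calc _ ≤ 2 * K * (K / (m + a)) * ((m : ℝ) + a) ^ (-(2 * σ)) := by gcongr
      _ = _ := by ring
  have hs1 := (summable_add_rpow ha (p := -(2 * σ) - 1) (by linarith)).mul_left (2 * K ^ 2)
  have hFs : Summable F := Summable.of_norm_bounded hs1 hFb
  refine ⟨hFs, 2 * K ^ 2 * (1 + 1 / (2 * σ)) + 1, by positivity, ?_⟩
  intro T M B hT hM ψ hψ0 hψ1 hψ hψB
  have hT0 : 0 < T := by linarith
  have hs40 : 40 ≤ √T := Real.le_sqrt_of_sq_le (by linarith)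
  have hMa : 0 < (M : ℝ) + a := by linarith
  have h1 : ∑ m ∈ range B, ψ m * F m = ∑' m, ψ m * F m :=
    (tsum_eq_sum fun m hm => by rw [hψB m (by simpa using hm), zero_mul]).symm
  have hψF : Summable fun m => ψ m * F m := summable_of_ne_finset_zero (s := range B)
    fun m hm => by rw [hψB m (by simpa using hm), zero_mul]
  set G : ℕ → ℝ := fun m => ψ m * F m - F m with hG
  have hGs : Summable G := hψF.sub hFs
  rw [h1, ← hψF.tsum_sub hFs, ← hGs.sum_add_tsum_nat_add M,
    sum_eq_zero fun m hm => by rw [hG]; simp [hψ m (mem_range.mp hm)], zero_add]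
  have hb : ∀ k : ℕ, ‖G (k + M)‖ ≤ 2 * K ^ 2 * ((k : ℝ) + (M + a)) ^ (-(2 * σ) - 1) := by
    intro k
    have h2 := hFb (k + M)
    have e : G (k + M) = (ψ (k + M) - 1) * F (k + M) := by rw [hG]; ring
    rw [e, norm_mul, Real.norm_eq_abs, Real.norm_eq_abs]
    have h3 : |ψ (k + M) - 1| ≤ 1 := by
      rw [abs_le]; constructor <;> linarith [hψ0 (k + M), hψ1 (k + M)]
    have e2 : (k : ℝ) + (M + a) = ((k + M : ℕ) : ℝ) + a := by push_cast; ring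
    rw [e2]
    exact (mul_le_of_le_one_left (abs_nonneg _) h3).trans h2
  have hs2 := (summable_add_rpow hMa (p := -(2 * σ) - 1) (by linarith)).mul_left (2 * K ^ 2)
  have h4 := tsum_of_norm_bounded hs2.hasSum hb
  rw [tsum_mul_left] at h4
  refine h4.trans ?_
  have h5 := tsum_add_rpow_le hMa (σ := 2 * σ) (by linarith)
  have h6 : ((M : ℝ) + a) ^ (-(2 * σ) - 1) ≤ ((M : ℝ) + a) ^ (-(2 * σ)) :=
    Real.rpow_le_rpow_of_exponent_le (by linarith) (by linarith)
  have h7 : ((M : ℝ) + a) ^ (-(2 * σ)) ≤ T ^ (-σ) := by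
    calc ((M : ℝ) + a) ^ (-(2 * σ)) ≤ √T ^ (-(2 * σ)) :=
          Real.rpow_le_rpow_of_nonpos (by linarith) hM (by linarith)
      _ = _ := by
          rw [Real.sqrt_eq_rpow, ← Real.rpow_mul hT0.le]
          congr 1
          ring
  have h8 : 0 < T ^ (-σ) := by positivity
  calc _ ≤ 2 * K ^ 2 * (T ^ (-σ) + T ^ (-σ) / (2 * σ)) := by
        gcongr
        refine h5.trans ?_
        gcongr
        exact h6.trans h7
    _ ≤ _ := by
        have : 2 * K ^ 2 * (T ^ (-σ) + T ^ (-σ) / (2 * σ)) =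
          2 * K ^ 2 * (1 + 1 / (2 * σ)) * T ^ (-σ) := by ring
        rw [this]
        linarith

lemma re_hzeta_eq_tsum {a σ : ℝ} (ha : 0 < a) (ha1 : a ≤ 1) (hσ : 1 / 2 < σ) :
    (hzeta a ((2 * σ : ℝ) : ℂ)).re = ∑' m : ℕ, ((m : ℝ) + a) ^ (-(2 * σ)) := by
  have h := hasSum_hzeta (s := ((2 * σ : ℝ) : ℂ)) ha ha1 (by rw [ofReal_re]; linarith)
  have h2 := Complex.hasSum_re h
  rw [← h2.tsum_eq]
  refine tsum_congr fun m => ?_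
  rw [← ofReal_neg, ← ofReal_cpow (by positivity), ofReal_re]

lemma near_sum_eq {a σ c₀ : ℝ} (c ψ : ℕ → ℝ) (ha : 0 < a) {η : ℝ → ℂ} (hη0 : η 0 = 1)
    (T₁ T₂ : ℝ) {M B B' : ℕ} (hMB : M ≤ B) (hBB : B ≤ B') (hψ : ∀ m < M, ψ m = 1) :
    ∑ m ∈ range B, ∑ n ∈ range B', ((ψ m * c m * c n : ℝ) : ℂ) * kern a σ η T₁ T₂ m n =
      (c₀ : ℂ) ^ 2 * ((((T₂ - T₁) * ∑ m ∈ range M, ((m : ℝ) + a) ^ (-(2 * σ)) : ℝ) : ℂ) +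
        ∑ m ∈ Ico M B, ((ψ m * ((m : ℝ) + a) ^ (-(2 * σ)) : ℝ) : ℂ) *
          windowInt (fun θ => (Real.exp (-σ * θ) : ℂ) * η θ) a (m + a) T₁ T₂ B') +
      (((T₂ - T₁) * ∑ m ∈ range B, ψ m * ((c m ^ 2 - c₀ ^ 2) * ((m : ℝ) + a) ^ (-(2 * σ))) : ℝ) : ℂ)
      + ∑ m ∈ range B, ∑ n ∈ (range B').erase m,
          (ψ m : ℂ) * (((c m * c n - c₀ ^ 2 : ℝ) : ℂ) * kern a σ η T₁ T₂ m n)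
      + (c₀ : ℂ) ^ 2 * ∑ m ∈ range M, ∑ n ∈ (range B').erase m, kern a σ η T₁ T₂ m n := by
  have e1 : (((T₂ - T₁) * ∑ m ∈ range M, ((m : ℝ) + a) ^ (-(2 * σ)) : ℝ) : ℂ) =
      ∑ m ∈ range M, kern a σ η T₁ T₂ m m := by
    rw [mul_sum, ofReal_sum]
    exact sum_congr rfl fun m _ => (kern_self ha σ hη0 T₁ T₂ m).symm
  have e2 : (((T₂ - T₁) * ∑ m ∈ range B,
      ψ m * ((c m ^ 2 - c₀ ^ 2) * ((m : ℝ) + a) ^ (-(2 * σ))) : ℝ) : ℂ) =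
      ∑ m ∈ range B, ((ψ m * (c m ^ 2 - c₀ ^ 2) : ℝ) : ℂ) * kern a σ η T₁ T₂ m m := by
    rw [mul_sum, ofReal_sum]
    refine sum_congr rfl fun m _ => ?_
    rw [kern_self ha σ hη0 T₁ T₂ m]
    push_cast
    ring
  have e3 : ∑ m ∈ Ico M B, ((ψ m * ((m : ℝ) + a) ^ (-(2 * σ)) : ℝ) : ℂ) *
      windowInt (fun θ => (Real.exp (-σ * θ) : ℂ) * η θ) a (m + a) T₁ T₂ B' =
      ∑ m ∈ Ico M B, (ψ m : ℂ) * ∑ n ∈ range B', kern a σ η T₁ T₂ m n := by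
    refine sum_congr rfl fun m _ => ?_
    rw [sum_kern_eq ha]
    push_cast
    ring
  have e4 : ∑ m ∈ range M, kern a σ η T₁ T₂ m m +
      ∑ m ∈ range M, ∑ n ∈ (range B').erase m, kern a σ η T₁ T₂ m n =
      ∑ m ∈ range M, (ψ m : ℂ) * ∑ n ∈ range B', kern a σ η T₁ T₂ m n := by
    rw [← sum_add_distrib]
    refine sum_congr rfl fun m hm => ?_
    have hm := mem_range.mp hm
    rw [hψ m hm, ofReal_one, one_mul,
      add_sum_erase _ _ (mem_range.mpr (hm.trans_le (hMB.trans hBB)))]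
  have e5 : ∑ m ∈ range B, ∑ n ∈ range B', ((ψ m * c m * c n : ℝ) : ℂ) * kern a σ η T₁ T₂ m n =
      (c₀ : ℂ) ^ 2 * ∑ m ∈ range B, (ψ m : ℂ) * ∑ n ∈ range B', kern a σ η T₁ T₂ m n +
      ∑ m ∈ range B, ((ψ m * (c m ^ 2 - c₀ ^ 2) : ℝ) : ℂ) * kern a σ η T₁ T₂ m m +
      ∑ m ∈ range B, ∑ n ∈ (range B').erase m,
          (ψ m : ℂ) * (((c m * c n - c₀ ^ 2 : ℝ) : ℂ) * kern a σ η T₁ T₂ m n) := by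
    rw [mul_sum, ← sum_add_distrib, ← sum_add_distrib]
    refine sum_congr rfl fun m hm => ?_
    have hm' : m ∈ range B' := mem_range.mpr ((mem_range.mp hm).trans_le hBB)
    rw [add_assoc, show ((ψ m * (c m ^ 2 - c₀ ^ 2) : ℝ) : ℂ) * kern a σ η T₁ T₂ m m =
      (ψ m : ℂ) * (((c m * c m - c₀ ^ 2 : ℝ) : ℂ) * kern a σ η T₁ T₂ m m) by push_cast; ring,
      add_sum_erase _ (fun n => (ψ m : ℂ) * (((c m * c n - c₀ ^ 2 : ℝ) : ℂ) *
        kern a σ η T₁ T₂ m n)) hm', mul_sum, mul_sum, ← sum_add_distrib]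
    refine sum_congr rfl fun n _ => ?_
    push_cast
    ring
  rw [e1, e2, e3, e5, ← sum_range_add_sum_Ico _ hMB, ← e4]
  ring

theorem exists_norm_near_sub_le {a σ K c₀ : ℝ} {c : ℕ → ℝ} (ha : 0 < a) (ha1 : a ≤ 1)
    (hσ : 1 / 2 < σ) (hσ1 : σ < 1) (hK : ∀ m, |c m| ≤ K) (hK₀ : |c₀| ≤ K)
    (hc : ∀ m, |c m - c₀| ≤ K / (m + a)) {η : ℝ → ℂ} (hη : IsTest η) (hη0 : η 0 = 1) (A : ℕ) :
    ∃ C, 0 < C ∧ ∀ T T₁ T₂ : ℝ, 2000 ≤ T → T / 2 ≤ T₁ → T₁ ≤ T₂ → T₂ ≤ 4 * T →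
    ∀ B B' : ℕ, 2 * T ≤ B → (B : ℝ) ≤ T ^ A →
    (∀ m < B, ((m : ℝ) + a) * Real.exp (1 / 2) ≤ B' + a) →
    ∀ ψ : ℕ → ℝ, (∀ m, 0 ≤ ψ m) → (∀ m, ψ m ≤ 1) → (∀ m : ℕ, (m : ℝ) + a ≤ 2 * T → ψ m = 1) →
    (∀ m, B ≤ m → ψ m = 0) →
      ‖∑ m ∈ range B, ∑ n ∈ range B', ((ψ m * c m * c n : ℝ) : ℂ) * kern a σ η T₁ T₂ m n -
        (((T₂ - T₁) * ∑' m : ℕ, c m ^ 2 * ((m : ℝ) + a) ^ (-(2 * σ)) +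
          c₀ ^ 2 * (secondTerm σ T₂ - secondTerm σ T₁) : ℝ) : ℂ)‖ ≤
        C * (T ^ (1 - σ) * Real.log T) := by
  have hK0 : 0 ≤ K := (abs_nonneg _).trans hK₀
  have hg : IsTest fun θ => (Real.exp (-σ * θ) : ℂ) * η θ :=
    hη.mul_left (ofRealCLM.contDiff.comp
      (Real.contDiff_exp.comp (contDiff_const.mul contDiff_id)))
  obtain ⟨C₁, hC₁, b₁⟩ := exists_norm_window_sum_sub_le ha ha1 hσ hσ1 hg (by simp [hη0]) A
  obtain ⟨hDs, C₂, hC₂, b₂⟩ := exists_abs_sum_diag_sub_le ha hσ hK hK₀ hc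
  obtain ⟨C₃, hC₃, b₃⟩ := exists_sum_norm_kern_le (by linarith) hσ1.le hη
  obtain ⟨C₄, hC₄, b₄⟩ := exists_sum_range_rpow_mul_log_le ha hσ hσ1
  have hls := summable_rpow_mul_log ha ha1 hσ
  set Λ := ∑' m : ℕ, ((m : ℝ) + a) ^ (-(2 * σ)) * (2 + Real.log (2 * m + 2)) with hΛ
  have hlog0 : ∀ m : ℕ, 0 ≤ Real.log (2 * m + 2) := fun m =>
    Real.log_nonneg (by linarith [m.cast_nonneg (α := ℝ)])
  have hΛ0 : 0 ≤ Λ := tsum_nonneg fun m => mul_nonneg (by positivity) (by linarith [hlog0 m])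
  refine ⟨K ^ 2 * C₁ + 4 * C₂ + 3 * K ^ 2 * C₃ * Λ + K ^ 2 * (C₃ * C₄), by positivity, ?_⟩
  intro T T₁ T₂ hT hT₁ hT₁₂ hT₂ B B' hB hBA hBB ψ hψ0 hψ1 hψ hψB
  have hT0 : 0 < T := by linarith
  obtain ⟨M, hM1, hM2⟩ := exists_nat_add_near_sqrt ha1 hT
  have hss : √T * √T = T := Real.mul_self_sqrt hT0.le
  have hs40 : 40 ≤ √T := Real.le_sqrt_of_sq_le (by linarith)
  have hMB : M ≤ B := by
    have : (M : ℝ) ≤ B := by nlinarith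
    exact_mod_cast this
  have hψM : ∀ m < M, ψ m = 1 := fun m hm => by
    refine hψ m ?_
    have : (m : ℝ) + 1 ≤ M := by exact_mod_cast hm
    nlinarith
  have hBB' : B ≤ B' := by
    rcases B.eq_zero_or_pos with h0 | h0
    · omega
    · have h1 := hBB (B - 1) (by omega)
      rw [Nat.cast_sub (by omega), Nat.cast_one] at h1
      have h2 : 3 / 2 ≤ Real.exp (1 / 2) := by
        have := Real.add_one_le_exp (1 / 2 : ℝ); linarith
      have h3 : (B : ℝ) ≤ B' := by nlinarith
      exact_mod_cast h3
  have k₁ := b₁ T T₁ T₂ hT hT₁ hT₁₂ hT₂ M B B' hM1 hM2 hB hBA hBB ψ hψ0 hψ1 hψ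
  have k₂ := b₂ T M B hT hM1 ψ hψ0 hψ1 hψM hψB
  have k₄ := b₄ T M hT (by linarith)
  have hLT : (T₂ - T₁) * T ^ (-σ) ≤ 4 * (T ^ (1 - σ) * Real.log T) := by
    have h1 : T * T ^ (-σ) = T ^ (1 - σ) := by
      rw [sub_eq_add_neg, Real.rpow_add hT0, Real.rpow_one]
    calc (T₂ - T₁) * T ^ (-σ) ≤ (4 * T) * T ^ (-σ) := by gcongr; linarith
      _ = 4 * T ^ (1 - σ) := by rw [← h1]; ring
      _ ≤ _ := by gcongr; exact rpow_le_rpow_mul_log hT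
  have hone := one_le_rpow_mul_log hT (p := 1 - σ) (by linarith)
  rw [near_sum_eq (c₀ := c₀) c ψ ha hη0 T₁ T₂ hMB hBB' hψM]
  have hsum : ∑' m : ℕ, c m ^ 2 * ((m : ℝ) + a) ^ (-(2 * σ)) =
      ∑' m : ℕ, (c m ^ 2 - c₀ ^ 2) * ((m : ℝ) + a) ^ (-(2 * σ)) +
      c₀ ^ 2 * (hzeta a ((2 * σ : ℝ) : ℂ)).re := by
    rw [re_hzeta_eq_tsum ha ha1 hσ, ← tsum_mul_left, ← hDs.tsum_add
      ((summable_add_rpow ha (p := -(2 * σ)) (by linarith)).mul_left _)]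
    exact tsum_congr fun m => by ring
  rw [hsum]
  set V : ℂ := (((T₂ - T₁) * ∑ m ∈ range M, ((m : ℝ) + a) ^ (-(2 * σ)) : ℝ) : ℂ) +
        ∑ m ∈ Ico M B, ((ψ m * ((m : ℝ) + a) ^ (-(2 * σ)) : ℝ) : ℂ) *
          windowInt (fun θ => (Real.exp (-σ * θ) : ℂ) * η θ) a (m + a) T₁ T₂ B'
  set V' : ℝ := (T₂ - T₁) * (hzeta a ((2 * σ : ℝ) : ℂ)).re + secondTerm σ T₂ - secondTerm σ T₁
    with hV'
  set D := ∑ m ∈ range B, ψ m * ((c m ^ 2 - c₀ ^ 2) * ((m : ℝ) + a) ^ (-(2 * σ)))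
  set D' := ∑' m : ℕ, (c m ^ 2 - c₀ ^ 2) * ((m : ℝ) + a) ^ (-(2 * σ))
  set E₁ := ∑ m ∈ range B, ∑ n ∈ (range B').erase m,
          (ψ m : ℂ) * (((c m * c n - c₀ ^ 2 : ℝ) : ℂ) * kern a σ η T₁ T₂ m n) with hE₁
  set E₂ := ∑ m ∈ range M, ∑ n ∈ (range B').erase m, kern a σ η T₁ T₂ m n with hE₂
  have n1 : ‖E₁‖ ≤ 3 * K ^ 2 * C₃ * Λ := by
    refine (norm_sum_le _ _).trans ?_
    calc _ ≤ ∑ m ∈ range B, 3 * K ^ 2 * C₃ *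
          (((m : ℝ) + a) ^ (-(2 * σ)) * (2 + Real.log (2 * m + 2))) := by
          refine sum_le_sum fun m _ => (norm_sum_le _ _).trans ?_
          have hm : 0 < (m : ℝ) + a := by positivity
          calc _ ≤ ∑ n ∈ (range B').erase m,
                3 * K ^ 2 / (m + a) * ‖kern a σ η T₁ T₂ m n‖ := by
                refine sum_le_sum fun n _ => ?_
                rw [norm_mul, norm_real, Real.norm_eq_abs, abs_of_nonneg (hψ0 m)]
                exact (mul_le_of_le_one_left (norm_nonneg _) (hψ1 m)).trans
                  (norm_coeff_mul_kern_le ha hK hK₀ hc hη T₁ T₂ m n)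
            _ ≤ 3 * K ^ 2 / (m + a) *
                (C₃ * ((m : ℝ) + a) ^ (1 - 2 * σ) * (2 + Real.log (2 * m + 2))) := by
                rw [← mul_sum]
                gcongr
                exact b₃ a T₁ T₂ ha ha1 m B'
            _ = _ := by
                rw [sub_eq_add_neg 1, add_comm 1, Real.rpow_add_one hm.ne']
                field_simp
      _ ≤ _ := by
          rw [← mul_sum]
          gcongr
          exact hls.sum_le_tsum _ fun m _ => mul_nonneg (by positivity) (by linarith [hlog0 m])
  have n2 : ‖E₂‖ ≤ C₃ * C₄ * (T ^ (1 - σ) * Real.log T) := by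
    refine (norm_sum_le _ _).trans ?_
    calc _ ≤ ∑ m ∈ range M, C₃ *
          (((m : ℝ) + a) ^ (1 - 2 * σ) * (2 + Real.log (2 * m + 2))) := by
          refine sum_le_sum fun m _ => (norm_sum_le _ _).trans ?_
          rw [← mul_assoc]
          exact b₃ a T₁ T₂ ha ha1 m B'
      _ ≤ _ := by
          rw [← mul_sum, mul_assoc]
          gcongr
  have e : (c₀ : ℂ) ^ 2 * V + (((T₂ - T₁) * D : ℝ) : ℂ) + E₁ + (c₀ : ℂ) ^ 2 * E₂ -
      (((T₂ - T₁) * (D' + c₀ ^ 2 * (hzeta a ((2 * σ : ℝ) : ℂ)).re) +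
        c₀ ^ 2 * (secondTerm σ T₂ - secondTerm σ T₁) : ℝ) : ℂ) =
      (c₀ : ℂ) ^ 2 * (V - V') + (((T₂ - T₁) * (D - D') : ℝ) : ℂ) + E₁ + (c₀ : ℂ) ^ 2 * E₂ := by
    rw [hV']
    push_cast
    ring
  have hc2 : ‖(c₀ : ℂ) ^ 2‖ ≤ K ^ 2 := by
    rw [norm_pow, norm_real, Real.norm_eq_abs]
    gcongr
  have n3 : ‖(((T₂ - T₁) * (D - D') : ℝ) : ℂ)‖ ≤ 4 * C₂ * (T ^ (1 - σ) * Real.log T) := by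
    rw [norm_real, Real.norm_eq_abs, abs_mul, abs_of_nonneg (sub_nonneg.mpr hT₁₂)]
    calc _ ≤ (T₂ - T₁) * (C₂ * T ^ (-σ)) := by gcongr
      _ = C₂ * ((T₂ - T₁) * T ^ (-σ)) := by ring
      _ ≤ C₂ * (4 * (T ^ (1 - σ) * Real.log T)) := by gcongr
      _ = _ := by ring
  have n4 : ‖(c₀ : ℂ) ^ 2 * (V - V')‖ ≤ K ^ 2 * (C₁ * (T ^ (1 - σ) * Real.log T)) := by
    rw [norm_mul]
    gcongr
  have n5 : ‖(c₀ : ℂ) ^ 2 * E₂‖ ≤ K ^ 2 * (C₃ * C₄ * (T ^ (1 - σ) * Real.log T)) := by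
    rw [norm_mul]
    gcongr
  have n6 : 3 * K ^ 2 * C₃ * Λ ≤ 3 * K ^ 2 * C₃ * Λ * (T ^ (1 - σ) * Real.log T) :=
    le_mul_of_one_le_right (by positivity) hone
  rw [e]
  have t1 := norm_add_le ((c₀ : ℂ) ^ 2 * (V - V') + (((T₂ - T₁) * (D - D') : ℝ) : ℂ) + E₁)
    ((c₀ : ℂ) ^ 2 * E₂)
  have t2 := norm_add_le ((c₀ : ℂ) ^ 2 * (V - V') + (((T₂ - T₁) * (D - D') : ℝ) : ℂ)) E₁
  have t3 := norm_add_le ((c₀ : ℂ) ^ 2 * (V - V')) (((T₂ - T₁) * (D - D') : ℝ) : ℂ)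
  linarith

/-- A nonnegative smooth bump on `[-1/2, 1/2]` of total mass one. -/
structure IsBump (w : ℝ → ℝ) : Prop where
  isTest : IsTest fun θ => (w θ : ℂ)
  nonneg : ∀ θ, 0 ≤ w θ
  integral_eq : ∫ θ in (-1 / 2 : ℝ)..(1 / 2), w θ = 1

lemma IsBump.continuous {w : ℝ → ℝ} (hw : IsBump w) : Continuous w :=
  Complex.continuous_re.comp hw.isTest.continuous

lemma exists_isBump : ∃ w : ℝ → ℝ, IsBump w := by
  let f : ContDiffBump (0 : ℝ) := ⟨1 / 4, 1 / 2, by norm_num, by norm_num⟩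
  have hsupp : ∀ θ, θ ∉ Set.Icc (-1 / 2 : ℝ) (1 / 2) → f.normed volume θ = 0 := by
    intro θ hθ
    rw [← Function.notMem_support, f.support_normed_eq]
    intro h
    rw [Metric.mem_ball, Real.dist_eq, sub_zero, abs_lt] at h
    exact hθ ⟨by have := h.1; simp only [f] at this; linarith,
      by have := h.2; simp only [f] at this; linarith⟩
  refine ⟨f.normed volume, ⟨?_, ?_⟩, fun θ => f.nonneg_normed θ, ?_⟩
  · exact ofRealCLM.contDiff.comp f.contDiff_normed
  · intro θ hθ
    rw [hsupp θ hθ, ofReal_zero]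
  · rw [intervalIntegral.integral_of_le (by norm_num), ← integral_Icc_eq_integral_Ioc,
      setIntegral_eq_integral_of_forall_compl_eq_zero hsupp]
    exact f.integral_normed

lemma exists_isTest_eq_one : ∃ η : ℝ → ℂ, IsTest η ∧ ∀ θ, |θ| ≤ 1 / 4 → η θ = 1 := by
  let f : ContDiffBump (0 : ℝ) := ⟨1 / 4, 1 / 2, by norm_num, by norm_num⟩
  refine ⟨fun θ => (f θ : ℂ), ⟨ofRealCLM.contDiff.comp f.contDiff, fun θ hθ => ?_⟩, fun θ hθ => ?_⟩
  · have : f θ = 0 := by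
      refine f.zero_of_le_dist ?_
      rw [Real.dist_eq, sub_zero]
      by_contra! h
      rw [abs_lt] at h
      exact hθ ⟨by have := h.1; simp only [f] at this; linarith,
        by have := h.2; simp only [f] at this; linarith⟩
    rw [this, ofReal_zero]
  · have : f θ = 1 := f.one_of_mem_closedBall (by simpa [f, Real.dist_eq] using hθ)
    simp only [this, ofReal_one]

/-- The smooth cutoff at height `N` built from the bump `w`. -/
noncomputable def cut (w : ℝ → ℝ) (N x : ℝ) : ℝ :=
  ∫ θ in (-1 / 2 : ℝ)..(1 / 2), w θ * (if x ≤ N * Real.exp θ then 1 else 0)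

lemma intervalIntegrable_cut {w : ℝ → ℝ} (hw : IsBump w) (N x : ℝ) :
    IntervalIntegrable (fun θ => w θ * (if x ≤ N * Real.exp θ then 1 else 0)) volume
      (-1 / 2) (1 / 2) := by
  have h : IntervalIntegrable w volume (-1 / 2) (1 / 2) := hw.continuous.intervalIntegrable _ _
  refine h.mono_fun (AEStronglyMeasurable.mul hw.continuous.aestronglyMeasurable ?_) ?_
  · refine (Measurable.ite ?_ measurable_const measurable_const).aestronglyMeasurable
    exact measurableSet_le measurable_const (Real.measurable_exp.const_mul N)
  · refine Eventually.of_forall fun θ => ?_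
    simp only
    split_ifs <;> simp

lemma cut_nonneg {w : ℝ → ℝ} (hw : IsBump w) (N x : ℝ) : 0 ≤ cut w N x := by
  refine intervalIntegral.integral_nonneg (by norm_num) fun θ _ => mul_nonneg (hw.nonneg θ) ?_
  split_ifs <;> norm_num

lemma cut_le_one {w : ℝ → ℝ} (hw : IsBump w) (N x : ℝ) : cut w N x ≤ 1 := by
  rw [← hw.integral_eq]
  refine intervalIntegral.integral_mono_on (by norm_num) (intervalIntegrable_cut hw N x)
    (hw.continuous.intervalIntegrable _ _) fun θ _ => mul_le_of_le_one_right (hw.nonneg θ) ?_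
  split_ifs <;> norm_num

lemma cut_eq_one {w : ℝ → ℝ} (hw : IsBump w) {N x : ℝ} (hN : 0 ≤ N)
    (h : x ≤ N * Real.exp (-1 / 2)) : cut w N x = 1 := by
  rw [← hw.integral_eq]
  refine intervalIntegral.integral_congr fun θ hθ => ?_
  rw [Set.uIcc_of_le (by norm_num)] at hθ
  rw [if_pos (h.trans (by gcongr; exact hθ.1)), mul_one]

lemma cut_eq_zero {w : ℝ → ℝ} {N x : ℝ} (hN : 0 ≤ N)
    (h : N * Real.exp (1 / 2) < x) : cut w N x = 0 := by
  rw [cut]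
  refine (intervalIntegral.integral_congr (g := fun _ => 0) fun θ hθ => ?_).trans (by simp)
  rw [Set.uIcc_of_le (by norm_num)] at hθ
  rw [if_neg, mul_zero]
  intro h2
  have : N * Real.exp θ ≤ N * Real.exp (1 / 2) := by gcongr; exact hθ.2
  linarith

lemma norm_cpow_div_sub_le {x y : ℝ} {s : ℂ} (hx : 0 < x) (hxy : x ≤ y) (hs : s ≠ 1)
    (hs0 : 0 ≤ s.re) :
    ‖(y : ℂ) ^ (1 - s) / (1 - s) - (x : ℂ) ^ (1 - s) / (1 - s)‖ ≤ x ^ (-s.re) * (y - x) := by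
  have hd : ∀ u ∈ Set.Icc x y, HasDerivWithinAt (fun u : ℝ => (u : ℂ) ^ (1 - s) / (1 - s))
      ((u : ℂ) ^ (-s)) (Set.Icc x y) u := by
    intro u hu
    have := hasDerivAt_ofReal_cpow_const' (x := u) (r := -s) (hx.trans_le hu.1).ne'
      (fun h => hs (neg_injective h))
    rw [show -s + 1 = 1 - s by ring] at this
    exact this.hasDerivWithinAt
  have h := Convex.norm_image_sub_le_of_norm_hasDerivWithin_le (C := x ^ (-s.re)) hd
    (fun u hu => by
      rw [norm_cpow_eq_rpow_re_of_pos (hx.trans_le hu.1), neg_re]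
      exact Real.rpow_le_rpow_of_nonpos hx hu.1 (by linarith))
    (convex_Icc x y) (Set.left_mem_Icc.mpr hxy) (Set.right_mem_Icc.mpr hxy)
  rwa [Real.norm_eq_abs, abs_of_nonneg (sub_nonneg.mpr hxy)] at h

lemma norm_sum_ite_sub_le {a x : ℝ} {s : ℂ} (ha : 0 < a) (ha1 : a ≤ 1) (hx : 1 ≤ x)
    (hs : 1 / 2 ≤ s.re) (hs1 : s ≠ 1) {B : ℕ} (hB : x + 1 ≤ B) :
    ‖∑ m ∈ range B, (if (m : ℝ) + a ≤ x then ((m + a : ℝ) : ℂ) ^ (-s) else 0) - hzeta a s -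
      (x : ℂ) ^ (1 - s) / (1 - s)‖ ≤ (3 * ‖s‖ + 1) * x ^ (-(1 / 2) : ℝ) := by
  have hx0 : 0 < x := by linarith
  set M := ⌊x - a⌋₊ + 1 with hM
  have hxa : 0 ≤ x - a := by linarith
  have hM1 : x < M + a := by
    have := Nat.lt_floor_add_one (x - a)
    rw [hM]; push_cast; linarith
  have hM2 : M + a ≤ x + 1 := by
    have := Nat.floor_le hxa
    rw [hM]; push_cast; linarith
  have hMB : M ≤ B := by
    have : (M : ℝ) ≤ B := by linarith
    exact_mod_cast this
  have hf : (range B).filter (fun m : ℕ => (m : ℝ) + a ≤ x) = range M := by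
    ext m
    rw [mem_filter, mem_range, mem_range, hM, Nat.lt_succ_iff, Nat.le_floor_iff hxa]
    constructor
    · rintro ⟨_, h⟩; linarith
    · intro h
      refine ⟨?_, by linarith⟩
      have : (m : ℝ) < B := by linarith
      exact_mod_cast this
  rw [← sum_filter, hf]
  have h1 := norm_sum_sub_hzeta_le ha ha1 (by linarith : 0 < s.re) hs1 M
  have h2 := norm_cpow_div_sub_le hx0 hM1.le hs1 (by linarith)
  have hxs : x ^ (-s.re) ≤ x ^ (-(1 / 2) : ℝ) :=
    Real.rpow_le_rpow_of_exponent_le hx (by linarith)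
  have h3 : ((M : ℝ) + a) ^ (-s.re - 1) ≤ x ^ (-(1 / 2) : ℝ) :=
    (Real.rpow_le_rpow_of_nonpos hx0 hM1.le (by linarith)).trans
      (Real.rpow_le_rpow_of_exponent_le hx (by linarith))
  have h4 : ((M : ℝ) + a) ^ (-s.re) ≤ x ^ (-(1 / 2) : ℝ) :=
    (Real.rpow_le_rpow_of_nonpos hx0 hM1.le (by linarith)).trans hxs
  have h5 : ((M : ℝ) + a) ^ (-s.re) / s.re ≤ 2 * x ^ (-(1 / 2) : ℝ) := by
    rw [div_le_iff₀ (by linarith)]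
    have : 0 ≤ ((M : ℝ) + a) ^ (-s.re) := by positivity
    nlinarith [Real.rpow_nonneg hx0.le (-(1 / 2) : ℝ)]
  have h6 : x ^ (-s.re) * (M + a - x) ≤ x ^ (-(1 / 2) : ℝ) := by
    have : 0 ≤ x ^ (-s.re) := by positivity
    nlinarith
  have h7 : ‖s‖ * (((M : ℝ) + a) ^ (-s.re - 1) + ((M : ℝ) + a) ^ (-s.re) / s.re) ≤
      ‖s‖ * (3 * x ^ (-(1 / 2) : ℝ)) := by
    gcongr
    linarith
  calc _ = ‖(∑ m ∈ range M, ((m + a : ℝ) : ℂ) ^ (-s) - hzeta a s -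
        ((M + a : ℝ) : ℂ) ^ (1 - s) / (1 - s)) + (((M + a : ℝ) : ℂ) ^ (1 - s) / (1 - s) -
        (x : ℂ) ^ (1 - s) / (1 - s))‖ := by congr 1; ring
    _ ≤ _ := by
        refine (norm_add_le _ _).trans ?_
        linarith

lemma norm_sum_cut_sub_le {a N : ℝ} {s : ℂ} {w : ℝ → ℝ} (hw : IsBump w) (ha : 0 < a)
    (ha1 : a ≤ 1) (hN : 2 ≤ N) (hs : 1 / 2 ≤ s.re) (hs1 : s ≠ 1) {B : ℕ}
    (hB : N * Real.exp (1 / 2) + 1 ≤ B) :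
    ‖∑ m ∈ range B, (cut w N (m + a) : ℂ) * ((m + a : ℝ) : ℂ) ^ (-s) - hzeta a s‖ ≤
      (3 * ‖s‖ + 1) * (N / 2) ^ (-(1 / 2) : ℝ) + N ^ (1 - s.re) / ‖1 - s‖ *
        ‖osc (fun θ => (Real.exp ((1 - s.re) * θ) : ℂ) * w θ) (-s.im) 0‖ := by
  have hN0 : 0 < N := by linarith
  have hexp : 1 / 2 ≤ Real.exp (-1 / 2) := by
    have := Real.add_one_le_exp (-1 / 2 : ℝ); linarith
  have hcw : Continuous fun θ => (w θ : ℂ) := hw.isTest.continuous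
  set F : ℝ → ℂ := fun θ => ∑ m ∈ range B,
    (if (m : ℝ) + a ≤ N * Real.exp θ then ((m + a : ℝ) : ℂ) ^ (-s) else 0) with hF
  set P : ℝ → ℂ := fun θ => ((N * Real.exp θ : ℝ) : ℂ) ^ (1 - s) / (1 - s) with hP
  have hPc : Continuous P := by
    refine Continuous.div_const ?_ _
    refine Continuous.cpow (by fun_prop) continuous_const fun θ => ?_
    exact ofReal_mem_slitPlane.mpr (by positivity)
  have hterm : ∀ m : ℕ, ∀ θ, (w θ : ℂ) *
      (if (m : ℝ) + a ≤ N * Real.exp θ then ((m + a : ℝ) : ℂ) ^ (-s) else 0) =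
      ((w θ * (if (m : ℝ) + a ≤ N * Real.exp θ then 1 else 0) : ℝ) : ℂ) *
        ((m + a : ℝ) : ℂ) ^ (-s) := by
    intro m θ
    split_ifs <;> simp
  have hqi : ∀ m : ℕ, IntervalIntegrable (fun θ => (w θ : ℂ) *
      (if (m : ℝ) + a ≤ N * Real.exp θ then ((m + a : ℝ) : ℂ) ^ (-s) else 0)) volume
      (-1 / 2) (1 / 2) := by
    intro m
    simp only [hterm]
    have h := intervalIntegrable_cut hw N (m + a)
    exact IntervalIntegrable.mul_const ⟨h.1.ofReal, h.2.ofReal⟩ _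
  have hFi : IntervalIntegrable (fun θ => (w θ : ℂ) * F θ) volume (-1 / 2) (1 / 2) := by
    simp only [hF, mul_sum]
    rw [← Finset.sum_fn]
    exact IntervalIntegrable.sum (range B) fun m _ => hqi m
  have e1 : ∑ m ∈ range B, (cut w N (m + a) : ℂ) * ((m + a : ℝ) : ℂ) ^ (-s) =
      ∫ θ in (-1 / 2 : ℝ)..(1 / 2), (w θ : ℂ) * F θ := by
    simp only [hF, mul_sum]
    rw [intervalIntegral.integral_finsetSum fun m _ => hqi m]
    refine sum_congr rfl fun m _ => ?_
    simp only [hterm]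
    rw [intervalIntegral.integral_mul_const, intervalIntegral.integral_ofReal, cut]
  have e2 : hzeta a s = ∫ θ in (-1 / 2 : ℝ)..(1 / 2), (w θ : ℂ) * hzeta a s := by
    rw [intervalIntegral.integral_mul_const, intervalIntegral.integral_ofReal, hw.integral_eq,
      ofReal_one, one_mul]
  have e3 : ∫ θ in (-1 / 2 : ℝ)..(1 / 2), (w θ : ℂ) * P θ =
      (N : ℂ) ^ (1 - s) / (1 - s) *
        osc (fun θ => (Real.exp ((1 - s.re) * θ) : ℂ) * w θ) (-s.im) 0 := by
    rw [osc, ← intervalIntegral.integral_const_mul]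
    refine intervalIntegral.integral_congr fun θ _ => ?_
    simp only [hP, phase]
    rw [ofReal_mul, mul_cpow_ofReal_nonneg hN0.le (Real.exp_pos θ).le]
    have : ((Real.exp θ : ℝ) : ℂ) ^ (1 - s) =
        (Real.exp ((1 - s.re) * θ) : ℂ) * cexp (((-s.im * θ - 0 * Real.exp θ : ℝ) : ℂ) * I) := by
      rw [cpow_def_of_ne_zero (by simp), ← ofReal_log (Real.exp_pos θ).le, Real.log_exp,
        ofReal_exp, ← Complex.exp_add]
      congr 1
      conv_lhs => rw [← re_add_im s]
      push_cast
      ring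
    rw [this]
    ring
  have e4 : ∑ m ∈ range B, (cut w N (m + a) : ℂ) * ((m + a : ℝ) : ℂ) ^ (-s) - hzeta a s =
      (∫ θ in (-1 / 2 : ℝ)..(1 / 2), (w θ : ℂ) * (F θ - hzeta a s - P θ)) +
        ∫ θ in (-1 / 2 : ℝ)..(1 / 2), (w θ : ℂ) * P θ := by
    rw [e1]
    conv_lhs => rw [e2]
    simp only [mul_sub]
    rw [intervalIntegral.integral_sub, intervalIntegral.integral_sub, sub_add_cancel]
    · exact hFi
    · exact (hcw.mul continuous_const).intervalIntegrable _ _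
    · exact hFi.sub ((hcw.mul continuous_const).intervalIntegrable _ _)
    · exact (hcw.mul hPc).intervalIntegrable _ _
  rw [e4]
  refine (norm_add_le _ _).trans (add_le_add ?_ ?_)
  · have hb : ∀ θ ∈ Set.Ioc (-1 / 2 : ℝ) (1 / 2), ‖(w θ : ℂ) * (F θ - hzeta a s - P θ)‖ ≤
        w θ * ((3 * ‖s‖ + 1) * (N / 2) ^ (-(1 / 2) : ℝ)) := by
      intro θ hθ
      rw [norm_mul, norm_real, Real.norm_eq_abs, abs_of_nonneg (hw.nonneg θ)]
      refine mul_le_mul_of_nonneg_left ?_ (hw.nonneg θ)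
      have hx : N / 2 ≤ N * Real.exp θ := by
        have : Real.exp (-1 / 2) ≤ Real.exp θ := Real.exp_le_exp.mpr hθ.1.le
        nlinarith
      have hx2 : N * Real.exp θ + 1 ≤ B := by
        refine le_trans ?_ hB
        gcongr
        exact hθ.2
      refine (norm_sum_ite_sub_le ha ha1 (by linarith) hs hs1 hx2).trans ?_
      gcongr ?_ * ?_
      exact Real.rpow_le_rpow_of_nonpos (by linarith) hx (by norm_num)
    refine (intervalIntegral.norm_integral_le_of_norm_le (by norm_num)
      (Eventually.of_forall hb) ((hw.continuous.mul continuous_const).intervalIntegrable _ _)).trans ?_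
    rw [intervalIntegral.integral_mul_const, hw.integral_eq, one_mul]
  · rw [e3, norm_mul, norm_div, norm_cpow_eq_rpow_re_of_pos hN0]
    simp

/-- The Dirichlet polynomial `∑_{m < B} c m (m + a)^{-(σ + it)}`. -/
noncomputable def dirPoly (a σ : ℝ) (c : ℕ → ℝ) (B : ℕ) (t : ℝ) : ℂ :=
  ∑ m ∈ range B, (c m : ℂ) * ((m + a : ℝ) : ℂ) ^ (-((σ : ℂ) + t * I))

/-- The boundary contribution of the pairs with well separated frequencies. -/
noncomputable def farSum (a σ : ℝ) (η : ℝ → ℂ) (c c' : ℕ → ℝ) (B B' : ℕ) (τ : ℝ) : ℂ :=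
  ∑ m ∈ range B, ∑ n ∈ range B',
    ((c m * c' n * (((m : ℝ) + a) ^ (-σ) * ((n : ℝ) + a) ^ (-σ)) : ℝ) : ℂ) *
      ((1 - η (Real.log ((n + a) / (m + a)))) *
        (cexp (((τ * Real.log ((n + a) / (m + a)) : ℝ) : ℂ) * I) /
          ((Real.log ((n + a) / (m + a)) : ℝ) * I)))

lemma ofReal_cpow_neg_line {x : ℝ} (hx : 0 < x) (σ t : ℝ) :
    (x : ℂ) ^ (-((σ : ℂ) + t * I)) =
      ((x ^ (-σ) : ℝ) : ℂ) * cexp (((-(t * Real.log x) : ℝ) : ℂ) * I) := by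
  rw [cpow_def_of_ne_zero (by simpa using hx.ne'), Real.rpow_def_of_pos hx, ofReal_exp,
    ← Complex.exp_add, ← ofReal_log hx.le]
  congr 1
  push_cast
  ring

lemma continuous_dirPoly {a : ℝ} (ha : 0 < a) (σ : ℝ) (c : ℕ → ℝ) (B : ℕ) :
    Continuous (dirPoly a σ c B) := by
  unfold dirPoly
  refine continuous_finsetSum _ fun m _ => continuous_const.mul ?_
  have hm : 0 < (m : ℝ) + a := by positivity
  simp only [ofReal_cpow_neg_line hm]
  fun_prop

lemma continuous_farSum (a σ : ℝ) (η : ℝ → ℂ) (c c' : ℕ → ℝ) (B B' : ℕ) :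
    Continuous (farSum a σ η c c' B B') := by
  unfold farSum
  fun_prop

lemma dirPoly_mul_conj {a : ℝ} (ha : 0 < a) (σ : ℝ) (c c' : ℕ → ℝ) (B B' : ℕ) (t : ℝ) :
    dirPoly a σ c B t * (starRingEnd ℂ) (dirPoly a σ c' B' t) =
      ∑ m ∈ range B, ∑ n ∈ range B',
        ((c m * c' n * (((m : ℝ) + a) ^ (-σ) * ((n : ℝ) + a) ^ (-σ)) : ℝ) : ℂ) *
          cexp (((t * Real.log ((n + a) / (m + a)) : ℝ) : ℂ) * I) := by
  rw [dirPoly, dirPoly, map_sum, sum_mul_sum]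
  refine sum_congr rfl fun m _ => sum_congr rfl fun n _ => ?_
  have hm : 0 < (m : ℝ) + a := by positivity
  have hn : 0 < (n : ℝ) + a := by positivity
  rw [ofReal_cpow_neg_line hm, ofReal_cpow_neg_line hn, map_mul, map_mul, conj_ofReal,
    conj_ofReal, ← exp_conj, map_mul, conj_ofReal, conj_I, Real.log_div hn.ne' hm.ne']
  have : ((t * (Real.log (n + a) - Real.log (m + a)) : ℝ) : ℂ) * I =
      ((-(t * Real.log (m + a)) : ℝ) : ℂ) * I + ((-(t * Real.log (n + a)) : ℝ) : ℂ) * -I := by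
    push_cast; ring
  rw [this, Complex.exp_add]
  push_cast
  ring

lemma integral_dirPoly_mul_conj {a : ℝ} (ha : 0 < a) (σ : ℝ) {η : ℝ → ℂ} (hη0 : η 0 = 1)
    (c c' : ℕ → ℝ) (B B' : ℕ) (T₁ T₂ : ℝ) :
    ∫ t in T₁..T₂, dirPoly a σ c B t * (starRingEnd ℂ) (dirPoly a σ c' B' t) =
      ∑ m ∈ range B, ∑ n ∈ range B', ((c m * c' n : ℝ) : ℂ) * kern a σ η T₁ T₂ m n +
        (farSum a σ η c c' B B' T₂ - farSum a σ η c c' B B' T₁) := by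
  simp only [dirPoly_mul_conj ha]
  rw [intervalIntegral.integral_finsetSum fun m _ => by
    apply Continuous.intervalIntegrable; fun_prop]
  rw [farSum, farSum, ← sum_sub_distrib, ← sum_add_distrib]
  refine sum_congr rfl fun m _ => ?_
  rw [intervalIntegral.integral_finsetSum fun m _ => by
    apply Continuous.intervalIntegrable; fun_prop]
  rw [← sum_sub_distrib, ← sum_add_distrib]
  refine sum_congr rfl fun n _ => ?_
  rw [intervalIntegral.integral_const_mul, kern]
  set θ := Real.log ((n + a) / (m + a)) with hθ
  rcases eq_or_ne θ 0 with h0 | h0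
  · rw [h0, hη0]
    push_cast
    ring
  · have hc : (θ : ℂ) * I ≠ 0 := mul_ne_zero (ofReal_ne_zero.mpr h0) I_ne_zero
    have e : ∀ t : ℝ, cexp (((t * θ : ℝ) : ℂ) * I) = cexp (θ * I * t) := fun t => by
      congr 1; push_cast; ring
    simp only [e]
    rw [integral_exp_mul_complex hc]
    push_cast
    ring

lemma norm_integral_bump_mul_farSum_le {a σ H K C : ℝ} {w : ℝ → ℝ} (hw : IsBump w) (ha : 0 < a)
    (hσ : 0 ≤ σ) {η : ℝ → ℂ} (hη : ∀ θ, |θ| ≤ 1 / 4 → η θ = 1) (hH : ∀ θ, ‖η θ‖ ≤ H)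
    {c c' : ℕ → ℝ} (hc : ∀ m, |c m| ≤ K) (hc' : ∀ m, |c' m| ≤ K) (j : ℕ) (hC : 0 ≤ C)
    (hosc : ∀ t : ℝ, t ≠ 0 → ‖osc (fun θ => (w θ : ℂ)) t 0‖ ≤ C / |t| ^ j)
    (B B' : ℕ) (τ : ℝ) {Δ : ℝ} (hΔ : 0 < Δ) :
    ‖∫ y in (-1 / 2 : ℝ)..(1 / 2), (w y : ℂ) * farSum a σ η c c' B B' (τ + Δ * y)‖ ≤
      B * B' * (K ^ 2 * (a ^ (-σ)) ^ 2 * (4 * (1 + H) * (C * 4 ^ j / Δ ^ j))) := by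
  have hK0 : 0 ≤ K := (abs_nonneg _).trans (hc 0)
  have hH0 : 0 ≤ H := (norm_nonneg _).trans (hH 0)
  have hcw : Continuous fun θ => (w θ : ℂ) := hw.isTest.continuous
  simp only [farSum, mul_sum]
  rw [intervalIntegral.integral_finsetSum fun m _ => by
    apply Continuous.intervalIntegrable; fun_prop]
  have hinner : ∀ m n : ℕ, ‖∫ y in (-1 / 2 : ℝ)..(1 / 2), (w y : ℂ) *
      (((c m * c' n * (((m : ℝ) + a) ^ (-σ) * ((n : ℝ) + a) ^ (-σ)) : ℝ) : ℂ) *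
      ((1 - η (Real.log ((n + a) / (m + a)))) *
        (cexp ((((τ + Δ * y) * Real.log ((n + a) / (m + a)) : ℝ) : ℂ) * I) /
          ((Real.log ((n + a) / (m + a)) : ℝ) * I))))‖ ≤
      K ^ 2 * (a ^ (-σ)) ^ 2 * (4 * (1 + H) * (C * 4 ^ j / Δ ^ j)) := by
    intro m n
    have hm : 0 < (m : ℝ) + a := by positivity
    have hn : 0 < (n : ℝ) + a := by positivity
    set θ := Real.log ((n + a) / (m + a)) with hθ
    rcases le_or_gt |θ| (1 / 4) with h | h
    · rw [hη θ h]
      simp only [sub_self, zero_mul, mul_zero, intervalIntegral.integral_zero, norm_zero]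
      positivity
    · have hθ0 : θ ≠ 0 := by
        intro h0; rw [h0, abs_zero] at h; linarith
      have e : ∀ y : ℝ, (w y : ℂ) *
          (((c m * c' n * (((m : ℝ) + a) ^ (-σ) * ((n : ℝ) + a) ^ (-σ)) : ℝ) : ℂ) *
          ((1 - η θ) * (cexp ((((τ + Δ * y) * θ : ℝ) : ℂ) * I) / ((θ : ℝ) * I)))) =
          ((c m * c' n * (((m : ℝ) + a) ^ (-σ) * ((n : ℝ) + a) ^ (-σ)) : ℝ) : ℂ) *
          ((1 - η θ) * (cexp (((τ * θ : ℝ) : ℂ) * I) / ((θ : ℝ) * I))) *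
          ((w y : ℂ) * phase (Δ * θ) 0 y) := by
        intro y
        have : (((τ + Δ * y) * θ : ℝ) : ℂ) * I = ((τ * θ : ℝ) : ℂ) * I +
            ((Δ * θ * y - 0 * Real.exp y : ℝ) : ℂ) * I := by push_cast; ring
        rw [this, Complex.exp_add, phase]
        ring
      simp only [e]
      rw [intervalIntegral.integral_const_mul, norm_mul]
      have h1 : ‖∫ y in (-1 / 2 : ℝ)..(1 / 2), (w y : ℂ) * phase (Δ * θ) 0 y‖ ≤
          C * 4 ^ j / Δ ^ j := by
        refine (hosc (Δ * θ) (mul_ne_zero hΔ.ne' hθ0)).trans ?_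
        rw [abs_mul, abs_of_pos hΔ, mul_pow, div_le_div_iff₀ (by positivity) (by positivity)]
        have h4 : 1 ≤ (4 * |θ|) ^ j := one_le_pow₀ (by linarith)
        rw [mul_pow] at h4
        have : 0 ≤ C * Δ ^ j := by positivity
        nlinarith
      have h2 : ‖((c m * c' n * (((m : ℝ) + a) ^ (-σ) * ((n : ℝ) + a) ^ (-σ)) : ℝ) : ℂ)‖ ≤
          K ^ 2 * (a ^ (-σ)) ^ 2 := by
        rw [norm_real, Real.norm_eq_abs, abs_mul, abs_mul, sq, sq, abs_mul,
          abs_of_nonneg (Real.rpow_nonneg hm.le _), abs_of_nonneg (Real.rpow_nonneg hn.le _)]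
        have hmp : ∀ k : ℕ, ((k : ℝ) + a) ^ (-σ) ≤ a ^ (-σ) := fun k =>
          Real.rpow_le_rpow_of_nonpos ha (by linarith [k.cast_nonneg (α := ℝ)]) (by linarith)
        exact mul_le_mul (mul_le_mul (hc m) (hc' n) (abs_nonneg _) hK0)
          (mul_le_mul (hmp m) (hmp n) (by positivity) (by positivity)) (by positivity)
          (by positivity)
      have h3 : ‖(1 - η θ) * (cexp (((τ * θ : ℝ) : ℂ) * I) / ((θ : ℝ) * I))‖ ≤ 4 * (1 + H) := by
        rw [norm_mul, norm_div, norm_exp_ofReal_mul_I, norm_mul, norm_I, mul_one, norm_real,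
          Real.norm_eq_abs]
        have h5 : ‖1 - η θ‖ ≤ 1 + H := by
          refine (norm_sub_le _ _).trans ?_
          rw [norm_one]
          linarith [hH θ]
        have h6 : 1 / |θ| ≤ 4 := by
          rw [div_le_iff₀ (by linarith)]; linarith
        calc _ ≤ (1 + H) * 4 := by gcongr
          _ = _ := by ring
      rw [norm_mul]
      calc _ ≤ (K ^ 2 * (a ^ (-σ)) ^ 2) * (4 * (1 + H)) * (C * 4 ^ j / Δ ^ j) := by gcongr
        _ = _ := by ring
  refine (norm_sum_le _ _).trans ?_
  rw [mul_assoc]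
  refine (sum_le_card_nsmul (range B) _ (B' *
    (K ^ 2 * (a ^ (-σ)) ^ 2 * (4 * (1 + H) * (C * 4 ^ j / Δ ^ j)))) fun m _ => ?_).trans_eq
    (by rw [card_range, nsmul_eq_mul])
  rw [intervalIntegral.integral_finsetSum fun m _ => by
    apply Continuous.intervalIntegrable; fun_prop]
  refine (norm_sum_le _ _).trans ?_
  exact (sum_le_card_nsmul (range B') _ _ fun n _ => hinner m n).trans_eq
    (by rw [card_range, nsmul_eq_mul])

/-- `f` is approximated by the smoothly truncated Dirichlet series `∑ c m (m + a)^{-(σ + it)}`. -/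
structure HasCutApprox (a σ : ℝ) (c : ℕ → ℝ) (w : ℝ → ℝ) (f : ℝ → ℂ) : Prop where
  continuousOn : ContinuousOn f (Set.Ioi 0)
  approx : ∃ C, 0 < C ∧ ∀ T N t : ℝ, 2000 ≤ T → T ^ 6 ≤ N → N ≤ 8 * T ^ 6 → T / 2 ≤ t → t ≤ 4 * T →
    ∀ B : ℕ, N * Real.exp (1 / 2) + 1 ≤ B →
      ‖dirPoly a σ (fun m => cut w N (m + a) * c m) B t - f t‖ ≤ C / T ^ 2 ∧ ‖f t‖ ≤ C * T

lemma norm_mul_conj_sub_le {z z' u : ℂ} {C T : ℝ} (hC : 0 < C) (hT : 1 ≤ T)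
    (hz : ‖z - u‖ ≤ C / T ^ 2) (hz' : ‖z' - u‖ ≤ C / T ^ 2) (hu : ‖u‖ ≤ C * T) :
    ‖u * (starRingEnd ℂ) u - z * (starRingEnd ℂ) z'‖ ≤ 3 * C ^ 2 / T := by
  have hT0 : 0 < T := by linarith
  have e : u * (starRingEnd ℂ) u - z * (starRingEnd ℂ) z' =
      -((z - u) * (starRingEnd ℂ) u) - (z - u) * (starRingEnd ℂ) (z' - u)
        - u * (starRingEnd ℂ) (z' - u) := by
    rw [map_sub]; ring
  have h1 : C / T ^ 2 * (C * T) = C ^ 2 / T := by field_simp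
  have h2 : C / T ^ 2 * (C / T ^ 2) ≤ C ^ 2 / T := by
    rw [← h1]
    gcongr
    exact (div_le_self hC.le (one_le_pow₀ hT)).trans (le_mul_of_one_le_right hC.le hT)
  have k1 : ‖(z - u) * (starRingEnd ℂ) u‖ ≤ C / T ^ 2 * (C * T) := by
    rw [norm_mul, RCLike.norm_conj]; gcongr
  have k2 : ‖(z - u) * (starRingEnd ℂ) (z' - u)‖ ≤ C / T ^ 2 * (C / T ^ 2) := by
    rw [norm_mul, RCLike.norm_conj]; gcongr
  have k3 : ‖u * (starRingEnd ℂ) (z' - u)‖ ≤ C / T ^ 2 * (C * T) := by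
    rw [norm_mul, RCLike.norm_conj, mul_comm]; gcongr
  rw [e]
  have t1 := norm_sub_le (-((z - u) * (starRingEnd ℂ) u) - (z - u) * (starRingEnd ℂ) (z' - u))
    (u * (starRingEnd ℂ) (z' - u))
  have t2 := norm_sub_le (-((z - u) * (starRingEnd ℂ) u)) ((z - u) * (starRingEnd ℂ) (z' - u))
  rw [norm_neg] at t2
  have e3 : 3 * C ^ 2 / T = C ^ 2 / T + C ^ 2 / T + C ^ 2 / T := by ring
  linarith

lemma exp_half_bounds : 1 / 2 ≤ Real.exp (-1 / 2) := by
  have := Real.add_one_le_exp (-1 / 2 : ℝ); linarith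

lemma cut_mul_cut_mul_kern {a N σ : ℝ} {w : ℝ → ℝ} (hw : IsBump w) (ha : 0 < a) (hN : 0 < N)
    {η : ℝ → ℂ} (hη : IsTest η) (T₁ T₂ : ℝ) (c : ℕ → ℝ) (m n : ℕ) :
    ((cut w N (m + a) * c m * (cut w (8 * N) (n + a) * c n) : ℝ) : ℂ) * kern a σ η T₁ T₂ m n =
      ((cut w N (m + a) * c m * c n : ℝ) : ℂ) * kern a σ η T₁ T₂ m n := by
  have hm : 0 < (m : ℝ) + a := by positivity
  have hn : 0 < (n : ℝ) + a := by positivity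
  have he2 := exp_half_lt_two
  have he := exp_half_bounds
  rcases lt_or_ge (N * Real.exp (1 / 2)) (m + a) with h | h
  · rw [cut_eq_zero hN.le h]; simp
  rcases le_or_gt (2 * ((m : ℝ) + a)) (n + a) with h2 | h2
  · rw [kern, test_log_eq_zero hη hm hn (Or.inl h2)]
    simp
  · rw [cut_eq_one hw (x := n + a) (by positivity) (by nlinarith), one_mul]

set_option maxHeartbeats 800000 in
theorem exists_local_mean_square {a σ K c₀ : ℝ} {c : ℕ → ℝ} {w : ℝ → ℝ} {f : ℝ → ℂ}
    (hw : IsBump w) (ha : 0 < a) (ha1 : a ≤ 1)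
    (hσ : 1 / 2 < σ) (hσ1 : σ < 1) (hK : ∀ m, |c m| ≤ K) (hK₀ : |c₀| ≤ K)
    (hc : ∀ m, |c m - c₀| ≤ K / (m + a)) (hf : HasCutApprox a σ c w f) :
    ∃ C, 0 < C ∧ ∀ T : ℝ, 2000 ≤ T → ∃ φ : ℝ → ℝ, Continuous φ ∧
      (∀ τ, |∫ y in (-1 / 2 : ℝ)..(1 / 2), w y * φ (τ + T ^ (1 - σ) * y)| ≤ C) ∧
      ∀ T₁ T₂, T / 2 ≤ T₁ → T₁ ≤ T₂ → T₂ ≤ 4 * T →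
        |(∫ t in T₁..T₂, ‖f t‖ ^ 2) -
          ((T₂ - T₁) * ∑' m : ℕ, c m ^ 2 * ((m : ℝ) + a) ^ (-(2 * σ)) +
            c₀ ^ 2 * (secondTerm σ T₂ - secondTerm σ T₁)) - (φ T₂ - φ T₁)| ≤
          C * (T ^ (1 - σ) * Real.log T) := by
  have hK0 : 0 ≤ K := (abs_nonneg _).trans hK₀
  obtain ⟨η, hη, hη1⟩ := exists_isTest_eq_one
  have hη0 : η 0 = 1 := hη1 0 (by norm_num)
  obtain ⟨H, hH0, hH⟩ := hη.bounded
  obtain ⟨C₁, hC₁, b₁⟩ := exists_norm_near_sub_le ha ha1 hσ hσ1 hK hK₀ hc hη hη0 7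
  obtain ⟨C₂, hC₂, b₂⟩ := hf.approx
  set j := ⌈14 / (1 - σ)⌉₊ with hj
  obtain ⟨C₃, hC₃, b₃⟩ := exists_norm_osc_zero_le hw.isTest j
  refine ⟨C₁ + 12 * C₂ ^ 2 + K ^ 2 * (a ^ (-σ)) ^ 2 * (4 * (1 + H) * (C₃ * 4 ^ j)), by positivity, ?_⟩
  have hcoef : ∀ N m, |cut w N ((m : ℕ) + a) * c m| ≤ K := fun N m => by
    rw [abs_mul, abs_of_nonneg (cut_nonneg hw _ _)]
    exact (mul_le_of_le_one_left (abs_nonneg _) (cut_le_one hw _ _)).trans (hK m)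
  intro T hT
  have hT0 : 0 < T := by linarith
  have hT1 : 1 ≤ T := by linarith
  have he2 := exp_half_lt_two
  have he := exp_half_bounds
  set N := T ^ 6 with hN
  have hT5 : 2000 ≤ T ^ 5 := hT.trans (le_self_pow₀ hT1 (by norm_num))
  have hNT : 2000 * T ≤ N := by
    rw [hN, pow_succ T 5]; gcongr
  have hN0 : 0 < N := by positivity
  have hN7 : T ^ 7 = N * T := by rw [hN]; ring
  set B := ⌈N * Real.exp (1 / 2) + 1⌉₊ with hB
  set B' := ⌈8 * N * Real.exp (1 / 2) + 1⌉₊ with hB'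
  have hB1 : N * Real.exp (1 / 2) + 1 ≤ B := Nat.le_ceil _
  have hB1' : 8 * N * Real.exp (1 / 2) + 1 ≤ B' := Nat.le_ceil _
  have hB2 : (B : ℝ) < N * Real.exp (1 / 2) + 1 + 1 := Nat.ceil_lt_add_one (by positivity)
  have hB2' : (B' : ℝ) < 8 * N * Real.exp (1 / 2) + 1 + 1 := Nat.ceil_lt_add_one (by positivity)
  have he1 : 1 ≤ Real.exp (1 / 2) := Real.one_le_exp (by norm_num)
  have hBT : (B : ℝ) ≤ T ^ 7 := by rw [hN7]; nlinarith
  have hBT' : (B' : ℝ) ≤ T ^ 7 := by rw [hN7]; nlinarith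
  set c₁ : ℕ → ℝ := fun m => cut w N (m + a) * c m with hc₁
  set c₂ : ℕ → ℝ := fun m => cut w (8 * N) (m + a) * c m with hc₂
  have hfc : Continuous (farSum a σ η c₁ c₂ B B') := continuous_farSum _ _ _ _ _ _ _
  refine ⟨fun τ => (farSum a σ η c₁ c₂ B B' τ).re, continuous_re.comp hfc, ?_, ?_⟩
  · intro τ
    have h1 := norm_integral_bump_mul_farSum_le hw ha (by linarith : 0 ≤ σ) hη1 hH (hcoef N)
      (hcoef (8 * N)) j hC₃.le b₃ B B' τ (Real.rpow_pos_of_pos hT0 (1 - σ))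
    have h2 : ∫ y in (-1 / 2 : ℝ)..(1 / 2), w y *
        (farSum a σ η c₁ c₂ B B' (τ + T ^ (1 - σ) * y)).re =
        (∫ y in (-1 / 2 : ℝ)..(1 / 2), (w y : ℂ) *
        farSum a σ η c₁ c₂ B B' (τ + T ^ (1 - σ) * y)).re := by
      have := reCLM.intervalIntegral_comp_comm (μ := volume) (a := (-1 / 2 : ℝ)) (b := 1 / 2)
        (f := fun y : ℝ => (w y : ℂ) * farSum a σ η c₁ c₂ B B' (τ + T ^ (1 - σ) * y))
        ((hw.isTest.continuous.mul (hfc.comp (by fun_prop))).intervalIntegrable _ _)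
      simp only [reCLM_apply, re_ofReal_mul] at this
      exact this
    rw [h2]
    refine (abs_re_le_norm _).trans (h1.trans ?_)
    have h14 : T ^ 14 ≤ (T ^ (1 - σ)) ^ j := by
      rw [← Real.rpow_natCast, ← Real.rpow_natCast, ← Real.rpow_mul hT0.le]
      refine Real.rpow_le_rpow_of_exponent_le hT1 ?_
      have := Nat.le_ceil (14 / (1 - σ))
      rw [div_le_iff₀ (by linarith)] at this
      push_cast
      rw [hj]
      linarith
    have hBB : (B : ℝ) * B' ≤ (T ^ (1 - σ)) ^ j := by
      refine le_trans ?_ h14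
      calc (B : ℝ) * B' ≤ T ^ 7 * T ^ 7 := by gcongr
        _ = _ := by ring
    have hpos : 0 < (T ^ (1 - σ)) ^ j := by positivity
    have e : (B : ℝ) * B' * (K ^ 2 * (a ^ (-σ)) ^ 2 *
        (4 * (1 + H) * (C₃ * 4 ^ j / (T ^ (1 - σ)) ^ j))) =
        (B * B' / (T ^ (1 - σ)) ^ j) *
          (K ^ 2 * (a ^ (-σ)) ^ 2 * (4 * (1 + H) * (C₃ * 4 ^ j))) := by ring
    rw [e]
    have h5 : (B : ℝ) * B' / (T ^ (1 - σ)) ^ j ≤ 1 := (div_le_one hpos).mpr hBB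
    have h6 : 0 ≤ K ^ 2 * (a ^ (-σ)) ^ 2 * (4 * (1 + H) * (C₃ * 4 ^ j)) := by positivity
    nlinarith [sq_nonneg C₂]
  · intro T₁ T₂ hT₁ h12 hT₂
    have k₁ := b₁ T T₁ T₂ hT hT₁ h12 hT₂ B B' (by nlinarith) hBT (fun m hm => by
        have : (m : ℝ) + 1 ≤ B := by exact_mod_cast hm
        nlinarith) (fun m => cut w N (m + a)) (fun m => cut_nonneg hw _ _)
      (fun m => cut_le_one hw _ _) (fun m hm => cut_eq_one hw hN0.le (by nlinarith))
      (fun m hm => cut_eq_zero hN0.le (by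
        have : (B : ℝ) ≤ m := by exact_mod_cast hm
        linarith))
    have e1 := integral_dirPoly_mul_conj ha σ hη0 c₁ c₂ B B' T₁ T₂
    simp only [hc₁, hc₂, cut_mul_cut_mul_kern hw ha hN0 hη T₁ T₂ c] at e1
    rw [← hc₁, ← hc₂] at e1
    have hsub : Set.uIcc T₁ T₂ ⊆ Set.Ioi 0 := by
      rw [Set.uIcc_of_le h12]
      intro t ht
      have := ht.1
      exact Set.mem_Ioi.mpr (by linarith)
    have hfi : IntervalIntegrable (fun t => f t * (starRingEnd ℂ) (f t)) volume T₁ T₂ :=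
      ContinuousOn.intervalIntegrable ((hf.continuousOn.mono hsub).mul
        (continuous_conj.comp_continuousOn (hf.continuousOn.mono hsub)))
    have hZi : IntervalIntegrable (fun t => dirPoly a σ c₁ B t *
        (starRingEnd ℂ) (dirPoly a σ c₂ B' t)) volume T₁ T₂ :=
      ((continuous_dirPoly ha σ c₁ B).mul
        (continuous_conj.comp (continuous_dirPoly ha σ c₂ B'))).intervalIntegrable _ _
    have e2 : ((∫ t in T₁..T₂, ‖f t‖ ^ 2 : ℝ) : ℂ) =
        ∫ t in T₁..T₂, f t * (starRingEnd ℂ) (f t) := by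
      rw [← intervalIntegral.integral_ofReal]
      refine intervalIntegral.integral_congr fun t _ => ?_
      rw [mul_conj, normSq_eq_norm_sq]
    have k₂ : ‖(∫ t in T₁..T₂, f t * (starRingEnd ℂ) (f t)) - ∫ t in T₁..T₂,
        dirPoly a σ c₁ B t * (starRingEnd ℂ) (dirPoly a σ c₂ B' t)‖ ≤ 12 * C₂ ^ 2 := by
      rw [← intervalIntegral.integral_sub hfi hZi]
      refine (intervalIntegral.norm_integral_le_of_norm_le_const (C := 3 * C₂ ^ 2 / T)
        fun t ht => ?_).trans ?_
      · rw [Set.uIoc_of_le h12] at ht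
        have h1 := b₂ T N t hT hN.ge (by linarith [hN.le]) (by linarith [ht.1]) (by linarith [ht.2]) B hB1
        have h2 := b₂ T (8 * N) t hT (by linarith [hN.ge]) (by linarith [hN.le]) (by linarith [ht.1])
          (by linarith [ht.2]) B' hB1'
        exact norm_mul_conj_sub_le hC₂ hT1 h1.1 h2.1 h1.2
      · rw [abs_of_nonneg (by linarith)]
        calc 3 * C₂ ^ 2 / T * (T₂ - T₁) ≤ 3 * C₂ ^ 2 / T * (4 * T) := by gcongr; linarith
          _ = _ := by field_simp; ring
    rw [e1, ← e2] at k₂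
    set X := (T₂ - T₁) * ∑' m : ℕ, c m ^ 2 * ((m : ℝ) + a) ^ (-(2 * σ)) +
            c₀ ^ 2 * (secondTerm σ T₂ - secondTerm σ T₁)
    set Y := ∫ t in T₁..T₂, ‖f t‖ ^ 2
    set Q := ∑ m ∈ range B, ∑ n ∈ range B', ((cut w N (m + a) * c m * c n : ℝ) : ℂ) *
      kern a σ η T₁ T₂ m n
    have e3 : Y - X - ((farSum a σ η c₁ c₂ B B' T₂).re - (farSum a σ η c₁ c₂ B B' T₁).re) =
        (((Y : ℂ) - (Q + (farSum a σ η c₁ c₂ B B' T₂ - farSum a σ η c₁ c₂ B B' T₁))) +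
          (Q - (X : ℂ))).re := by
      simp only [add_re, sub_re, ofReal_re]
      ring
    rw [e3]
    refine (abs_re_le_norm _).trans ((norm_add_le _ _).trans ?_)
    have hone := one_le_rpow_mul_log hT (p := 1 - σ) (by linarith)
    have h6 : 0 ≤ K ^ 2 * (a ^ (-σ)) ^ 2 * (4 * (1 + H) * (C₃ * 4 ^ j)) := by positivity
    have h7 : 0 ≤ 12 * C₂ ^ 2 := by positivity
    nlinarith

lemma le_of_average_le {w φ : ℝ → ℝ} (hw : IsBump w) (hφ : Continuous φ) {Δ C X : ℝ}
    (hC : ∀ τ, |∫ y in (-1 / 2 : ℝ)..(1 / 2), w y * φ (τ + Δ * y)| ≤ C) (τ₁ τ₂ : ℝ)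
    (h : ∀ y ∈ Set.Icc (-1 / 2 : ℝ) (1 / 2), X ≤ φ (τ₂ + Δ * y) - φ (τ₁ + Δ * y)) :
    X ≤ 2 * C := by
  have hwc := hw.continuous
  have h1 : ∫ y in (-1 / 2 : ℝ)..(1 / 2), w y * X ≤
      ∫ y in (-1 / 2 : ℝ)..(1 / 2), (w y * φ (τ₂ + Δ * y) - w y * φ (τ₁ + Δ * y)) := by
    refine intervalIntegral.integral_mono_on (by norm_num)
      (Continuous.intervalIntegrable (by fun_prop) _ _)
      (Continuous.intervalIntegrable (by fun_prop) _ _) fun y hy => ?_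
    rw [← mul_sub]
    exact mul_le_mul_of_nonneg_left (h y hy) (hw.nonneg y)
  rw [intervalIntegral.integral_mul_const, hw.integral_eq, one_mul,
    intervalIntegral.integral_sub (Continuous.intervalIntegrable (by fun_prop) _ _)
      (Continuous.intervalIntegrable (by fun_prop) _ _)] at h1
  have h2 := le_abs_self (∫ y in (-1 / 2 : ℝ)..(1 / 2), w y * φ (τ₂ + Δ * y))
  have h3 := neg_abs_le (∫ y in (-1 / 2 : ℝ)..(1 / 2), w y * φ (τ₁ + Δ * y))
  linarith [hC τ₁, hC τ₂]

/-- Removal of an oscillating boundary term `φ` with small averages, using monotonicity of the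
integral of a nonnegative function. -/
lemma abs_integral_sub_le_of_average {q w φ 𝓜 : ℝ → ℝ} (hq : ∀ t, 0 ≤ q t)
    (hqc : ContinuousOn q (Set.Ioi 0)) (hw : IsBump w) (hφ : Continuous φ) {T Δ C E Λ : ℝ}
    (hT : 0 < T) (hΔ0 : 0 ≤ Δ) (hΔ : Δ ≤ T / 4) (hΛ : 0 ≤ Λ)
    (hC : ∀ τ, |∫ y in (-1 / 2 : ℝ)..(1 / 2), w y * φ (τ + Δ * y)| ≤ C)
    (h𝓜 : ∀ x y, T / 2 ≤ x → T / 2 ≤ y → |𝓜 x - 𝓜 y| ≤ Λ * |x - y|)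
    (hE : ∀ T₁ T₂, T / 2 ≤ T₁ → T₁ ≤ T₂ → T₂ ≤ 4 * T →
      |(∫ t in T₁..T₂, q t) - (𝓜 T₂ - 𝓜 T₁) - (φ T₂ - φ T₁)| ≤ E) :
    |(∫ t in T..2 * T, q t) - (𝓜 (2 * T) - 𝓜 T)| ≤ E + 2 * C + 4 * (Λ * Δ) := by
  have hqi : ∀ x y, 0 < x → x ≤ y → IntervalIntegrable q volume x y := by
    intro x y hx hxy
    refine ContinuousOn.intervalIntegrable (hqc.mono ?_)
    rw [Set.uIcc_of_le hxy]
    exact fun t ht => hx.trans_le ht.1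
  have hlip : ∀ x y, T / 2 ≤ x → T / 2 ≤ y → |x - y| ≤ 2 * Δ → |𝓜 x - 𝓜 y| ≤ 2 * (Λ * Δ) := by
    intro x y hx hy h
    refine (h𝓜 x y hx hy).trans ?_
    nlinarith
  rw [abs_le]
  constructor
  · have key := le_of_average_le hw hφ hC (2 * T - Δ) (T + Δ)
      (X := -((∫ t in T..2 * T, q t) - (𝓜 (2 * T) - 𝓜 T)) - E - 4 * (Λ * Δ)) fun y hy => by
        have y1 := hy.1
        have y2 := hy.2
        have d1 : -(Δ / 2) ≤ Δ * y := by nlinarith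
        have d2 : Δ * y ≤ Δ / 2 := by nlinarith
        have h1 := (abs_le.mp (hE (T + Δ + Δ * y) (2 * T - Δ + Δ * y) (by linarith) (by linarith)
          (by linarith))).1
        have h2 : ∫ t in (T + Δ + Δ * y)..(2 * T - Δ + Δ * y), q t ≤ ∫ t in T..2 * T, q t :=
          intervalIntegral.integral_mono_interval (by linarith) (by linarith) (by linarith)
            (Eventually.of_forall hq) (hqi _ _ hT (by linarith))
        have h3 := (abs_le.mp (hlip (T + Δ + Δ * y) T (by linarith) (by linarith)
          (by rw [abs_le]; constructor <;> linarith))).2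
        have h4 := (abs_le.mp (hlip (2 * T - Δ + Δ * y) (2 * T) (by linarith) (by linarith)
          (by rw [abs_le]; constructor <;> linarith))).1
        linarith
    linarith
  · have key := le_of_average_le hw hφ hC (T - Δ) (2 * T + Δ)
      (X := ((∫ t in T..2 * T, q t) - (𝓜 (2 * T) - 𝓜 T)) - E - 4 * (Λ * Δ)) fun y hy => by
        have y1 := hy.1
        have y2 := hy.2
        have d1 : -(Δ / 2) ≤ Δ * y := by nlinarith
        have d2 : Δ * y ≤ Δ / 2 := by nlinarith
        have h1 := (abs_le.mp (hE (T - Δ + Δ * y) (2 * T + Δ + Δ * y) (by linarith) (by linarith)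
          (by linarith))).2
        have h2 : ∫ t in T..2 * T, q t ≤ ∫ t in (T - Δ + Δ * y)..(2 * T + Δ + Δ * y), q t :=
          intervalIntegral.integral_mono_interval (by linarith) (by linarith) (by linarith)
            (Eventually.of_forall hq) (hqi _ _ (by linarith) (by linarith))
        have h3 := (abs_le.mp (hlip (T - Δ + Δ * y) T (by linarith) (by linarith)
          (by rw [abs_le]; constructor <;> linarith))).1
        have h4 := (abs_le.mp (hlip (2 * T + Δ + Δ * y) (2 * T) (by linarith) (by linarith)
          (by rw [abs_le]; constructor <;> linarith))).2
        linarith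
    linarith

lemma exists_abs_le_of_dyadic {F : ℝ → ℝ} {p C : ℝ} (hp : 0 < p) (hC : 0 ≤ C)
    (hF : ContinuousOn F (Set.Ioi 0))
    (h : ∀ T, 2000 ≤ T → |F (2 * T) - F T| ≤ C * (T ^ p * Real.log T)) :
    ∃ C', 0 < C' ∧ ∀ T, 2000 ≤ T → |F T| ≤ C' * (T ^ p * Real.log T) := by
  obtain ⟨B₀, hB₀⟩ := isCompact_Icc.exists_bound_of_continuousOn
    (hF.mono (fun t (ht : t ∈ Set.Icc (2000 : ℝ) 4000) => show 0 < t by linarith [ht.1]))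
  have hB₀0 : 0 ≤ B₀ := (norm_nonneg _).trans (hB₀ 2000 ⟨le_rfl, by norm_num⟩)
  have h2p : 0 < (2 : ℝ) ^ p - 1 := by
    have := Real.one_lt_rpow (show (1 : ℝ) < 2 by norm_num) hp
    linarith
  have key : ∀ k : ℕ, ∀ T, 2000 ≤ T → T ≤ 4000 * 2 ^ k →
      |F T| ≤ B₀ + C / (2 ^ p - 1) * (T ^ p * Real.log T) := by
    intro k
    induction k with
    | zero =>
      intro T hT hT2
      have h1 := hB₀ T ⟨hT, by simpa using hT2⟩
      have h2 : 0 ≤ T ^ p * Real.log T := by linarith [one_le_rpow_mul_log hT hp.le]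
      rw [Real.norm_eq_abs] at h1
      have : 0 ≤ C / (2 ^ p - 1) * (T ^ p * Real.log T) := by positivity
      linarith
    | succ k ih =>
      intro T hT hT2
      rcases le_or_gt T 4000 with h4 | h4
      · have h1 := hB₀ T ⟨hT, h4⟩
        have h2 : 0 ≤ T ^ p * Real.log T := by linarith [one_le_rpow_mul_log hT hp.le]
        rw [Real.norm_eq_abs] at h1
        have : 0 ≤ C / (2 ^ p - 1) * (T ^ p * Real.log T) := by positivity
        linarith
      · have hT0 : 0 < T / 2 := by linarith
        have h1 := ih (T / 2) (by linarith) (by rw [pow_succ] at hT2; linarith)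
        have h2 := h (T / 2) (by linarith)
        rw [show 2 * (T / 2) = T by ring] at h2
        have h3 := abs_sub_abs_le_abs_sub (F T) (F (T / 2))
        have h5 : (2 : ℝ) ^ p * ((T / 2) ^ p * Real.log (T / 2)) ≤ T ^ p * Real.log T := by
          rw [← mul_assoc, ← Real.mul_rpow (by norm_num) hT0.le,
            show 2 * (T / 2) = T by ring]
          gcongr
          linarith
        have h6 : C / (2 ^ p - 1) * ((T / 2) ^ p * Real.log (T / 2)) +
            C * ((T / 2) ^ p * Real.log (T / 2)) =
            C / (2 ^ p - 1) * (2 ^ p * ((T / 2) ^ p * Real.log (T / 2))) := by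
          field_simp
          ring
        have h7 : C / (2 ^ p - 1) * (2 ^ p * ((T / 2) ^ p * Real.log (T / 2))) ≤
            C / (2 ^ p - 1) * (T ^ p * Real.log T) := by gcongr
        linarith
  refine ⟨B₀ + C / (2 ^ p - 1) + 1, by positivity, fun T hT => ?_⟩
  obtain ⟨k, hk⟩ := pow_unbounded_of_one_lt T (show (1 : ℝ) < 2 by norm_num)
  have h1 := key k T hT (by linarith)
  have h2 := one_le_rpow_mul_log hT hp.le
  nlinarith

lemma abs_secondTerm_sub_le {σ : ℝ} (hσ : 1 / 2 < σ) (hσ1 : σ < 1) :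
    ∃ Λ, 0 ≤ Λ ∧ ∀ x y, 1 ≤ x → 1 ≤ y → |secondTerm σ x - secondTerm σ y| ≤ Λ * |x - y| := by
  set κ := 2 * Real.pi * ((1 / (2 * Real.pi)) ^ (2 - 2 * σ) *
    (hzeta 1 ((2 - 2 * σ : ℝ) : ℂ)).re / (2 - 2 * σ)) with hκ
  have e : ∀ x, 0 ≤ x → secondTerm σ x = κ * x ^ (2 - 2 * σ) := by
    intro x hx
    rw [secondTerm, hκ, div_eq_mul_one_div x, Real.mul_rpow hx (by positivity)]
    ring
  refine ⟨|κ|, abs_nonneg _, fun x y hx hy => ?_⟩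
  rw [e x (by linarith), e y (by linarith), ← mul_sub, abs_mul]
  refine mul_le_mul_of_nonneg_left ?_ (abs_nonneg κ)
  refine (abs_rpow_sub_rpow_le (x := x) (y := y) (p := 2 - 2 * σ) (by linarith) (by linarith)
    (by linarith) (by linarith)).trans ?_
  exact mul_le_of_le_one_right (abs_nonneg _)
    (Real.rpow_le_one_of_one_le_of_nonpos hx (by linarith))

lemma continuousOn_secondTerm {σ : ℝ} : ContinuousOn (secondTerm σ) (Set.Ioi 0) := by
  unfold secondTerm
  refine continuousOn_const.mul (ContinuousOn.div_const (ContinuousOn.mul ?_ continuousOn_const) _)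
  refine ContinuousOn.rpow_const (by fun_prop) fun x hx => Or.inl ?_
  have : 0 < x := hx
  positivity

theorem exists_mean_square {a σ K c₀ : ℝ} {c : ℕ → ℝ} {w : ℝ → ℝ} {f : ℝ → ℂ}
    (hw : IsBump w) (ha : 0 < a) (ha1 : a ≤ 1)
    (hσ : 1 / 2 < σ) (hσ1 : σ < 1) (hK : ∀ m, |c m| ≤ K) (hK₀ : |c₀| ≤ K)
    (hc : ∀ m, |c m - c₀| ≤ K / (m + a)) (hf : HasCutApprox a σ c w f) :
    ∃ C, 0 < C ∧ ∀ T : ℝ, 2000 ≤ T →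
      |(∫ t in (1 : ℝ)..T, ‖f t‖ ^ 2) -
          (T * ∑' m : ℕ, c m ^ 2 * ((m : ℝ) + a) ^ (-(2 * σ)) + c₀ ^ 2 * secondTerm σ T)| ≤
          C * (T ^ (1 - σ) * Real.log T) := by
  obtain ⟨C, hC, h⟩ := exists_local_mean_square hw ha ha1 hσ hσ1 hK hK₀ hc hf
  obtain ⟨Λ, hΛ, hΛb⟩ := abs_secondTerm_sub_le hσ hσ1
  set D := ∑' m : ℕ, c m ^ 2 * ((m : ℝ) + a) ^ (-(2 * σ))
  set 𝓜 : ℝ → ℝ := fun T => T * D + c₀ ^ 2 * secondTerm σ T with h𝓜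
  have hqc : ContinuousOn (fun t => ‖f t‖ ^ 2) (Set.Ioi 0) := hf.continuousOn.norm.pow 2
  have hqi : ∀ x y, 0 < x → 0 < y → IntervalIntegrable (fun t => ‖f t‖ ^ 2) volume x y := by
    intro x y hx hy
    refine ContinuousOn.intervalIntegrable (hqc.mono ?_)
    intro t ht
    have := ht.1
    exact (lt_inf_iff.mpr ⟨hx, hy⟩).trans_le this
  have hFc : ContinuousOn (fun T => (∫ t in (1 : ℝ)..T, ‖f t‖ ^ 2) - 𝓜 T) (Set.Ioi 0) := by
    refine ContinuousOn.sub ?_ ?_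
    · intro T hT
      have hT : 0 < T := hT
      have hd := intervalIntegral.integral_hasDerivAt_right (hqi 1 T one_pos hT)
        (hqc.stronglyMeasurableAtFilter isOpen_Ioi T hT) (hqc.continuousAt (Ioi_mem_nhds hT))
      exact hd.continuousAt.continuousWithinAt
    · exact (continuousOn_id.mul continuousOn_const).add
        (continuousOn_const.mul continuousOn_secondTerm)
  refine exists_abs_le_of_dyadic (C := C + 2 * C + 4 * (|D| + c₀ ^ 2 * Λ)) (by linarith)
    (by positivity) hFc fun T hT => ?_
  have hT0 : 0 < T := by linarith
  obtain ⟨φ, hφ, hφC, hφE⟩ := h T hT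
  have hΔ : T ^ (1 - σ) ≤ T / 4 := by
    have h1 : T ^ (1 - σ) ≤ √T := by
      rw [Real.sqrt_eq_rpow]
      exact Real.rpow_le_rpow_of_exponent_le (by linarith) (by linarith)
    have hss : √T * √T = T := Real.mul_self_sqrt hT0.le
    have hs40 : 40 ≤ √T := Real.le_sqrt_of_sq_le (by linarith)
    nlinarith
  have key := abs_integral_sub_le_of_average (𝓜 := 𝓜) (Λ := |D| + c₀ ^ 2 * Λ)
    (E := C * (T ^ (1 - σ) * Real.log T)) (fun t => sq_nonneg ‖f t‖) hqc hw hφ hT0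
    (by positivity) hΔ (by positivity) hφC
    (fun x y hx hy => by
      have e : 𝓜 x - 𝓜 y = D * (x - y) + c₀ ^ 2 * (secondTerm σ x - secondTerm σ y) := by
        rw [h𝓜]; ring
      rw [e, add_mul, mul_assoc]
      refine (abs_add_le _ _).trans ?_
      rw [abs_mul, abs_mul, abs_of_nonneg (sq_nonneg c₀)]
      gcongr
      exact hΛb x y (by linarith) (by linarith))
    (fun T₁ T₂ h1 h2 h3 => by
      have := hφE T₁ T₂ h1 h2 h3
      convert this using 3
      rw [h𝓜]
      ring)
  have hadd : (∫ t in (1 : ℝ)..2 * T, ‖f t‖ ^ 2) - ∫ t in (1 : ℝ)..T, ‖f t‖ ^ 2 =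
      ∫ t in T..2 * T, ‖f t‖ ^ 2 :=
    intervalIntegral.integral_interval_sub_left (hqi _ _ one_pos (by linarith))
      (hqi _ _ one_pos hT0)
  have e : (∫ t in (1 : ℝ)..2 * T, ‖f t‖ ^ 2) - 𝓜 (2 * T) - ((∫ t in (1 : ℝ)..T, ‖f t‖ ^ 2) - 𝓜 T)
      = (∫ t in T..2 * T, ‖f t‖ ^ 2) - (𝓜 (2 * T) - 𝓜 T) := by
    rw [← hadd]; ring
  rw [e]
  refine key.trans ?_
  have h1 := one_le_rpow_mul_log hT (p := 1 - σ) (by linarith)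
  have h2 := rpow_le_rpow_mul_log hT (p := 1 - σ)
  have h3 : 0 ≤ |D| + c₀ ^ 2 * Λ := by positivity
  nlinarith [mul_le_mul_of_nonneg_left h2 h3]

lemma exists_norm_cut_sub_le {a σ : ℝ} {w : ℝ → ℝ} (hw : IsBump w) (ha : 0 < a) (ha1 : a ≤ 1)
    (hσ : 1 / 2 < σ) :
    ∃ C, 0 < C ∧ ∀ T N t : ℝ, 2000 ≤ T → T ^ 6 ≤ N → N ≤ 8 * T ^ 6 → T / 2 ≤ t → t ≤ 4 * T →
      ∀ B : ℕ, N * Real.exp (1 / 2) + 1 ≤ B →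
        ‖∑ m ∈ range B, (cut w N (m + a) : ℂ) * ((m + a : ℝ) : ℂ) ^ (-((σ : ℂ) + t * I)) -
          hzeta a (σ + t * I)‖ ≤ C / T ^ 2 := by
  have htest : IsTest fun θ => (Real.exp ((1 - σ) * θ) : ℂ) * w θ :=
    hw.isTest.mul_left (ofRealCLM.contDiff.comp
      (Real.contDiff_exp.comp (contDiff_const.mul contDiff_id)))
  obtain ⟨D, hD, hosc⟩ := exists_norm_osc_zero_le htest 5
  refine ⟨(3 * (σ + 4) + 1) * 2 + 512 * D, by positivity, fun T N t hT hN hN8 ht ht4 B hB => ?_⟩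
  have hT0 : 0 < T := by linarith
  have ht0 : 0 < t := by linarith
  have hT6 : 1 ≤ T ^ 6 := one_le_pow₀ (by linarith)
  have hT2 : T ≤ T ^ 6 := le_self_pow₀ (by linarith) (by norm_num)
  have hN0 : 0 < N := by linarith
  have hre : ((σ : ℂ) + t * I).re = σ := by simp
  have him : ((σ : ℂ) + t * I).im = t := by simp
  have hs1 : (σ : ℂ) + t * I ≠ 1 := fun h => by
    have := congrArg im h
    rw [him, one_im] at this
    exact ht0.ne' this
  have key := norm_sum_cut_sub_le hw ha ha1 (show 2 ≤ N by linarith) (by rw [hre]; exact hσ.le)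
    hs1 hB
  rw [hre, him] at key
  refine key.trans ?_
  have hs : ‖(σ : ℂ) + t * I‖ ≤ (σ + 4) * T := by
    refine (norm_add_le _ _).trans ?_
    rw [norm_mul, norm_I, norm_real, norm_real, Real.norm_of_nonneg (by linarith),
      Real.norm_of_nonneg ht0.le]
    nlinarith
  have hpow : (T ^ 6 / 4 : ℝ) ^ (-(1 / 2) : ℝ) = 2 / T ^ 3 := by
    rw [show T ^ 6 / 4 = (T ^ 3 / 2) ^ (2 : ℝ) by rw [Real.rpow_two]; ring,
      ← Real.rpow_mul (by positivity), show (2 : ℝ) * (-(1 / 2)) = -1 by norm_num,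
      Real.rpow_neg_one, inv_div]
  have hNp : (N / 2) ^ (-(1 / 2) : ℝ) ≤ 2 / T ^ 3 := by
    rw [← hpow]
    exact Real.rpow_le_rpow_of_nonpos (by positivity) (by linarith) (by norm_num)
  have hNs : N ^ (1 - σ) ≤ 4 * T ^ 3 := by
    have h1 : N ^ (1 - σ) ≤ N ^ (1 / 2 : ℝ) :=
      Real.rpow_le_rpow_of_exponent_le (by linarith) (by linarith)
    refine h1.trans ?_
    rw [← Real.sqrt_eq_rpow]
    refine Real.sqrt_le_iff.mpr ⟨by positivity, ?_⟩
    nlinarith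
  have hs1n : T / 2 ≤ ‖1 - ((σ : ℂ) + t * I)‖ := by
    have := abs_im_le_norm (1 - ((σ : ℂ) + t * I))
    rw [sub_im, him, one_im, zero_sub, abs_neg, abs_of_pos ht0] at this
    linarith
  have hO : ‖osc (fun θ => (Real.exp ((1 - σ) * θ) : ℂ) * w θ) (-t) 0‖ ≤ D / (T / 2) ^ 5 := by
    refine (hosc (-t) (by linarith)).trans ?_
    rw [abs_neg, abs_of_pos ht0]
    gcongr
  have e1 : (3 * ‖(σ : ℂ) + t * I‖ + 1) * (N / 2) ^ (-(1 / 2) : ℝ) ≤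
      (3 * ((σ + 4) * T) + T) * (2 / T ^ 3) := by
    gcongr
    linarith
  have e2 : N ^ (1 - σ) / ‖1 - ((σ : ℂ) + t * I)‖ *
      ‖osc (fun θ => (Real.exp ((1 - σ) * θ) : ℂ) * w θ) (-t) 0‖ ≤
      4 * T ^ 3 / (T / 2) * (D / (T / 2) ^ 5) := by
    gcongr
  have e3 : (3 * ((σ + 4) * T) + T) * (2 / T ^ 3) = (3 * (σ + 4) + 1) * 2 / T ^ 2 := by
    field_simp
  have e4 : 4 * T ^ 3 / (T / 2) * (D / (T / 2) ^ 5) ≤ 512 * D / T ^ 2 := by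
    rw [show 4 * T ^ 3 / (T / 2) * (D / (T / 2) ^ 5) = 256 * D / T ^ 3 by field_simp; norm_num]
    have : T ^ 2 ≤ T ^ 3 := pow_le_pow_right₀ (by linarith) (by norm_num)
    gcongr
    norm_num
  rw [add_div]
  linarith

lemma exists_norm_hzeta_le {a σ : ℝ} (ha : 0 < a) (ha1 : a ≤ 1) (hσ : 0 < σ) :
    ∃ C, 0 < C ∧ ∀ t : ℝ, 1 ≤ t → ‖hzeta a (σ + t * I)‖ ≤ C * t := by
  refine ⟨a ^ (1 - σ) + (σ + 1) * (a ^ (-σ - 1) + a ^ (-σ) / σ), by positivity, fun t ht => ?_⟩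
  have ht0 : 0 < t := by linarith
  have hre : ((σ : ℂ) + t * I).re = σ := by simp
  have him : ((σ : ℂ) + t * I).im = t := by simp
  have hs1 : (σ : ℂ) + t * I ≠ 1 := fun h => by
    have := congrArg im h
    rw [him, one_im] at this
    exact ht0.ne' this
  have key := norm_sum_sub_hzeta_le ha ha1 (s := (σ : ℂ) + t * I) (by rw [hre]; exact hσ) hs1 0
  simp only [range_zero, sum_empty, Nat.cast_zero, zero_add, zero_sub, hre] at key
  have hs : ‖(σ : ℂ) + t * I‖ ≤ (σ + 1) * t := by
    refine (norm_add_le _ _).trans ?_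
    rw [norm_mul, norm_I, norm_real, norm_real, Real.norm_of_nonneg hσ.le,
      Real.norm_of_nonneg ht0.le]
    nlinarith
  have hs1n : 1 ≤ ‖1 - ((σ : ℂ) + t * I)‖ := by
    have := abs_im_le_norm (1 - ((σ : ℂ) + t * I))
    rw [sub_im, him, one_im, zero_sub, abs_neg, abs_of_pos ht0] at this
    linarith
  have h1 : ‖(a : ℂ) ^ (1 - ((σ : ℂ) + t * I)) / (1 - ((σ : ℂ) + t * I))‖ ≤ a ^ (1 - σ) := by
    rw [norm_div, norm_cpow_eq_rpow_re_of_pos ha, sub_re, hre, one_re]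
    exact div_le_self (by positivity) hs1n
  have h2 := norm_sub_le (-hzeta a ((σ : ℂ) + t * I) -
    (a : ℂ) ^ (1 - ((σ : ℂ) + t * I)) / (1 - ((σ : ℂ) + t * I)))
    (-((a : ℂ) ^ (1 - ((σ : ℂ) + t * I)) / (1 - ((σ : ℂ) + t * I))))
  rw [sub_neg_eq_add, sub_add_cancel, norm_neg, norm_neg] at h2
  have h3 : ‖(σ : ℂ) + t * I‖ * (a ^ (-σ - 1) + a ^ (-σ) / σ) ≤
      (σ + 1) * t * (a ^ (-σ - 1) + a ^ (-σ) / σ) := by gcongr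
  have h4 : a ^ (1 - σ) ≤ a ^ (1 - σ) * t := le_mul_of_one_le_right (by positivity) ht
  calc _ ≤ _ := h2
    _ ≤ (σ + 1) * t * (a ^ (-σ - 1) + a ^ (-σ) / σ) + a ^ (1 - σ) * t := by linarith
    _ = _ := by ring

lemma hasCutApprox_hzeta {a σ : ℝ} {w : ℝ → ℝ} (hw : IsBump w) (ha : 0 < a) (ha1 : a ≤ 1)
    (hσ : 1 / 2 < σ) (k : ℕ) :
    HasCutApprox a σ (fun m => (((m : ℝ) + a) ^ k)⁻¹) w
      fun t => hzeta a ((σ + k : ℝ) + t * I) := by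
  have hk : (0 : ℝ) ≤ k := k.cast_nonneg
  obtain ⟨C₁, hC₁, h₁⟩ := exists_norm_cut_sub_le hw ha ha1 (show 1 / 2 < σ + k by linarith)
  obtain ⟨C₂, hC₂, h₂⟩ := exists_norm_hzeta_le ha ha1 (show 0 < σ + k by linarith)
  refine ⟨fun t ht => ?_, C₁ + 4 * C₂, by positivity, fun T N t hT hN hN8 ht ht4 B hB => ⟨?_, ?_⟩⟩
  · have ht : 0 < t := ht
    have hs1 : ((σ + k : ℝ) : ℂ) + t * I ≠ 1 := fun h => by
      have := congrArg im h
      simp at this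
      exact ht.ne' this
    have hd := (HurwitzZeta.differentiableAt_hurwitzZeta (a : UnitAddCircle) hs1).continuousAt
    exact (ContinuousAt.comp (f := fun t : ℝ => ((σ + k : ℝ) : ℂ) + t * I) (x := t) hd
      (by fun_prop)).continuousWithinAt
  · have e : dirPoly a σ (fun m => cut w N (m + a) * (((m : ℝ) + a) ^ k)⁻¹) B t =
        ∑ m ∈ range B, (cut w N (m + a) : ℂ) *
          ((m + a : ℝ) : ℂ) ^ (-(((σ + k : ℝ) : ℂ) + t * I)) := by
      refine sum_congr rfl fun m _ => ?_
      have hm : ((m + a : ℝ) : ℂ) ≠ 0 := by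
        have : (0 : ℝ) < m + a := by positivity
        exact_mod_cast this.ne'
      rw [show -(((σ + k : ℝ) : ℂ) + t * I) = -((σ : ℂ) + t * I) - (k : ℂ) by push_cast; ring,
        cpow_sub _ _ hm, cpow_natCast]
      push_cast
      ring
    rw [e]
    refine (h₁ T N t hT hN hN8 ht ht4 B hB).trans ?_
    gcongr
    linarith
  · refine (h₂ t (by linarith)).trans ?_
    nlinarith

lemma HasCutApprox.sum {a σ : ℝ} {w : ℝ → ℝ} {r : ℕ} {p : ℕ → ℝ} {c : ℕ → ℕ → ℝ}
    {f : ℕ → ℝ → ℂ} (h : ∀ j, HasCutApprox a σ (c j) w (f j)) :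
    HasCutApprox a σ (fun m => ∑ j ∈ range r, p j * c j m) w
      fun t => ∑ j ∈ range r, (p j : ℂ) * f j t := by
  choose C hC hCb using fun j => (h j).approx
  refine ⟨continuousOn_finsetSum _ fun j _ => continuousOn_const.mul (h j).continuousOn,
    ∑ j ∈ range r, |p j| * C j + 1, ?_, fun T N t hT hN hN8 ht ht4 B hB => ⟨?_, ?_⟩⟩
  · have : 0 ≤ ∑ j ∈ range r, |p j| * C j := sum_nonneg fun j _ => by have := hC j; positivity
    linarith
  · have e : dirPoly a σ (fun m => cut w N (m + a) * ∑ j ∈ range r, p j * c j m) B t =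
        ∑ j ∈ range r, (p j : ℂ) * dirPoly a σ (fun m => cut w N (m + a) * c j m) B t := by
      simp only [dirPoly, mul_sum]
      rw [sum_comm]
      refine sum_congr rfl fun m _ => ?_
      rw [ofReal_sum, sum_mul]
      refine sum_congr rfl fun j _ => ?_
      push_cast
      ring
    rw [e, ← sum_sub_distrib]
    refine (norm_sum_le _ _).trans ?_
    have hb : ∀ j ∈ range r, ‖(p j : ℂ) * dirPoly a σ (fun m => cut w N (m + a) * c j m) B t -
        (p j : ℂ) * f j t‖ ≤ |p j| * C j / T ^ 2 := by
      intro j _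
      rw [← mul_sub, norm_mul, norm_real, Real.norm_eq_abs, mul_div_assoc]
      gcongr
      exact (hCb j T N t hT hN hN8 ht ht4 B hB).1
    refine (sum_le_sum hb).trans ?_
    rw [← sum_div]
    gcongr
    linarith
  · refine (norm_sum_le _ _).trans ?_
    have hb : ∀ j ∈ range r, ‖(p j : ℂ) * f j t‖ ≤ |p j| * C j * T := by
      intro j _
      rw [norm_mul, norm_real, Real.norm_eq_abs, mul_assoc]
      gcongr
      exact (hCb j T N t hT hN hN8 ht ht4 B hB).2
    refine (sum_le_sum hb).trans ?_
    rw [← sum_mul]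
    have : 0 < T := by linarith
    gcongr
    linarith

lemma hasCutApprox_zetaR {a σ : ℝ} {w : ℝ → ℝ} (hw : IsBump w) (ha : 0 < a) (ha1 : a ≤ 1)
    {r : ℕ} (hr : 1 ≤ r) (h1 : (r : ℝ) - 1 / 2 < σ) :
    HasCutApprox a (σ - (r - 1))
      (fun m => ∑ j ∈ range r, pCoeff r a j * (((m : ℝ) + a) ^ (r - 1 - j))⁻¹) w
      fun t => zetaR r a (σ + t * I) := by
  have h := HasCutApprox.sum (r := r) (p := pCoeff r a)
    (fun j => hasCutApprox_hzeta hw ha ha1 (show 1 / 2 < σ - (r - 1) by linarith) (r - 1 - j))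
  convert h using 1
  funext t
  refine sum_congr rfl fun j hj => ?_
  have hj := mem_range.mp hj
  congr 2
  rw [Nat.cast_sub (by omega), Nat.cast_sub hr]
  push_cast
  ring

lemma pCoeff_sub_one (r : ℕ) (a : ℝ) : pCoeff r a (r - 1) = ((r - 1).factorial : ℝ)⁻¹ := by
  have hm : ∀ i ∈ range (r - 1),
      (Polynomial.X + Polynomial.C ((i : ℝ) + 1 - a)).Monic :=
    fun i _ => Polynomial.monic_X_add_C _
  have hd : (∏ i ∈ range (r - 1),
      (Polynomial.X + Polynomial.C ((i : ℝ) + 1 - a))).natDegree = r - 1 := by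
    rw [Polynomial.natDegree_prod_of_monic _ _ hm]
    simp only [Polynomial.natDegree_X_add_C, sum_const, card_range, smul_eq_mul, mul_one]
  have hc := Polynomial.monic_prod_of_monic _ _ hm
  rw [Polynomial.Monic, Polynomial.leadingCoeff, hd] at hc
  rw [pCoeff, Polynomial.coeff_smul, hc, smul_eq_mul, mul_one]

lemma exists_coeff_bounds {a : ℝ} (ha : 0 < a) (ha1 : a ≤ 1) {r : ℕ} (hr : 1 ≤ r) (p : ℕ → ℝ) :
    ∃ K, (∀ m : ℕ, |∑ j ∈ range r, p j * (((m : ℝ) + a) ^ (r - 1 - j))⁻¹| ≤ K) ∧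
      |p (r - 1)| ≤ K ∧
      ∀ m : ℕ, |(∑ j ∈ range r, p j * (((m : ℝ) + a) ^ (r - 1 - j))⁻¹) - p (r - 1)| ≤
        K / (m + a) := by
  obtain ⟨n, rfl⟩ : ∃ n, r = n + 1 := ⟨r - 1, by omega⟩
  simp only [Nat.add_sub_cancel]
  have hle : ∀ m k : ℕ, (((m : ℝ) + a) ^ k)⁻¹ ≤ (a ^ k)⁻¹ := by
    intro m k
    gcongr
    linarith [m.cast_nonneg (α := ℝ)]
  refine ⟨∑ j ∈ range (n + 1), |p j| * (a ^ (n - j))⁻¹, fun m => ?_, ?_, fun m => ?_⟩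
  · have hm : 0 < (m : ℝ) + a := by positivity
    refine (abs_sum_le_sum_abs _ _).trans (sum_le_sum fun j _ => ?_)
    rw [abs_mul, abs_of_pos (show 0 < (((m : ℝ) + a) ^ (n - j))⁻¹ by positivity)]
    exact mul_le_mul_of_nonneg_left (hle m _) (abs_nonneg _)
  · have := single_le_sum (f := fun j => |p j| * (a ^ (n - j))⁻¹)
      (fun j _ => by positivity) (self_mem_range_succ n)
    simpa using this
  · have hm : 0 < (m : ℝ) + a := by positivity
    rw [sum_range_succ, Nat.sub_self, pow_zero, inv_one, mul_one, add_sub_cancel_right,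
      sum_range_succ, add_div, sum_div]
    have hb : ∀ j ∈ range n, |p j * (((m : ℝ) + a) ^ (n - j))⁻¹| ≤
        |p j| * (a ^ (n - j))⁻¹ / (m + a) := by
      intro j hj
      have hj := mem_range.mp hj
      rw [abs_mul, abs_of_pos (show 0 < (((m : ℝ) + a) ^ (n - j))⁻¹ by positivity), mul_div_assoc]
      refine mul_le_mul_of_nonneg_left ?_ (abs_nonneg _)
      obtain ⟨k, hk⟩ : ∃ k, n - j = k + 1 := ⟨n - j - 1, by omega⟩
      rw [hk, pow_succ ((m : ℝ) + a), mul_inv, ← div_eq_mul_inv]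
      refine div_le_div_of_nonneg_right ((hle m k).trans ?_) hm.le
      exact inv_anti₀ (by positivity) (pow_le_pow_of_le_one ha.le ha1 k.le_succ)
    refine ((abs_sum_le_sum_abs _ _).trans (sum_le_sum hb)).trans ?_
    exact le_add_of_nonneg_right (by positivity)

lemma ofReal_tsum_coeff_sq {a σ : ℝ} (ha : 0 < a) (ha1 : a ≤ 1) {r : ℕ} (hr : 1 ≤ r)
    (h1 : (r : ℝ) - 1 / 2 < σ) (p : ℕ → ℝ) :
    ((∑' m : ℕ, (∑ j ∈ range r, p j * (((m : ℝ) + a) ^ (r - 1 - j))⁻¹) ^ 2 *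
      ((m : ℝ) + a) ^ (-(2 * (σ - (r - 1)))) : ℝ) : ℂ) =
      ∑ k ∈ range r, ∑ l ∈ range r, (p k : ℂ) * (p l : ℂ) * hzeta a ((2 * σ - k - l : ℝ) : ℂ) := by
  rw [ofReal_tsum]
  refine HasSum.tsum_eq ?_
  have hkl : ∀ k ∈ range r, ∀ l ∈ range r, HasSum (fun m : ℕ => (p k : ℂ) * (p l : ℂ) *
      ((m + a : ℝ) : ℂ) ^ (-((2 * σ - k - l : ℝ) : ℂ)))
      ((p k : ℂ) * (p l : ℂ) * hzeta a ((2 * σ - k - l : ℝ) : ℂ)) := by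
    intro k hk l hl
    have hk : (k : ℝ) + 1 ≤ r := by exact_mod_cast mem_range.mp hk
    have hl : (l : ℝ) + 1 ≤ r := by exact_mod_cast mem_range.mp hl
    exact (hasSum_hzeta ha ha1 (by rw [ofReal_re]; linarith)).mul_left _
  convert hasSum_sum fun k hk => hasSum_sum fun l hl => hkl k hk l hl using 1
  funext m
  have hm : 0 < (m : ℝ) + a := by positivity
  have hinv : ∀ n : ℕ, (((m : ℝ) + a) ^ n)⁻¹ = ((m : ℝ) + a) ^ (-(n : ℝ)) := fun n => by
    rw [Real.rpow_neg hm.le, Real.rpow_natCast]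
  rw [sq, sum_mul_sum, sum_mul, ofReal_sum]
  refine sum_congr rfl fun k hk => ?_
  rw [sum_mul, ofReal_sum]
  refine sum_congr rfl fun l hl => ?_
  have hk := mem_range.mp hk
  have hl := mem_range.mp hl
  rw [← ofReal_neg, ← ofReal_cpow hm.le, ← ofReal_mul, ← ofReal_mul, hinv, hinv]
  congr 1
  rw [show -(2 * σ - k - l) = -((r - 1 - k : ℕ) : ℝ) + -((r - 1 - l : ℕ) : ℝ) +
      -(2 * (σ - (r - 1))) by
    rw [Nat.cast_sub (show k ≤ r - 1 by omega), Nat.cast_sub (show l ≤ r - 1 by omega),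
      Nat.cast_sub hr]
    push_cast
    ring, Real.rpow_add hm, Real.rpow_add hm]
  ring

lemma ofReal_mul_secondTerm {σ T : ℝ} {r : ℕ} (h1 : (r : ℝ) - 1 / 2 < σ) (h2 : σ < r)
    (hT : 0 < T) :
    ((secondTerm (σ - (r - 1)) T : ℝ) : ℂ) =
      (((2 * Real.pi : ℝ) : ℂ) ^ ((2 * σ - 2 * r + 1 : ℝ) : ℂ) / ((2 * r - 2 * σ : ℝ) : ℂ)) *
        riemannZeta ((2 * r - 2 * σ : ℝ) : ℂ) * (T : ℂ) ^ ((2 * r - 2 * σ : ℝ) : ℂ) := by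
  have hpi : 0 < 2 * Real.pi := by positivity
  have hp : 2 - 2 * (σ - (r - 1)) = 2 * r - 2 * σ := by ring
  have hz : riemannZeta ((2 * r - 2 * σ : ℝ) : ℂ) =
      (((hzeta 1 ((2 * r - 2 * σ : ℝ) : ℂ)).re : ℝ) : ℂ) := by
    have h0 : riemannZeta ((2 * r - 2 * σ : ℝ) : ℂ) = hzeta 1 ((2 * r - 2 * σ : ℝ) : ℂ) := by
      rw [hzeta, AddCircle.coe_period, HurwitzZeta.hurwitzZeta_zero]
    rw [h0]
    refine Complex.ext (by simp) ?_
    rw [ofReal_im]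
    exact hzeta_ofReal_im one_pos le_rfl (by linarith) (by linarith)
  rw [secondTerm, hp, hz, ← ofReal_cpow hpi.le, ← ofReal_cpow hT.le, ← ofReal_div, ← ofReal_mul,
    ← ofReal_mul]
  congr 1
  rw [Real.div_rpow hT.le hpi.le, show 2 * σ - 2 * r + 1 = 1 - (2 * r - 2 * σ) by ring,
    Real.rpow_sub hpi 1, Real.rpow_one]
  ring

theorem stmt1 (r : ℕ) (hr : 1 ≤ r) (a : ℝ) (ha : 0 < a) (ha1 : a ≤ 1)
    (σ : ℝ) (h1 : (r : ℝ) - 1 / 2 < σ) (h2 : σ < r) :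
    (fun T : ℝ =>
        ((∫ t in (1 : ℝ)..T, ‖zetaR r a (σ + t * I)‖ ^ 2 : ℝ) : ℂ)
        - (∑ k ∈ Finset.range r, ∑ l ∈ Finset.range r,
            (pCoeff r a k : ℂ) * (pCoeff r a l : ℂ) *
              hzeta a ((2 * σ - k - l : ℝ) : ℂ)) * (T : ℂ)
        - ((Nat.factorial (r - 1) : ℂ) ^ 2)⁻¹ *
            (((2 * Real.pi : ℝ) : ℂ) ^ ((2 * σ - 2 * r + 1 : ℝ) : ℂ) / ((2 * r - 2 * σ : ℝ) : ℂ)) *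
            riemannZeta ((2 * r - 2 * σ : ℝ) : ℂ) * (T : ℂ) ^ ((2 * r - 2 * σ : ℝ) : ℂ))
      =O[atTop] fun T : ℝ => T ^ ((r : ℝ) - σ) * Real.log T := by
  obtain ⟨w, hw⟩ := exists_isBump
  obtain ⟨K, hK, hK₀, hc⟩ := exists_coeff_bounds ha ha1 hr (pCoeff r a)
  obtain ⟨C, hC, h⟩ := exists_mean_square hw ha ha1 (show 1 / 2 < σ - (r - 1) by linarith)
    (by linarith) hK hK₀ hc (hasCutApprox_zetaR hw ha ha1 hr h1)
  refine Asymptotics.IsBigO.of_bound C ?_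
  filter_upwards [eventually_ge_atTop 2000] with T hT
  have hT0 : 0 < T := by linarith
  have key := h T hT
  rw [show 1 - (σ - ((r : ℝ) - 1)) = r - σ by ring] at key
  have hlog : 0 ≤ Real.log T := Real.log_nonneg (by linarith)
  rw [Real.norm_of_nonneg (by positivity : 0 ≤ T ^ ((r : ℝ) - σ) * Real.log T)]
  refine le_of_eq_of_le ?_ key
  rw [← Real.norm_eq_abs, ← norm_real]
  congr 1
  rw [← ofReal_tsum_coeff_sq ha ha1 hr h1 (pCoeff r a), mul_assoc, mul_assoc,
    ← mul_assoc (_ / _), ← ofReal_mul_secondTerm h1 h2 hT0, pCoeff_sub_one]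
  push_cast
  ring
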